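/- arXiv:1503.03850 — 3 statements merged into one kernel-verified Lean document; each statement's English description precedes it below -/
import Mathlib

section
/- Let N ≥ 0 and let Γ be an irreducible subgroup of Diff₊(I) such that every non-identity element of Γ has at most N fixed points in (0,1). Assume that for every ε > 0 the commutator subgroup [Γ,Γ] contains a non-identity element h with sup_{x∈[0,1]} |h(x) − x| < ε. Then every non-identity element of Γ has at most 1 fixed point in (0,1), and Γ is isomorphic to a subgroup of Aff₊(ℝ). -/
open Set

noncomputable section

/-- The group of orientation-preserving homeomorphisms of `I = [0,1]` (each fixing the
endpoints), modeled as order-isomorphisms of the unit interval. -/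
abbrev HomeoI : Type := ↥unitInterval ≃o ↥unitInterval

/-- `f` is an orientation-preserving `C¹` diffeomorphism of `I = [0,1]`:
it extends to a function `F` which is `C¹` on `[0,1]` with everywhere positive
derivative there. -/
def IsC1DiffeoI (f : HomeoI) : Prop :=
  ∃ F : ℝ → ℝ, ContDiffOn ℝ 1 F (Set.Icc 0 1) ∧ (∀ x : ↥unitInterval, F x = (f x : ℝ)) ∧
    ∀ x ∈ Set.Icc (0 : ℝ) 1, 0 < derivWithin F (Set.Icc 0 1) x

/-- The set of fixed points of `f` lying in the open interval `(0,1)`. -/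
def interiorFixedPts (f : HomeoI) : Set ↥unitInterval :=
  {x | f x = x ∧ 0 < (x : ℝ) ∧ (x : ℝ) < 1}

/-- A subgroup of homeomorphisms of `[0,1]` is irreducible if no point of `(0,1)` is
fixed by every element. -/
def IrreducibleSubgroup (Γ : Subgroup HomeoI) : Prop :=
  ∀ x : ↥unitInterval, 0 < (x : ℝ) → (x : ℝ) < 1 → ∃ f ∈ Γ, f x ≠ x

/-- The `C⁰` distance from `f` to the identity: `sup_{x ∈ [0,1]} |f(x) - x|`. -/
def c0DistId (f : HomeoI) : ℝ :=
  ⨆ x : ↥unitInterval, |(f x : ℝ) - (x : ℝ)|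

/-- `f : ℝ ≃o ℝ` is an orientation-preserving affine map `x ↦ a*x + b`, `a > 0`. -/
def IsAffinePos (f : ℝ ≃o ℝ) : Prop :=
  ∃ a b : ℝ, 0 < a ∧ ∀ x : ℝ, f x = a * x + b

/-- `Γ` is isomorphic (as an abstract group) to a subgroup of `Aff₊(ℝ)`. -/
def IsIsomorphicToAffineSubgroup (Γ : Subgroup HomeoI) : Prop :=
  ∃ φ : ↥Γ →* (ℝ ≃o ℝ), Function.Injective φ ∧ ∀ γ : ↥Γ, IsAffinePos (φ γ)

section
open Set Filter Topology
namespace Aux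

abbrev GR : Type := ℝ ≃o ℝ

/-- filter of order isomorphisms of the line close to the identity (pointwise). -/
def LF : Filter GR := ⨅ x : ℝ, comap (fun h : GR => h x) (𝓝 x)

lemma tendsto_LF {α : Type*} {l : Filter α} {F : α → GR} :
    Tendsto F l LF ↔ ∀ x, Tendsto (fun a => F a x) l (𝓝 x) := by
  simp only [LF, tendsto_iInf, tendsto_comap_iff, Function.comp_def]

lemma tendsto_eval (x : ℝ) : Tendsto (fun h : GR => h x) LF (𝓝 x) :=
  tendsto_LF.1 tendsto_id x

lemma gcont (f : GR) : Continuous f := f.continuous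

lemma tendsto_mul {α : Type*} {l : Filter α} {F G : α → GR}
    (hF : Tendsto F l LF) (hG : Tendsto G l LF) : Tendsto (fun a => F a * G a) l LF := by
  rw [tendsto_LF] at *
  intro x
  rw [tendsto_order]
  constructor
  · intro a ha
    obtain ⟨b, hab, hbx⟩ := exists_between ha
    filter_upwards [(hG x).eventually_const_lt hbx, (hF b).eventually_const_lt hab] with i h1 h2
    exact h2.trans ((F i).lt_iff_lt.2 h1)
  · intro a ha
    obtain ⟨b, hxb, hba⟩ := exists_between ha
    filter_upwards [(hG x).eventually_lt_const hxb, (hF b).eventually_lt_const hba] with i h1 h2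
    exact lt_trans ((F i).lt_iff_lt.2 h1) h2

lemma inv_lt_iff (f : GR) (x y : ℝ) : f⁻¹ x < y ↔ x < f y := by
  rw [← f.lt_iff_lt (x := f⁻¹ x), RelIso.apply_inv_self]
lemma lt_inv_iff (f : GR) (x y : ℝ) : x < f⁻¹ y ↔ f x < y := by
  rw [← f.lt_iff_lt (y := f⁻¹ y), RelIso.apply_inv_self]
lemma inv_le_iff (f : GR) (x y : ℝ) : f⁻¹ x ≤ y ↔ x ≤ f y := by
  rw [← f.le_iff_le (x := f⁻¹ x), RelIso.apply_inv_self]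
lemma le_inv_iff (f : GR) (x y : ℝ) : x ≤ f⁻¹ y ↔ f x ≤ y := by
  rw [← f.le_iff_le (y := f⁻¹ y), RelIso.apply_inv_self]

lemma tendsto_inv : Tendsto (fun h : GR => h⁻¹) LF LF := by
  rw [tendsto_LF]
  intro x
  rw [tendsto_order]
  constructor
  · intro a ha
    filter_upwards [(tendsto_eval a).eventually_lt_const ha] with h hh
    exact (lt_inv_iff h a x).2 hh
  · intro a ha
    filter_upwards [(tendsto_eval a).eventually_const_lt ha] with h hh
    exact (inv_lt_iff h x a).2 hh

lemma tendsto_conj (g : GR) : Tendsto (fun h : GR => g * h * g⁻¹) LF LF := by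
  rw [tendsto_LF]
  intro x
  have h1 := (gcont g).continuousAt.tendsto.comp (tendsto_eval (g⁻¹ x))
  have h2 : g (g⁻¹ x) = x := RelIso.apply_inv_self g x
  rw [h2] at h1
  exact h1

/-- the commutator used throughout -/
def cm (h g : GR) : GR := h⁻¹ * (g⁻¹ * h * g)

lemma cm_apply (h g : GR) (x : ℝ) : cm h g x = h⁻¹ (g⁻¹ (h (g x))) := rfl

lemma tendsto_cm (g : GR) : Tendsto (fun h : GR => cm h g) LF LF := by
  have := tendsto_conj g⁻¹
  simp only [inv_inv] at this
  exact tendsto_mul tendsto_inv this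

lemma tendsto_pow (n : ℕ) : Tendsto (fun h : GR => h ^ n) LF LF := by
  induction n with
  | zero => 
    rw [tendsto_LF]; intro x; simp only [pow_zero]; exact tendsto_const_nhds
  | succ n ih => simp only [pow_succ]; exact tendsto_mul ih tendsto_id

/-- sign lemmas -/
lemma sg_inv (f : GR) (s x : ℝ) (h : 0 < s * (f x - x)) : 0 < (-s) * (f⁻¹ x - x) := by
  rcases pos_and_pos_or_neg_and_neg_of_mul_pos h with ⟨h1, h2⟩ | ⟨h1, h2⟩
  · have : f⁻¹ x < x := (inv_lt_iff f x x).2 (by linarith)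
    nlinarith
  · have : x < f⁻¹ x := (lt_inv_iff f x x).2 (by linarith)
    nlinarith

lemma sg_cm_fix (h g : GR) (c k : ℝ) (hc : g c = c) (hk : 0 < k * (g (h c) - h c)) :
    0 < (-k) * (cm h g c - c) := by
  rw [cm_apply, hc]
  rcases pos_and_pos_or_neg_and_neg_of_mul_pos hk with ⟨h1, h2⟩ | ⟨h1, h2⟩
  · have : h⁻¹ (g⁻¹ (h c)) < c := by rw [inv_lt_iff, inv_lt_iff]; linarith
    nlinarith
  · have : c < h⁻¹ (g⁻¹ (h c)) := by rw [lt_inv_iff, lt_inv_iff]; linarith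
    nlinarith

/-- `x` is a good point: `h` has sign `s` at `x` and sign `-s` at `g x`, weakly, not both zero. -/
def Good (h g : GR) (s x : ℝ) : Prop :=
  (0 < s * (h x - x) ∧ s * (h (g x) - g x) ≤ 0) ∨ (0 ≤ s * (h x - x) ∧ s * (h (g x) - g x) < 0)

lemma sg_cm_good (h g : GR) (s x : ℝ) (hg : Good h g s x) : 0 < (-s) * (cm h g x - x) := by
  rw [cm_apply]
  rcases lt_trichotomy s 0 with hs | hs | hs
  · have : x < h⁻¹ (g⁻¹ (h (g x))) := by
      rw [lt_inv_iff]
      rcases hg with ⟨h1, h2⟩ | ⟨h1, h2⟩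
      · have a1 : h x < x := by nlinarith
        have a2 : g x ≤ h (g x) := by nlinarith
        exact lt_of_lt_of_le a1 ((le_inv_iff g _ _).2 a2)
      · have a1 : h x ≤ x := by nlinarith
        have a2 : g x < h (g x) := by nlinarith
        exact lt_of_le_of_lt a1 ((lt_inv_iff g _ _).2 a2)
    nlinarith
  · subst hs; rcases hg with ⟨h1, h2⟩ | ⟨h1, h2⟩ <;> simp at h1 h2
  · have : h⁻¹ (g⁻¹ (h (g x))) < x := by
      rw [inv_lt_iff]
      rcases hg with ⟨h1, h2⟩ | ⟨h1, h2⟩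
      · have a1 : x < h x := by nlinarith
        have a2 : h (g x) ≤ g x := by nlinarith
        exact lt_of_le_of_lt ((inv_le_iff g _ _).2 a2) a1
      · have a1 : x ≤ h x := by nlinarith
        have a2 : h (g x) < g x := by nlinarith
        exact lt_of_lt_of_le ((inv_lt_iff g _ _).2 a2) a1
    nlinarith

/-- alternation on `k` points -/
def Alt (h : GR) (k : ℕ) (p : ℕ → ℝ) : Prop :=
  ∃ s : ℝ, ∀ i < k, 0 < s * (-1) ^ i * (h (p i) - p i)

def Inc (k : ℕ) (p : ℕ → ℝ) : Prop := ∀ i j, i < j → j < k → p i < p j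

lemma inc_of_step (k : ℕ) (p : ℕ → ℝ) (h : ∀ i, i + 1 < k → p i < p (i+1)) : Inc k p := by
  intro i j hij
  induction j, hij using Nat.le_induction with
  | base => exact h i
  | succ n hn ih => intro hk; exact (ih (by omega)).trans (h n hk)

/-- hypotheses on a group -/
def Bd (N : ℕ) (G : Subgroup GR) : Prop := ∀ f ∈ G, f ≠ 1 → {x | f x = x}.encard ≤ (N : ℕ∞)
def Irr (G : Subgroup GR) : Prop := ∀ x, ∃ f ∈ G, f x ≠ x
def ND (G : Subgroup GR) : Prop := ∃ᶠ h in LF, h ∈ G ∧ h ≠ 1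

lemma Bd.fin {N : ℕ} {G : Subgroup GR} (h : Bd N G) {f : GR} (hf : f ∈ G) (h1 : f ≠ 1) :
    {x | f x = x}.Finite := Set.finite_of_encard_le_coe (h f hf h1)

lemma Bd.inj {N : ℕ} {G : Subgroup GR} (h : Bd N G) {f : GR} (hf : f ∈ G) 
    (S : Finset ℝ) (hS : ∀ x ∈ S, f x = x) (hc : N < S.card) : f = 1 := by
  by_contra h1
  have h2 := h f hf h1
  have h3 : (S : Set ℝ).encard ≤ {x | f x = x}.encard := Set.encard_le_encard (fun x hx => hS x hx)
  rw [Set.encard_coe_eq_coe_finsetCard] at h3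
  have := h3.trans h2
  norm_cast at this
  omega

lemma ivt (f : ℝ → ℝ) (hf : Continuous f) (a b : ℝ) (hab : a < b) (h : f a * f b < 0) : 
    ∃ c, a < c ∧ c < b ∧ f c = 0 := by
  rcases mul_neg_iff.1 h with ⟨h1, h2⟩ | ⟨h1, h2⟩
  · obtain ⟨c, hc, hc'⟩ := intermediate_value_Ioo' hab.le hf.continuousOn (show (0:ℝ) ∈ Ioo (f b) (f a) from ⟨h2, h1⟩)
    exact ⟨c, hc.1, hc.2, hc'⟩
  · obtain ⟨c, hc, hc'⟩ := intermediate_value_Ioo hab.le hf.continuousOn (show (0:ℝ) ∈ Ioo (f a) (f b) from ⟨h1, h2⟩)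
    exact ⟨c, hc.1, hc.2, hc'⟩

lemma dcont (f : GR) : Continuous (fun x => f x - x) := (gcont f).sub continuous_id

lemma alt_bound {N : ℕ} {G : Subgroup GR} (hB : Bd N G) {f : GR} (hf : f ∈ G) {k : ℕ} {p : ℕ → ℝ}
    (hp : Inc k p) (ha : Alt f k p) : k ≤ N + 1 := by
  by_contra hk
  push Not at hk
  obtain ⟨s, hs⟩ := ha
  have : ∀ i : ℕ, ∃ c, i + 1 < k → p i < c ∧ c < p (i+1) ∧ f c - c = 0 := by
    intro i
    by_cases hi : i + 1 < k
    · obtain ⟨c, h⟩ := ivt _ (dcont f) (p i) (p (i+1)) (hp i (i+1) (by omega) hi) (by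
        have h1 := hs i (by omega)
        have h2 := hs (i+1) hi
        rw [pow_succ] at h2
        have h3 := mul_pos h1 h2
        have h4 : ((-1:ℝ)^i)^2 = 1 := by rw [← pow_mul, mul_comm, pow_mul]; norm_num
        have h5 : s * (-1) ^ i * (f (p i) - p i) * (s * ((-1) ^ i * -1) * (f (p (i + 1)) - p (i + 1))) = 
          - s^2 * ((-1:ℝ)^i)^2 * ((f (p i) - p i) * (f (p (i + 1)) - p (i + 1))) := by ring
        rw [h5, h4] at h3
        by_contra hn
        push Not at hn
        nlinarith [mul_nonneg (sq_nonneg s) hn])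
      exact ⟨c, fun _ => h⟩
    · exact ⟨0, fun h => absurd h hi⟩
  choose c hc using this
  have hinc : Inc (k-1) c := by
    apply inc_of_step
    intro i hi
    exact (hc i (by omega)).2.1.trans (hc (i+1) (by omega)).1
  have h1 : f = 1 := by
    apply hB.inj hf ((Finset.range (k-1)).image c)
    · intro x hx
      simp only [Finset.mem_image, Finset.mem_range] at hx
      obtain ⟨i, hi, rfl⟩ := hx
      have := (hc i (by omega)).2.2
      linarith
    · rw [Finset.card_image_of_injOn, Finset.card_range]
      · omega
      · intro i hi j hj hij
        simp only [Finset.coe_range, Set.mem_Iio] at hi hj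
        rcases lt_trichotomy i j with h | h | h
        · exact absurd hij (hinc i j h hj).ne
        · exact h
        · exact absurd hij (hinc j i h hi).ne'
  have h0 := hs 0 (by omega)
  rw [h1] at h0
  simp at h0

/-- crossing zero -/
def Cross (g : GR) (e c : ℝ) : Prop :=
  g c = c ∧ ∀ᶠ y in 𝓝 c, (c < y → 0 < e * (g y - y)) ∧ (y < c → 0 < (-e) * (g y - y))

lemma exists_cross (φ : ℝ → ℝ) (hφ : Continuous φ) (hfin : {x | φ x = 0}.Finite) (a b : ℝ)
    (hab : a < b) (ha : φ a < 0) (hb : 0 < φ b) : 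
    ∃ c, a < c ∧ c < b ∧ φ c = 0 ∧ ∀ᶠ y in 𝓝 c, (c < y → 0 < φ y) ∧ (y < c → φ y < 0) := by
  set S := {x | a ≤ x ∧ x ≤ b ∧ φ x < 0} with hS
  have hne : S.Nonempty := ⟨a, le_rfl, hab.le, ha⟩
  have hbd : BddAbove S := ⟨b, fun x hx => hx.2.1⟩
  set c := sSup S with hc
  have hac : a ≤ c := le_csSup hbd ⟨le_rfl, hab.le, ha⟩
  have hcb : c ≤ b := csSup_le hne (fun x hx => hx.2.1)
  have hright : ∀ y, c < y → y ≤ b → 0 ≤ φ y := by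
    intro y hy hyb
    by_contra h
    push Not at h
    exact absurd (le_csSup hbd ⟨hac.trans hy.le, hyb, h⟩) (not_le.2 hy)
  have hle : φ c ≤ 0 := by
    have hcl : c ∈ closure S := csSup_mem_closure hne hbd
    have : S ⊆ {x | φ x ≤ 0} := fun x hx => hx.2.2.le
    exact closure_minimal this (isClosed_le hφ continuous_const) hcl
  have hcb' : c < b := lt_of_le_of_ne hcb (fun h => by rw [h] at hle; linarith)
  have hge : 0 ≤ φ c := by
    by_contra h
    push Not at h
    have : ∀ᶠ y in 𝓝 c, φ y < 0 := hφ.continuousAt.eventually_lt_const h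
    have h2 : ∀ᶠ y in 𝓝[>] c, φ y < 0 := this.filter_mono nhdsWithin_le_nhds
    have h3 : ∀ᶠ y in 𝓝[>] c, y ∈ Ioo c b := Ioo_mem_nhdsGT hcb'
    obtain ⟨y, h4, h5⟩ := (h2.and h3).exists
    linarith [hright y h5.1 h5.2.le]
  have h0 : φ c = 0 := le_antisymm hle hge
  have hac' : a < c := lt_of_le_of_ne hac (fun h => by rw [← h] at h0; linarith)
  have hz : ∀ᶠ y in 𝓝 c, y ≠ c → φ y ≠ 0 := by
    have hfin' : ({x | φ x = 0} \ {c}).Finite := hfin.subset sdiff_subset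
    have := hfin'.isClosed.isOpen_compl.mem_nhds (show c ∈ ({x | φ x = 0} \ {c})ᶜ by simp)
    filter_upwards [this] with y hy hyc h
    exact hy ⟨h, hyc⟩
  obtain ⟨l, r, hlr, hsub⟩ := mem_nhds_iff_exists_Ioo_subset.1 hz
  refine ⟨c, hac', hcb', h0, ?_⟩
  filter_upwards [Ioo_mem_nhds hlr.1 hlr.2, Ioo_mem_nhds hac' hcb'] with y hy hy2
  constructor
  · intro h
    exact lt_of_le_of_ne (hright y h hy2.2.le) (Ne.symm (hsub hy h.ne'))
  · intro h
    by_contra hn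
    push Not at hn
    have hpos : 0 < φ y := lt_of_le_of_ne hn (Ne.symm (hsub hy h.ne))
    obtain ⟨z, hzS, hyz⟩ := exists_lt_of_lt_csSup hne h
    have hzc : z < c := lt_of_le_of_ne (le_csSup hbd hzS) (fun h => by 
      have := hzS.2.2
      rw [h] at this; linarith)
    obtain ⟨w, hw1, hw2, hw3⟩ := ivt φ hφ y z hyz (mul_neg_of_pos_of_neg hpos hzS.2.2)
    exact hsub ⟨hy.1.trans hw1, (hw2.trans hzc).trans hlr.2⟩ (hw2.trans hzc).ne hw3

lemma exists_Cross {N : ℕ} {G : Subgroup GR} (hB : Bd N G) {f : GR} (hf : f ∈ G) (e a b : ℝ)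
    (hab : a < b) (ha : 0 < (-e) * (f a - a)) (hb : 0 < e * (f b - b)) : 
    ∃ c, a < c ∧ c < b ∧ Cross f e c := by
  have he : e ≠ 0 := by rintro rfl; simp at hb
  have h1 : f ≠ 1 := by rintro rfl; simp at hb
  obtain ⟨c, h1, h2, h3, h4⟩ := exists_cross (fun x => e * (f x - x)) ((dcont f).const_mul e |>.congr (fun x => rfl))
    (by 
      refine (hB.fin hf h1).subset ?_
      intro x hx
      have h := (mul_eq_zero.1 hx).resolve_left he
      show f x = x
      linarith) a b hab (by show e * (f a - a) < 0; nlinarith) hb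
  refine ⟨c, h1, h2, ?_, ?_⟩
  · have h := (mul_eq_zero.1 h3).resolve_left he
    linarith
  · filter_upwards [h4] with y hy
    exact ⟨hy.1, fun h => by have := hy.2 h; linarith⟩

lemma Cross.inv {g : GR} {e c : ℝ} (h : Cross g e c) : Cross g⁻¹ (-e) c := by
  refine ⟨?_, ?_⟩
  · rw [← h.1, RelIso.inv_apply_self, h.1]
  · filter_upwards [h.2] with y hy
    exact ⟨fun h' => sg_inv g e y (hy.1 h'), fun h' => sg_inv g (-e) y (hy.2 h')⟩

lemma Cross.ev {g : GR} {e c : ℝ} (h : Cross g e c) :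
    ∀ᶠ u : GR in LF, ∀ s : ℝ, 0 < s * (u c - c) → 0 < (-(e * s)) * (cm u g c - c) := by
  filter_upwards [(tendsto_eval c).eventually h.2] with u hu s hs
  apply sg_cm_fix _ _ _ _ h.1
  rcases pos_and_pos_or_neg_and_neg_of_mul_pos hs with ⟨h1, h2⟩ | ⟨h1, h2⟩
  · have := hu.1 (by linarith); nlinarith
  · have := hu.2 (by linarith); nlinarith

/-- escape lemma -/
lemma escape (f : GR) (a b : ℝ) (h : ∀ x, a ≤ x → x ≤ b → x < f x) : ∃ n : ℕ, b < (f ^ n) a := by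
  by_contra hn
  push Not at hn
  set S := range (fun n : ℕ => (f ^ n) a) with hS
  have hne : S.Nonempty := ⟨_, 0, rfl⟩
  have hbd : BddAbove S := ⟨b, by rintro _ ⟨n, rfl⟩; exact hn n⟩
  set c := sSup S with hc
  have hac : a ≤ c := le_csSup hbd ⟨0, by simp⟩
  have hcb : c ≤ b := csSup_le hne (by rintro _ ⟨n, rfl⟩; exact hn n)
  have h1 := h c hac hcb
  have h2 : f⁻¹ c < c := (inv_lt_iff _ _ _).2 h1
  obtain ⟨_, ⟨n, rfl⟩, hlt⟩ := exists_lt_of_lt_csSup hne h2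
  rw [inv_lt_iff] at hlt
  have h3 : (f ^ (n+1)) a ≤ c := le_csSup hbd ⟨n+1, rfl⟩
  rw [pow_succ', RelIso.mul_apply] at h3
  linarith

lemma pow_gt (f : GR) (x : ℝ) (h : x < f x) (n : ℕ) : x < (f ^ (n+1)) x := by
  induction n with
  | zero => simpa using h
  | succ n ih =>
    rw [pow_succ', RelIso.mul_apply]
    exact h.trans (f.lt_iff_lt.2 ih)

lemma sg_pow (f : GR) (s x : ℝ) (h : 0 < s * (f x - x)) (n : ℕ) : 0 < s * ((f ^ (n+1)) x - x) := by
  rcases pos_and_pos_or_neg_and_neg_of_mul_pos h with ⟨h1, h2⟩ | ⟨h1, h2⟩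
  · have := pow_gt f x (by linarith) n
    nlinarith
  · have h3 := pow_gt f⁻¹ x ((lt_inv_iff _ _ _).2 (by linarith)) n
    rw [inv_pow, lt_inv_iff] at h3
    nlinarith

lemma Cross.pow {g : GR} {e c : ℝ} (h : Cross g e c) (n : ℕ) : Cross (g ^ (n+1)) e c := by
  refine ⟨?_, ?_⟩
  · have : ∀ m : ℕ, (g ^ m) c = c := by
      intro m
      induction m with
      | zero => simp
      | succ m ih => rw [pow_succ', RelIso.mul_apply, ih, h.1]
    exact this _
  · filter_upwards [h.2] with y hy
    exact ⟨fun h' => sg_pow g e y (hy.1 h') n, fun h' => sg_pow g (-e) y (hy.2 h') n⟩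

/-- pushing -/
lemma push {G : Subgroup GR} (hI : Irr G) (x y : ℝ) : ∃ g ∈ G, y < g x := by
  by_contra hn
  push Not at hn
  set S := {z | ∃ g ∈ G, z = g x} with hS
  have hne : S.Nonempty := ⟨_, 1, G.one_mem, rfl⟩
  have hbd : BddAbove S := ⟨y, by rintro _ ⟨g, hg, rfl⟩; exact hn g hg⟩
  have key : ∀ g ∈ G, g (sSup S) ≤ sSup S := by
    intro g hg
    by_contra h
    push Not at h
    have h2 := (inv_lt_iff g _ _).2 h
    obtain ⟨_, ⟨k, hk, rfl⟩, hlt⟩ := exists_lt_of_lt_csSup hne h2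
    rw [inv_lt_iff] at hlt
    have := le_csSup hbd (show g (k x) ∈ S from ⟨g * k, G.mul_mem hg hk, rfl⟩)
    linarith
  obtain ⟨f, hf, hfx⟩ := hI (sSup S)
  apply hfx
  apply le_antisymm (key f hf)
  have := key f⁻¹ (G.inv_mem hf)
  rwa [inv_le_iff] at this

lemma exists_seq {G : Subgroup GR} (hI : Irr G) (u v : ℝ) (huv : u ≤ v) : ∃ g : ℕ → GR, (∀ j, g j ∈ G) ∧
    (∀ j, v < g j u) ∧ ∀ i j, i < j → g i v < g j u ∧ (g j)⁻¹ v < (g i)⁻¹ u := by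
  have hstep : ∀ g0 : GR, ∃ g ∈ G, v < g u ∧ g0 v < g u ∧ v < g (g0⁻¹ u) := by
    intro g0
    obtain ⟨g, hg, h⟩ := push hI (min u (g0⁻¹ u)) (max v (g0 v))
    refine ⟨g, hg, ?_, ?_, ?_⟩
    · exact (le_max_left _ _).trans_lt (h.trans_le (g.le_iff_le.2 (min_le_left _ _)))
    · exact (le_max_right _ _).trans_lt (h.trans_le (g.le_iff_le.2 (min_le_left _ _)))
    · exact (le_max_left _ _).trans_lt (h.trans_le (g.le_iff_le.2 (min_le_right _ _)))
  choose F hF using hstep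
  let g : ℕ → GR := fun n => Nat.rec (F 1) (fun _ x => F x) n
  have hg1 : ∀ n, g (n+1) = F (g n) := fun n => rfl
  have hg0 : ∀ n, ∃ x, g n = F x := by
    intro n; cases n with
    | zero => exact ⟨1, rfl⟩
    | succ n => exact ⟨_, hg1 n⟩
  refine ⟨g, ?_, ?_, ?_⟩
  · intro j; obtain ⟨x, hx⟩ := hg0 j; rw [hx]; exact (hF x).1
  · intro j; obtain ⟨x, hx⟩ := hg0 j; rw [hx]; exact (hF x).2.1
  · have hv : ∀ j, v < g j u := by intro j; obtain ⟨x, hx⟩ := hg0 j; rw [hx]; exact (hF x).2.1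
    intro i j hij
    induction j, hij using Nat.le_induction with
    | base =>
      rw [hg1]
      refine ⟨(hF _).2.2.1, ?_⟩
      rw [inv_lt_iff]; exact (hF _).2.2.2
    | succ n hn ih =>
      rw [hg1]
      have h1 := (hF (g n)).2.2.1
      have h2 := (hF (g n)).2.2.2
      constructor
      · exact ih.1.trans (((g n).le_iff_le.2 huv).trans_lt h1)
      · have h3 : (F (g n))⁻¹ v < (g n)⁻¹ u := by rw [inv_lt_iff]; exact h2
        exact h3.trans ((((g n)⁻¹).le_iff_le.2 huv).trans_lt ih.2)


end Aux
end

section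
open Set Filter Topology
namespace Aux

def KM (G : Subgroup GR) (k : ℕ) (P : ℕ → ℝ) : Prop :=
  ∃ᶠ h in LF, h ∈ G ∧ h ≠ 1 ∧ Alt h k P
def Mx (G : Subgroup GR) (k : ℕ) : Prop :=
  ∀ t, Inc (k+1) t → ∀ᶠ h in LF, h ∈ G → ¬ Alt h (k+1) t

lemma exists_km {N : ℕ} {G : Subgroup GR} (hB : Bd N G) (hN : ND G) :
    ∃ k, 1 ≤ k ∧ Mx G k ∧ ∃ P, Inc k P ∧ KM G k P := by
  classical
  have hbound : ∀ k P, Inc k P → KM G k P → k ≤ N + 1 := by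
    intro k P hP hk
    obtain ⟨h, h1, h2, h3⟩ := hk.exists
    exact alt_bound hB h1 hP h3
  have h0 : ∃ P, Inc 0 P ∧ KM G 0 P := ⟨fun _ => 0, fun i j _ h => by omega, 
    hN.mono (fun h hh => ⟨hh.1, hh.2, 0, fun i hi => by omega⟩)⟩
  have hex : ∃ k, (∃ P, Inc k P ∧ KM G k P) ∧ ¬ (∃ P, Inc (k+1) P ∧ KM G (k+1) P) := by
    by_contra hn
    push Not at hn
    have : ∀ k, ∃ P, Inc k P ∧ KM G k P := by
      intro k
      induction k with
      | zero => exact h0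
      | succ k ih => exact hn k ih
    obtain ⟨P, h1, h2⟩ := this (N+2)
    have := hbound _ _ h1 h2
    omega
  obtain ⟨k, hk, hk2⟩ := hex
  have hmx : Mx G k := by
    intro t ht
    by_contra hn
    apply hk2
    refine ⟨t, ht, ?_⟩
    rw [not_eventually] at hn
    refine hn.mono ?_
    intro h hh
    push Not at hh
    refine ⟨hh.1, ?_, hh.2⟩
    rintro rfl
    obtain ⟨s, hs⟩ := hh.2
    have := hs 0 (by omega)
    simp at this
  refine ⟨k, ?_, hmx, hk⟩
  by_contra hk0
  obtain rfl : k = 0 := by omega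
  have : ∀ᶠ h in LF, ∀ i ∈ Finset.range (N+1), h ∈ G → ¬ Alt h 1 (fun _ => (i:ℝ)) := by
    rw [Finset.eventually_all]
    intro i _
    exact hmx _ (fun i j _ h => by omega)
  obtain ⟨h, ⟨h1, h2⟩, h3⟩ := (hN.and_eventually this).exists
  apply h2
  apply hB.inj h1 ((Finset.range (N+1)).image (fun i : ℕ => (i:ℝ)))
  · intro x hx
    simp only [Finset.mem_image] at hx
    obtain ⟨i, hi, rfl⟩ := hx
    by_contra hne
    apply h3 i hi h1
    refine ⟨h i - i, ?_⟩
    intro j hj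
    obtain rfl : j = 0 := by omega
    simp only [pow_zero, mul_one]
    exact mul_self_pos.2 (sub_ne_zero.2 hne)
  · rw [Finset.card_image_of_injective _ Nat.cast_injective]; simp

lemma pigeon {N : ℕ} {G : Subgroup GR} (hB : Bd N G) {k : ℕ} {P : ℕ → ℝ} (hK : KM G k P)
    (u v : ℝ) (A : Finset ℝ) (hA : ∀ a ∈ A, u ≤ a ∧ a ≤ v) (g : ℕ → GR) (hg : ∀ j, g j ∈ G)
    (hg2 : ∀ i j, i < j → (g j)⁻¹ v < (g i)⁻¹ u) (J : Finset ℕ) (hJ : A.card * N < J.card)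
    (H : ∀ j ∈ J, ∀ᶠ h in LF, h ∈ G → Alt h k (fun i => g j (P i)) → (∀ a ∈ A, h a ≠ a) → False) :
    False := by
  classical
  have : ∀ᶠ h in LF, ∀ j ∈ J, g j * h * (g j)⁻¹ ∈ G → Alt (g j * h * (g j)⁻¹) k (fun i => g j (P i)) → 
      (∀ a ∈ A, (g j * h * (g j)⁻¹) a ≠ a) → False := by
    rw [Finset.eventually_all]
    intro j hj
    exact (tendsto_conj (g j)).eventually (H j hj)
  obtain ⟨h, ⟨h1, h2, s, h3⟩, h4⟩ := (hK.and_eventually this).exists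
  have hex : ∀ j ∈ J, ∃ a ∈ A, h ((g j)⁻¹ a) = (g j)⁻¹ a := by
    intro j hj
    have h5 := h4 j hj (G.mul_mem (G.mul_mem (hg j) h1) (G.inv_mem (hg j)))
    by_contra hn
    push Not at hn
    apply h5
    · refine ⟨s, fun i hi => ?_⟩
      have h6 := h3 i hi
      simp only [RelIso.mul_apply, RelIso.inv_apply_self]
      rcases pos_and_pos_or_neg_and_neg_of_mul_pos h6 with ⟨a1, a2⟩ | ⟨a1, a2⟩
      · apply mul_pos a1; rw [sub_pos] at *; exact (g j).lt_iff_lt.2 a2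
      · apply mul_pos_of_neg_of_neg a1; rw [sub_neg] at *; exact (g j).lt_iff_lt.2 a2
    · intro a ha he
      apply hn a ha
      simp only [RelIso.mul_apply] at he
      apply (g j).injective
      rw [he, RelIso.apply_inv_self]
  choose! α hα1 hα2 using hex
  obtain ⟨a, ha, hcard⟩ := Finset.exists_lt_card_fiber_of_mul_lt_card_of_maps_to hα1 hJ
  apply h2
  apply hB.inj h1 ((J.filter (fun j => α j = a)).image (fun j => (g j)⁻¹ a))
  · intro x hx
    simp only [Finset.mem_image, Finset.mem_filter] at hx
    obtain ⟨j, ⟨hj, rfl⟩, rfl⟩ := hx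
    exact hα2 j hj
  · rw [Finset.card_image_of_injective]
    · exact hcard
    · have hlt : ∀ i j, i < j → (g j)⁻¹ a < (g i)⁻¹ a := by
        intro i j hij
        exact (((g j)⁻¹).le_iff_le.2 (hA a ha).2).trans_lt ((hg2 i j hij).trans_le (((g i)⁻¹).le_iff_le.2 (hA a ha).1))
      intro i j hij
      rcases lt_trichotomy i j with h | h | h
      · exact absurd hij (hlt i j h).ne'
      · exact h
      · exact absurd hij (hlt j i h).ne

def cons (c : ℝ) (Q : ℕ → ℝ) : ℕ → ℝ
  | 0 => c
  | (i+1) => Q i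

lemma inc_cons {k : ℕ} {c : ℝ} {Q : ℕ → ℝ} (hQ : Inc k Q) (hc : c < Q 0) : Inc (k+1) (cons c Q) := by
  apply inc_of_step
  intro i hi
  cases i with
  | zero => exact hc
  | succ i => exact hQ i (i+1) (by omega) (by omega)

lemma sgn_at {G : Subgroup GR} {k : ℕ} (hk : 1 ≤ k) (hM : Mx G k) {Q : ℕ → ℝ} (hQ : Inc k Q) {c : ℝ} (hc : c < Q 0) :
    ∀ᶠ h in LF, h ∈ G → ∀ s : ℝ, (∀ i < k, 0 < s * (-1)^i * (h (Q i) - Q i)) → h c ≠ c → 0 < s * (h c - c) := by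
  filter_upwards [hM _ (inc_cons hQ hc)] with h hh hG s hs hne
  by_contra hn
  push Not at hn
  have hs0 : s ≠ 0 := by rintro rfl; have := hs 0 (by omega); simp at this
  have : s * (h c - c) < 0 := lt_of_le_of_ne hn (mul_ne_zero hs0 (sub_ne_zero.2 hne))
  apply hh hG
  refine ⟨-s, ?_⟩
  intro i hi
  cases i with
  | zero => simp only [cons, pow_zero]; linarith
  | succ i => have := hs i (by omega); simp only [cons, pow_succ]; linarith

lemma cm_mem {G : Subgroup GR} {h g : GR} (hh : h ∈ G) (hg : g ∈ G) : cm h g ∈ G :=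
  G.mul_mem (G.inv_mem hh) (G.mul_mem (G.mul_mem (G.inv_mem hg) hh) hg)

lemma case_le3 {G : Subgroup GR} {k : ℕ} (hk : 1 ≤ k) (hk3 : k ≤ 3) (hM : Mx G k)
    {f : GR} (hf : f ∈ G) {a : ℕ → ℝ} (ha : Inc 3 a) (hac : ∀ i < 3, Cross f ((-1)^i) (a i)) {p3 : ℝ}
    (hap : ∀ i < 3, a i < p3) (hfp : ∀ x, p3 ≤ x → x < f x) {Q : ℕ → ℝ} (hQ : Inc k Q) (hQ0 : p3 < Q 0) : 
    ∀ᶠ h in LF, h ∈ G → Alt h k Q → (∀ i < 3, h (a i) ≠ a i) → False := by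
  have e1 : ∀ᶠ h in LF, ∀ i ∈ Finset.range 3, h ∈ G → ∀ s : ℝ, (∀ j < k, 0 < s * (-1)^j * (h (Q j) - Q j)) → h (a i) ≠ a i → 0 < s * (h (a i) - a i) := by
    rw [Finset.eventually_all]
    intro i hi
    exact sgn_at hk hM hQ ((hap i (by simpa using hi)).trans hQ0)
  by_cases hk2 : k ≤ 2
  · have e2 : ∀ᶠ h in LF, ∀ i ∈ Finset.range 3, ∀ s : ℝ, 0 < s * (h (a i) - a i) → 0 < (-((-1)^i * s)) * (cm h f (a i) - a i) := by
      rw [Finset.eventually_all]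
      intro i hi
      exact (hac i (by simpa using hi)).ev
    have e3 := (tendsto_cm f).eventually (hM a (fun i j hij hj => ha i j hij (by omega)))
    filter_upwards [e1, e2, e3] with h h1 h2 h3 hG ⟨s, hs⟩ hne
    apply h3 (cm_mem hG hf)
    refine ⟨-s, fun i hi => ?_⟩
    have hi3 : i ∈ Finset.range 3 := by rw [Finset.mem_range]; omega
    have := h2 i hi3 s (h1 i hi3 hG s hs (hne i (by omega)))
    calc 0 < _ := this
      _ = _ := by ring
  · obtain rfl : k = 3 := by omega
    have q01 := hQ 0 1 (by omega) (by omega)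
    have q12 := hQ 1 2 (by omega) (by omega)
    obtain ⟨n, hn⟩ := escape f (Q 1) (Q 2) (fun x hx _ => hfp x (by linarith))
    cases n with
    | zero => simp at hn; linarith
    | succ n => 
    set F := f ^ (n+1) with hF
    have hFG : F ∈ G := G.pow_mem hf _
    have e2 : ∀ᶠ h in LF, ∀ i ∈ Finset.range 3, ∀ s : ℝ, 0 < s * (h (a i) - a i) → 0 < (-((-1)^i * s)) * (cm h F (a i) - a i) := by
      rw [Finset.eventually_all]
      intro i hi
      exact ((hac i (by simpa using hi)).pow n).ev
    let t : ℕ → ℝ := fun i => if i < 3 then Q i else F (Q 1)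
    have e4 := hM t (by
      apply inc_of_step
      intro i hi
      have : i = 0 ∨ i = 1 ∨ i = 2 := by omega
      rcases this with rfl | rfl | rfl
      · simpa [t] using q01
      · simpa [t] using q12
      · simpa [t] using hn)
    let t' : ℕ → ℝ := fun i => if i < 3 then a i else (Q 1)
    have e3 := (tendsto_cm F).eventually (hM t' (by
      apply inc_of_step
      intro i hi
      have : i = 0 ∨ i = 1 ∨ i = 2 := by omega
      rcases this with rfl | rfl | rfl
      · simpa [t'] using ha 0 1 (by omega) (by omega)
      · simpa [t'] using ha 1 2 (by omega) (by omega)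
      · simpa [t'] using (hap 2 (by omega)).trans (by linarith)))
    filter_upwards [e1, e2, e3, e4] with h h1 h2 h3 h4 hG ⟨s, hs⟩ hne
    have hgood : Good h F (-s) (Q 1) := by
      left
      have s1 := hs 1 (by omega)
      refine ⟨by linarith, ?_⟩
      by_contra hn
      push Not at hn
      apply h4 hG
      refine ⟨s, fun i hi => ?_⟩
      have : i < 3 ∨ i = 3 := by omega
      rcases this with hi3 | rfl
      · simpa [t, hi3] using hs i hi3
      · simp only [t, lt_irrefl, if_false]; linarith
    have hg := sg_cm_good h F (-s) (Q 1) hgood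
    apply h3 (cm_mem hG hFG)
    refine ⟨-s, fun i hi => ?_⟩
    have : i < 3 ∨ i = 3 := by omega
    rcases this with hi3 | rfl
    · have hi3' : i ∈ Finset.range 3 := by rw [Finset.mem_range]; omega
      have := h2 i hi3' s (h1 i hi3' hG s hs (hne i (by omega)))
      simp only [t', hi3, if_true]
      calc 0 < _ := this
        _ = _ := by ring
    · simp only [t', lt_irrefl, if_false]
      linarith

lemma step {G : Subgroup GR} {k : ℕ} (hM : Mx G k) {γ : GR} {q q' : ℝ} (hqq : q < q')
    (hγ : ∀ x, q ≤ x → x ≤ q' → x < γ x) (hm : ∀ m ≤ k, (γ ^ m) q < q') : 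
    ∃ S : Finset ℝ, (∀ x ∈ S, q ≤ x ∧ x < q') ∧ ∀ᶠ h in LF, h ∈ G → ∀ σ : ℝ, 0 < σ * (h q - q) →
      0 < (-σ) * (h q' - q') → ∃ x ∈ S, Good h γ σ x := by
  classical
  have hex := escape γ q q' hγ
  obtain ⟨R, hR⟩ : ∃ R, Nat.find hex = R + 1 := by
    apply Nat.exists_eq_succ_of_ne_zero
    intro h0
    have := Nat.find_spec hex
    rw [h0] at this
    simp at this; linarith
  have hR1 : q' < (γ ^ (R+1)) q := by have := Nat.find_spec hex; rwa [hR] at this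
  have hR2 : (γ ^ R) q ≤ q' := by
    have := Nat.find_min hex (m := R) (by omega)
    exact not_lt.1 this
  have hkR : k ≤ R := by
    by_contra h
    have := hm (R+1) (by omega)
    linarith
  set z := (γ ^ R)⁻¹ q' with hz
  have hqz : q ≤ z := (le_inv_iff _ _ _).2 hR2
  have hzq : z < γ q := by
    rw [hz, inv_lt_iff]
    rw [pow_succ, RelIso.mul_apply] at hR1
    exact hR1
  have hzR : (γ ^ R) z = q' := RelIso.apply_inv_self _ _
  have hq_mono : ∀ j, j < R → q ≤ (γ ^ j) q ∧ (γ ^ j) q < q' := by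
    intro j hj
    have h1 : q < γ q := hγ q le_rfl hqq.le
    constructor
    · cases j with
      | zero => simp
      | succ j => exact (pow_gt γ q h1 j).le
    · obtain ⟨d, rfl⟩ := Nat.exists_eq_add_of_lt hj
      refine lt_of_lt_of_le ?_ hR2
      rw [add_assoc, pow_add, RelIso.mul_apply]
      exact (γ ^ j).lt_iff_lt.2 (pow_gt γ q h1 d)
  have hz_mono : ∀ j, j < R → q ≤ (γ ^ j) z ∧ (γ ^ j) z < q' := by
    intro j hj
    have h1 : z < γ z := by
      apply hγ z hqz
      rcases Nat.eq_zero_or_pos R with h | h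
      · omega
      · refine hzq.le.trans (le_trans ?_ hR2)
        obtain ⟨d, rfl⟩ := Nat.exists_eq_succ_of_ne_zero h.ne'
        rcases Nat.eq_zero_or_pos d with rfl | hd
        · simp
        · obtain ⟨e, rfl⟩ := Nat.exists_eq_succ_of_ne_zero hd.ne'
          rw [pow_succ' , RelIso.mul_apply]
          exact γ.le_iff_le.2 (pow_gt γ q (hγ q le_rfl hqq.le) e).le
    constructor
    · cases j with
      | zero => simpa using hqz
      | succ j => exact hqz.trans (pow_gt γ z h1 j).le
    · obtain ⟨d, rfl⟩ := Nat.exists_eq_add_of_lt hj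
      rw [← hzR, add_assoc, pow_add, RelIso.mul_apply]
      exact (γ ^ j).lt_iff_lt.2 (pow_gt γ z h1 d)
  let S : Finset ℝ := (Finset.range R).image (fun j => (γ ^ j) q) ∪ (Finset.range R).image (fun j => (γ ^ j) z)
  refine ⟨S, ?_, ?_⟩
  · intro x hx
    simp only [S, Finset.mem_union, Finset.mem_image, Finset.mem_range] at hx
    rcases hx with ⟨j, hj, rfl⟩ | ⟨j, hj, rfl⟩
    · exact hq_mono j hj
    · exact hz_mono j hj
  have main : ∀ h : GR, ∀ σ : ℝ, 0 < σ * (h q - q) → 0 < (-σ) * (h q' - q') → (¬ ∃ x ∈ S, Good h γ σ x) →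
      (∀ j ≤ R, 0 < σ * (h ((γ ^ j) q) - (γ ^ j) q)) ∧ (∀ j ≤ R, σ * (h ((γ ^ j) z) - (γ ^ j) z) < 0) := by
    intro h σ h1 h2 hn
    push Not at hn
    constructor
    · intro j
      induction j with
      | zero => intro _; simpa using h1
      | succ j ih =>
        intro hj
        have h3 := ih (by omega)
        have h4 := hn ((γ ^ j) q) (by simp only [S, Finset.mem_union, Finset.mem_image, Finset.mem_range]; left; exact ⟨j, by omega, rfl⟩)
        by_contra h5
        push Not at h5
        rw [pow_succ', RelIso.mul_apply] at h5
        exact h4 (Or.inl ⟨h3, h5⟩)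
    · have : ∀ i ≤ R, σ * (h ((γ ^ (R - i)) z) - (γ ^ (R-i)) z) < 0 := by
        intro i
        induction i with
        | zero => intro _; simp only [Nat.sub_zero, hzR]; linarith
        | succ i ih =>
          intro hi
          have h3 := ih (by omega)
          have h4 := hn ((γ ^ (R - (i+1))) z) (by simp only [S, Finset.mem_union, Finset.mem_image, Finset.mem_range]; right; exact ⟨R - (i+1), by omega, rfl⟩)
          by_contra h5
          push Not at h5
          have h6 : R - i = R - (i+1) + 1 := by omega
          rw [h6, pow_succ', RelIso.mul_apply] at h3
          exact h4 (Or.inr ⟨h5, h3⟩)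
      intro j hj
      have := this (R - j) (by omega)
      rwa [show R - (R - j) = j by omega] at this
  rcases hqz.eq_or_lt with hqz' | hqz'
  · refine Eventually.of_forall ?_
    intro h hG σ h1 h2
    by_contra hn
    obtain ⟨h3, h4⟩ := main h σ h1 h2 hn
    have h5 := h3 0 (by omega)
    have h6 := h4 0 (by omega)
    rw [← hqz'] at h6
    linarith
  · let e : ℕ → ℝ := fun i => if i % 2 = 0 then (γ ^ (i/2)) q else (γ ^ (i/2)) z
    have hinc : Inc (k+1) e := by
      apply inc_of_step
      intro i hi
      rcases Nat.even_or_odd' i with ⟨j, rfl | rfl⟩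
      · simp only [e]
        rw [if_pos (by omega), if_neg (by omega), show 2 * j / 2 = j by omega, show (2*j+1)/2 = j by omega]
        exact (γ ^ j).lt_iff_lt.2 hqz'
      · simp only [e]
        rw [if_neg (by omega), if_pos (by omega), show (2*j+1)/2 = j by omega, show (2*j+1+1)/2 = j+1 by omega, pow_succ, RelIso.mul_apply]
        exact (γ ^ j).lt_iff_lt.2 hzq
    filter_upwards [hM e hinc] with h hh hG σ h1 h2
    by_contra hn
    obtain ⟨h3, h4⟩ := main h σ h1 h2 hn
    apply hh hG
    refine ⟨σ, ?_⟩
    intro i hi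
    rcases Nat.even_or_odd' i with ⟨j, rfl | rfl⟩
    · simp only [e]
      rw [if_pos (by omega), show 2 * j / 2 = j by omega, pow_mul]
      simpa using h3 j (by omega)
    · simp only [e]
      rw [if_neg (by omega), show (2*j+1)/2 = j by omega, pow_succ, pow_mul]
      have := h4 j (by omega)
      simp only [even_two, Even.neg_pow, one_pow, one_mul]
      linarith

end Aux
end

section
open Set Filter Topology
namespace Aux

lemma core {G : Subgroup GR} {k : ℕ} (hk : 4 ≤ k) (hM : Mx G k) {γ : GR} (hγG : γ ∈ G)
    {c Q : ℕ → ℝ} (hc : Inc (k-1) c) (hcc : ∀ i < k - 1, Cross γ ((-1)^(k+i)) (c i)) 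
    (hQ : Inc k Q) (hcQ : ∀ i < k - 1, c i < Q 0)
    (hγ : ∀ x, Q 0 ≤ x → x ≤ Q (k-1) → x < γ x)
    (hm : ∀ m ≤ k, (γ ^ m) (Q 1) < Q 2 ∧ (γ ^ m) (Q 2) < Q 3) : 
    ∀ᶠ h in LF, h ∈ G → Alt h k Q → (∀ i < k - 1, h (c i) ≠ c i) → False := by
  classical
  have q01 := hQ 0 1 (by omega) (by omega)
  have q12 := hQ 1 2 (by omega) (by omega)
  have q23 := hQ 2 3 (by omega) (by omega)
  have q3 : Q 3 ≤ Q (k-1) := by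
    rcases Nat.lt_or_ge 3 (k-1) with h | h
    · exact (hQ 3 (k-1) h (by omega)).le
    · rw [show k - 1 = 3 by omega]
  obtain ⟨S1, hS1, e1⟩ := step (q := Q 1) (q' := Q 2) hM q12 (fun x h1 h2 => hγ x (by linarith) (by linarith)) (fun m h => (hm m h).1)
  obtain ⟨S2, hS2, e2⟩ := step (q := Q 2) (q' := Q 3) hM q23 (fun x h1 h2 => hγ x (by linarith) (by linarith)) (fun m h => (hm m h).2)
  have e3 : ∀ᶠ h in LF, ∀ i ∈ Finset.range (k-1), h ∈ G → ∀ s : ℝ, (∀ j < k, 0 < s * (-1)^j * (h (Q j) - Q j)) → h (c i) ≠ c i → 0 < s * (h (c i) - c i) := by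
    rw [Finset.eventually_all]
    intro i hi
    exact sgn_at (by omega) hM hQ (hcQ i (by simpa using hi))
  have e4 : ∀ᶠ h in LF, ∀ i ∈ Finset.range (k-1), ∀ s : ℝ, 0 < s * (h (c i) - c i) → 0 < (-((-1)^(k+i) * s)) * (cm h γ (c i) - c i) := by
    rw [Finset.eventually_all]
    intro i hi
    exact (hcc i (by simpa using hi)).ev
  let t : ℝ → ℝ → ℕ → ℝ := fun x y i => if i < k - 1 then c i else if i = k - 1 then x else y
  have e5 : ∀ᶠ h in LF, ∀ x ∈ S1, ∀ y ∈ S2, cm h γ ∈ G → ¬ Alt (cm h γ) (k+1) (t x y) := by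
    rw [Finset.eventually_all]
    intro x hx
    rw [Finset.eventually_all]
    intro y hy
    refine (tendsto_cm γ).eventually (hM _ ?_)
    apply inc_of_step
    intro i hi
    have : i + 1 < k - 1 ∨ i + 1 = k - 1 ∨ i + 1 = k := by omega
    rcases this with h | h | h
    · simp only [t]
      rw [if_pos (by omega), if_pos (by omega)]
      exact hc i (i+1) (by omega) h
    · simp only [t]
      rw [if_pos (by omega), if_neg (by omega), if_pos h]
      have := hcQ i (by omega)
      linarith [(hS1 x hx).1]
    · simp only [t]
      rw [if_neg (by omega), if_pos (by omega), if_neg (by omega), if_neg (by omega)]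
      linarith [(hS1 x hx).2, (hS2 y hy).1]
  filter_upwards [e1, e2, e3, e4, e5] with h h1 h2 h3 h4 h5 hG ⟨s, hs⟩ hne
  have s1 := hs 1 (by omega)
  have s2 := hs 2 (by omega)
  have s3 := hs 3 (by omega)
  obtain ⟨x, hx, hxg⟩ := h1 hG (-s) (by linarith) (by linarith)
  obtain ⟨y, hy, hyg⟩ := h2 hG s (by linarith) (by linarith)
  apply h5 x hx y hy (cm_mem hG hγG)
  have gx := sg_cm_good _ _ _ _ hxg
  have gy := sg_cm_good _ _ _ _ hyg
  have hsq : ((-1:ℝ)^k) * (-1)^k = 1 := by rw [← mul_pow]; norm_num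
  refine ⟨- s * (-1)^k, ?_⟩
  intro i hi
  have : i < k - 1 ∨ i + 1 = k ∨ i = k := by omega
  rcases this with hi | hi | hi
  · have hi' : i ∈ Finset.range (k-1) := by simpa using hi
    have := h4 i hi' s (h3 i hi' hG s hs (hne i hi))
    simp only [t]
    rw [if_pos hi]
    calc 0 < _ := this
      _ = _ := by ring
  · simp only [t]
    rw [if_neg (by omega), if_pos (by omega)]
    have h6 : -s * (-1)^k * (-1)^i * (cm h γ x - x) = (s * (cm h γ x - x)) * ((-1)^k * (-1)^k) := by
      rw [← hi]; ring
    rw [h6, hsq]; linarith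
  · simp only [t]
    rw [if_neg (by omega), if_neg (by omega), hi]
    have h6 : -s * (-1)^k * (-1)^k * (cm h γ y - y) = (-s * (cm h γ y - y)) * ((-1)^k * (-1)^k) := by
      ring
    rw [h6, hsq]; linarith

lemma Alt.norm {h : GR} {k : ℕ} {p : ℕ → ℝ} (hA : Alt h k p) :
    ∃ s : ℝ, (s = 1 ∨ s = -1) ∧ ∀ i < k, 0 < s * (-1)^i * (h (p i) - p i) := by
  obtain ⟨s, hs⟩ := hA
  rcases lt_trichotomy s 0 with h0 | h0 | h0
  · refine ⟨-1, Or.inr rfl, fun i hi => ?_⟩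
    have := hs i hi
    rw [mul_assoc] at this ⊢
    have := neg_of_mul_pos_right this h0.le
    linarith
  · refine ⟨1, Or.inl rfl, fun i hi => ?_⟩
    have := hs i hi
    simp [h0] at this
  · refine ⟨1, Or.inl rfl, fun i hi => ?_⟩
    have := hs i hi
    rw [mul_assoc] at this ⊢
    have := pos_of_mul_pos_right this h0.le
    linarith

lemma inc_img {k : ℕ} {P : ℕ → ℝ} (hP : Inc k P) (g : GR) : Inc k (fun i => g (P i)) := 
  fun i j hij hj => g.lt_iff_lt.2 (hP i j hij hj)

lemma Inc.le {k : ℕ} {P : ℕ → ℝ} (hP : Inc k P) {i j : ℕ} (h : i ≤ j) (hj : j < k) : P i ≤ P j := by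
  rcases h.eq_or_lt with rfl | h
  · exact le_rfl
  · exact (hP i j h hj).le

lemma no_k4 {N : ℕ} {G : Subgroup GR} (hB : Bd N G) (hI : Irr G) {k : ℕ} (hk : 4 ≤ k) (hM : Mx G k)
    {P : ℕ → ℝ} (hP : Inc k P) (hK : KM G k P) : False := by
  classical
  have huv : P 0 ≤ P (k-1) := hP.le (by omega) (by omega)
  obtain ⟨g, hg, hgv, hgs⟩ := exists_seq hI (P 0) (P (k-1)) huv
  set J0 := N + (k-1) * N + 1 with hJ0
  let t : ℕ → ℕ → ℝ := fun j i => if i < k then P i else g j (P 0)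
  have ht : ∀ j, Inc (k+1) (t j) := by
    intro j
    apply inc_of_step
    intro i hi
    have : i + 1 < k ∨ i + 1 = k := by omega
    rcases this with h | h
    · simp only [t]
      rw [if_pos (by omega), if_pos (by omega)]
      exact hP i (i+1) (by omega) h
    · simp only [t]
      rw [if_pos (by omega), if_neg (by omega)]
      rw [show i = k - 1 by omega]
      exact hgv j
  have e1 : ∀ᶠ h in LF, ∀ j ∈ Finset.range J0, h ∈ G → ¬ Alt h (k+1) (t j) := by
    rw [Finset.eventually_all]
    intro j _
    exact hM _ (ht j)
  have e2 : ∀ᶠ h : GR in LF, ∀ j ∈ Finset.range J0, ∀ m ∈ Finset.range (k+1), ∀ i ∈ Finset.range 3, 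
      (h ^ m) (g j (P i)) < g j (P (i+1)) ∧ (h⁻¹ ^ m) (g j (P i)) < g j (P (i+1)) := by
    rw [Finset.eventually_all]
    intro j _
    rw [Finset.eventually_all]
    intro m _
    rw [Finset.eventually_all]
    intro i hi
    have hi : i < 3 := by simpa using hi
    have hlt : g j (P i) < g j (P (i+1)) := (g j).lt_iff_lt.2 (hP i (i+1) (by omega) (by omega))
    have a1 := ((tendsto_eval (g j (P i))).comp (tendsto_pow m)).eventually_lt_const hlt
    have a2 := ((tendsto_eval (g j (P i))).comp ((tendsto_pow m).comp tendsto_inv)).eventually_lt_const hlt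
    exact a1.and a2
  obtain ⟨γ, ⟨hγG, hγ1, hγA⟩, f1, f2⟩ := (hK.and_eventually (e1.and e2)).exists
  obtain ⟨s, hs1, hs⟩ := hγA.norm
  have hss : s * s = 1 := by rcases hs1 with rfl | rfl <;> norm_num
  -- crossings
  have hex : ∀ i, ∃ c, i < k - 1 → P i < c ∧ c < P (i+1) ∧ Cross γ (s * (-1)^(i+1)) c := by
    intro i
    by_cases hi : i < k - 1
    · obtain ⟨c, hc⟩ := exists_Cross hB hγG (s * (-1)^(i+1)) (P i) (P (i+1)) (hP i (i+1) (by omega) (by omega))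
        (by have := hs i (by omega); calc 0 < _ := this
              _ = _ := by ring) (hs (i+1) (by omega))
      exact ⟨c, fun _ => hc⟩
    · exact ⟨0, fun h => absurd h hi⟩
  choose c hc using hex
  have hcinc : Inc (k-1) c := by
    apply inc_of_step
    intro i hi
    exact (hc i (by omega)).2.1.trans (hc (i+1) (by omega)).1
  have hcP : ∀ i < k - 1, P 0 ≤ c i ∧ c i ≤ P (k-1) := by
    intro i hi
    constructor
    · exact (hP.le (by omega) (by omega)).trans (hc i hi).1.le
    · exact (hc i hi).2.1.le.trans (hP.le (by omega) (by omega))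
  let bad : ℕ → Prop := fun j => ∃ y, g j (P 0) ≤ y ∧ y ≤ g j (P (k-1)) ∧ γ y = y
  have hbadcard : ((Finset.range J0).filter bad).card ≤ N := by
    by_contra hcard
    push Not at hcard
    have hex : ∀ j ∈ (Finset.range J0).filter bad, ∃ y, g j (P 0) ≤ y ∧ y ≤ g j (P (k-1)) ∧ γ y = y := by
      intro j hj; exact (Finset.mem_filter.1 hj).2
    choose! y hy using hex
    apply hγ1
    apply hB.inj hγG (((Finset.range J0).filter bad).image y)
    · intro x hx
      obtain ⟨j, hj, rfl⟩ := Finset.mem_image.1 hx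
      exact (hy j hj).2.2
    · rw [Finset.card_image_of_injOn]
      · exact hcard
      · have hlt : ∀ i ∈ (Finset.range J0).filter bad, ∀ j ∈ (Finset.range J0).filter bad, i < j → y i < y j := by
          intro i hi j hj hij
          exact (hy i hi).2.1.trans_lt ((hgs i j hij).1.trans_le (hy j hj).1)
        intro i hi j hj hij
        rcases lt_trichotomy i j with h | h | h
        · exact absurd hij (hlt i hi j hj h).ne
        · exact h
        · exact absurd hij (hlt j hj i hi h).ne'
  have hJcard : (k-1) * N < ((Finset.range J0).filter (fun j => ¬ bad j)).card := by
    have := Finset.card_filter_add_card_filter_not (s := Finset.range J0) bad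
    rw [Finset.card_range] at this
    omega
  refine pigeon hB hK (P 0) (P (k-1)) ((Finset.range (k-1)).image c) ?_ g hg (fun i j h => (hgs i j h).2)
    ((Finset.range J0).filter (fun j => ¬ bad j)) (lt_of_le_of_lt (Nat.mul_le_mul_right _ ?_) hJcard) ?_
  · intro a ha
    obtain ⟨i, hi, rfl⟩ := Finset.mem_image.1 ha
    exact hcP i (by simpa using hi)
  · exact Finset.card_image_le.trans (by simp)
  intro j hj
  obtain ⟨hj, hjb⟩ := Finset.mem_filter.1 hj
  have hnz : ∀ y, g j (P 0) ≤ y → y ≤ g j (P (k-1)) → γ y ≠ y := fun y h1 h2 h3 => hjb ⟨y, h1, h2, h3⟩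
  have hle : g j (P 0) ≤ g j (P (k-1)) := (g j).le_iff_le.2 huv
  have hsgn : 0 < s * (-1)^(k+1) * (γ (g j (P 0)) - g j (P 0)) := by
    by_contra hn
    apply f1 j hj hγG
    refine ⟨s, ?_⟩
    intro i hi
    have : i < k ∨ i = k := by omega
    rcases this with h | rfl
    · simp only [t]; rw [if_pos h]; exact hs i h
    · simp only [t]; rw [if_neg (by omega)]
      have h2 : s * (-1)^i * (γ (g j (P 0)) - g j (P 0)) ≠ 0 := by
        apply mul_ne_zero
        · apply mul_ne_zero
          · rcases hs1 with rfl | rfl <;> norm_num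
          · exact pow_ne_zero _ (by norm_num)
        · exact sub_ne_zero.2 (hnz _ le_rfl hle)
      rw [pow_succ] at hn
      push Not at hn
      rcases lt_or_gt_of_ne h2 with h3 | h3
      · linarith
      · exact h3
  have final : ∀ γ' ∈ G, (∀ i < k - 1, Cross γ' ((-1)^(k+i)) (c i)) → (∀ y, g j (P 0) ≤ y → y ≤ g j (P (k-1)) → γ' y ≠ y) →
      g j (P 0) < γ' (g j (P 0)) → (∀ m ∈ Finset.range (k+1), ∀ i ∈ Finset.range 3, 
      (γ' ^ m) (g j (P i)) < g j (P (i+1))) → ∀ᶠ h in LF, h ∈ G → Alt h k (fun i => g j (P i)) → 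
      (∀ a ∈ (Finset.range (k-1)).image c, h a ≠ a) → False := by
    intro γ' hG hcr hnz hpos hmm
    have := core hk hM hG (c := c) (Q := fun i => g j (P i)) hcinc hcr (inc_img hP _) 
      (fun i hi => (hcP i hi).2.trans_lt (hgv j)) (by
        intro x hx1 hx2
        by_contra hn
        push Not at hn
        have hn2 : γ' x < x := lt_of_le_of_ne hn (hnz x hx1 hx2)
        have hx1' : g j (P 0) < x := by
          rcases hx1.eq_or_lt with h | h
          · rw [← h] at hn2; linarith
          · exact h
        obtain ⟨y, hy1, hy2, hy3⟩ := ivt _ (dcont γ') _ _ hx1' (mul_neg_of_pos_of_neg (by linarith) (by linarith))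
        exact hnz y hy1.le (hy2.le.trans hx2) (by linarith))
      (fun m hm => ⟨hmm m (by rw [Finset.mem_range]; omega) 1 (by simp), hmm m (by rw [Finset.mem_range]; omega) 2 (by simp)⟩)
    filter_upwards [this] with h hh h1 h2 h3
    exact hh h1 h2 (fun i hi => h3 _ (Finset.mem_image_of_mem _ (by simpa using hi)))
  have hpk : ((-1:ℝ)^(k+1)) * (-1)^(k+1) = 1 := by rw [← mul_pow]; norm_num
  rcases lt_or_gt_of_ne (hnz _ le_rfl hle) with hneg | hpos
  · have hs' : s = - (-1)^(k+1) := by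
      have h1 : s * (-1)^(k+1) < 0 := by
        by_contra h; push Not at h; nlinarith
      rcases hs1 with rfl | rfl <;> rcases neg_one_pow_eq_or ℝ (k+1) with h | h <;> rw [h] at h1 ⊢ <;> revert h1 <;> norm_num
    refine final γ⁻¹ (G.inv_mem hγG) ?_ ?_ ?_ (fun m hm i hi => (f2 j hj m hm i hi).2)
    · intro i hi
      have := (hc i hi).2.2.inv
      rw [hs'] at this
      convert this using 1
      have : (-1:ℝ)^(k+1+(i+1)) = (-1)^(k+i) := by rw [show k+1+(i+1) = k+i+2 by ring, pow_add]; norm_num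
      rw [← this, pow_add]; ring
    · intro y h1 h2 h3
      apply hnz y h1 h2
      conv_lhs => rw [← h3]
      exact RelIso.apply_inv_self _ _
    · rw [lt_inv_iff]; exact hneg
  · have hs' : s = (-1)^(k+1) := by
      have h1 : 0 < s * (-1)^(k+1) := by
        by_contra h; push Not at h; nlinarith
      rcases hs1 with rfl | rfl <;> rcases neg_one_pow_eq_or ℝ (k+1) with h | h <;> rw [h] at h1 ⊢ <;> revert h1 <;> norm_num
    refine final γ hγG ?_ hnz hpos (fun m hm i hi => (f2 j hj m hm i hi).1)
    intro i hi
    have := (hc i hi).2.2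
    rw [hs'] at this
    convert this using 1
    have : (-1:ℝ)^(k+1+(i+1)) = (-1)^(k+i) := by rw [show k+1+(i+1) = k+i+2 by ring, pow_add]; norm_num
    rw [← this, pow_add]

end Aux
end

section
open Set Filter Topology
namespace Aux

lemma no_norm4 {N : ℕ} {G : Subgroup GR} (hB : Bd N G) (hI : Irr G) (hN : ND G) {f : GR} (hf : f ∈ G)
    {p : ℕ → ℝ} (hp : Inc 4 p) (hs : ∀ i < 4, 0 < -(-1)^i * (f (p i) - p i)) (hfp : ∀ x, p 3 ≤ x → x < f x) :
    False := by
  classical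
  obtain ⟨k, hk1, hM, P, hP, hK⟩ := exists_km hB hN
  rcases Nat.lt_or_ge 3 k with hk | hk
  · exact no_k4 hB hI hk hM hP hK
  have hex : ∀ i, ∃ c, i < 3 → p i < c ∧ c < p (i+1) ∧ Cross f ((-1)^i) c := by
    intro i
    by_cases hi : i < 3
    · obtain ⟨c, hc⟩ := exists_Cross hB hf ((-1)^i) (p i) (p (i+1)) (hp i (i+1) (by omega) (by omega))
        (hs i (by omega)) (by
          have := hs (i+1) (by omega)
          rw [pow_succ] at this; linarith)
      exact ⟨c, fun _ => hc⟩
    · exact ⟨0, fun h => absurd h hi⟩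
  choose a ha using hex
  have hainc : Inc 3 a := by
    apply inc_of_step
    intro i hi
    exact (ha i (by omega)).2.1.trans (ha (i+1) (by omega)).1
  have hap : ∀ i < 3, p 0 ≤ a i ∧ a i < p 3 := by
    intro i hi
    exact ⟨(hp.le (by omega) (by omega)).trans (ha i hi).1.le, (ha i hi).2.1.trans_le (hp.le (by omega) (by omega))⟩
  set u := min (p 0) (P 0) with hu
  set v := max (p 3) (P 0) with hv
  have h03 : p 0 < p 3 := hp 0 3 (by omega) (by omega)
  have huv : u ≤ v := (min_le_left _ _).trans (h03.le.trans (le_max_left _ _))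
  obtain ⟨g, hg, hgv, hgs⟩ := exists_seq hI u v huv
  refine pigeon hB hK u v ((Finset.range 3).image a) ?_ g hg (fun i j h => (hgs i j h).2) 
    (Finset.range (((Finset.range 3).image a).card * N + 1)) (by simp) ?_
  · intro x hx
    obtain ⟨i, hi, rfl⟩ := Finset.mem_image.1 hx
    have := hap i (by simpa using hi)
    exact ⟨(min_le_left _ _).trans this.1, this.2.le.trans (le_max_left _ _)⟩
  · intro j _
    have := case_le3 hk1 hk hM hf hainc (fun i hi => (ha i hi).2.2) (fun i hi => (hap i hi).2) hfp
      (inc_img hP (g j)) (lt_of_le_of_lt (le_max_left _ _) ((hgv j).trans_le ((g j).le_iff_le.2 (min_le_right _ _))))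
    filter_upwards [this] with h hh h1 h2 h3
    exact hh h1 h2 (fun i hi => h3 _ (Finset.mem_image_of_mem _ (by simpa using hi)))

lemma const_sign {φ : ℝ → ℝ} (hφ : Continuous φ) {a b : ℝ} (hab : a ≤ b)
    (h : ∀ x, a ≤ x → x ≤ b → φ x ≠ 0) (ha : 0 < φ a) : 0 < φ b := by
  by_contra hn
  push Not at hn
  have hn2 : φ b < 0 := lt_of_le_of_ne hn (h b hab le_rfl)
  have : a < b := by
    rcases hab.eq_or_lt with rfl | h
    · linarith
    · exact h
  obtain ⟨c, h1, h2, h3⟩ := ivt φ hφ a b this (mul_neg_of_pos_of_neg ha hn2)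
  exact h c h1.le h2.le h3

lemma const_sign' {φ : ℝ → ℝ} (hφ : Continuous φ) {a b : ℝ} (hab : a ≤ b)
    (h : ∀ x, a ≤ x → x ≤ b → φ x ≠ 0) (ha : 0 < φ b) : 0 < φ a := by
  by_contra hn
  push Not at hn
  have hn2 : φ a < 0 := lt_of_le_of_ne hn (h a le_rfl hab)
  have := const_sign (φ := fun x => - φ x) hφ.neg hab (fun x h1 h2 => neg_ne_zero.2 (h x h1 h2)) (by linarith)
  linarith

lemma ev_top {N : ℕ} {G : Subgroup GR} (hB : Bd N G) {f : GR} (hf : f ∈ G) (h1 : f ≠ 1) :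
    (∀ᶠ x in atTop, x < f x) ∨ (∀ᶠ x in atTop, f x < x) := by
  obtain ⟨M, hM⟩ := (hB.fin hf h1).bddAbove
  have hnz : ∀ x, M + 1 ≤ x → f x - x ≠ 0 := by
    intro x hx h
    have := hM (show f x = x by linarith)
    linarith
  rcases lt_or_gt_of_ne (hnz _ le_rfl) with h | h
  · right
    filter_upwards [eventually_ge_atTop (M+1)] with x hx
    have := const_sign (φ := fun x => - (f x - x)) (dcont f).neg hx (fun y h1 _ => neg_ne_zero.2 (hnz y h1)) (by linarith)
    linarith
  · left
    filter_upwards [eventually_ge_atTop (M+1)] with x hx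
    have := const_sign (dcont f) hx (fun y h1 _ => (hnz y h1)) (by linarith)
    linarith

lemma ev_bot {N : ℕ} {G : Subgroup GR} (hB : Bd N G) {f : GR} (hf : f ∈ G) (h1 : f ≠ 1) :
    (∀ᶠ x in atBot, x < f x) ∨ (∀ᶠ x in atBot, f x < x) := by
  obtain ⟨M, hM⟩ := (hB.fin hf h1).bddBelow
  have hnz : ∀ x, x ≤ M - 1 → f x - x ≠ 0 := by
    intro x hx h
    have := hM (show f x = x by linarith)
    linarith
  rcases lt_or_gt_of_ne (hnz _ le_rfl) with h | h
  · right
    filter_upwards [eventually_le_atBot (M-1)] with x hx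
    have := const_sign' (φ := fun x => - (f x - x)) (dcont f).neg hx (fun y _ h1 => neg_ne_zero.2 (hnz y h1)) (by linarith)
    linarith
  · left
    filter_upwards [eventually_le_atBot (M-1)] with x hx
    have := const_sign' (dcont f) hx (fun y _ h1 => (hnz y h1)) (by linarith)
    linarith

lemma Alt.inv {f : GR} {k : ℕ} {p : ℕ → ℝ} (h : Alt f k p) : Alt f⁻¹ k p := by
  obtain ⟨s, hs⟩ := h
  refine ⟨-s, fun i hi => ?_⟩
  have := sg_inv f _ _ (hs i hi)
  calc 0 < _ := this
    _ = _ := by ring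

def NoAlt (G : Subgroup GR) (k : ℕ) : Prop := ∀ f ∈ G, ∀ p, Inc k p → ¬ Alt f k p

lemma no_alt4 {N : ℕ} {G : Subgroup GR} (hB : Bd N G) (hI : Irr G) (hN : ND G) : NoAlt G 4 := by
  have key : ∀ f ∈ G, ∀ p, Inc 4 p → Alt f 4 p → ¬ (∀ᶠ x in atTop, x < f x) := by
    intro f hf p hp ha htop
    obtain ⟨M, hM⟩ := eventually_atTop.1 htop
    obtain ⟨s, hs1, hs⟩ := ha.norm
    set M' := max M (p 3) + 1 with hM'
    have m1 : M < M' := by have := le_max_left M (p 3); linarith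
    have m2 : p 3 < M' := by have := le_max_right M (p 3); linarith
    have p01 := hp 0 1 (by omega) (by omega)
    have p12 := hp 1 2 (by omega) (by omega)
    have p23 := hp 2 3 (by omega) (by omega)
    have s0 := hs 0 (by omega)
    have s1 := hs 1 (by omega)
    have s2 := hs 2 (by omega)
    have s3 := hs 3 (by omega)
    have sM := hM M' m1.le
    rcases hs1 with rfl | rfl
    · let t : ℕ → ℝ := fun i => if i < 3 then p (i+1) else M'
      refine no_norm4 hB hI hN hf (p := t) ?_ ?_ ?_
      · apply inc_of_step
        intro i hi
        have : i = 0 ∨ i = 1 ∨ i = 2 := by omega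
        rcases this with rfl | rfl | rfl
        · simpa [t] using p12
        · simpa [t] using p23
        · simpa [t] using m2
      · intro i hi
        have : i = 0 ∨ i = 1 ∨ i = 2 ∨ i = 3 := by omega
        rcases this with rfl | rfl | rfl | rfl
        · norm_num [t] at s1 ⊢; linarith
        · norm_num [t] at s2 ⊢; linarith
        · norm_num [t] at s3 ⊢; linarith
        · norm_num [t]; linarith
      · intro x hx
        simp only [t, lt_irrefl, if_false] at hx
        exact hM x (by linarith)
    · let t : ℕ → ℝ := fun i => if i < 3 then p i else M'
      refine no_norm4 hB hI hN hf (p := t) ?_ ?_ ?_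
      · apply inc_of_step
        intro i hi
        have : i = 0 ∨ i = 1 ∨ i = 2 := by omega
        rcases this with rfl | rfl | rfl
        · simpa [t] using p01
        · simpa [t] using p12
        · simpa [t] using p23.trans m2
      · intro i hi
        have : i = 0 ∨ i = 1 ∨ i = 2 ∨ i = 3 := by omega
        rcases this with rfl | rfl | rfl | rfl
        · norm_num [t] at s0 ⊢; linarith
        · norm_num [t] at s1 ⊢; linarith
        · norm_num [t] at s2 ⊢; linarith
        · norm_num [t]; linarith
      · intro x hx
        simp only [t, lt_irrefl, if_false] at hx
        exact hM x (by linarith)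
  intro f hf p hp ha
  have h1 : f ≠ 1 := by
    rintro rfl
    obtain ⟨s, hs⟩ := ha
    have := hs 0 (by omega)
    simp at this
  rcases ev_top hB hf h1 with h | h
  · exact key f hf p hp ha h
  · apply key f⁻¹ (G.inv_mem hf) p hp ha.inv
    filter_upwards [h] with x hx
    exact (lt_inv_iff _ _ _).2 hx

end Aux
end

section
open Set Filter Topology
open scoped commutatorElement
namespace Aux

section ordhom
variable {G : Type*} [Group G]

lemma pw (le : G → G → Prop) (hr : ∀ a, le a a) (ht : ∀ a b c, le a b → le b c → le a c)
    (hl : ∀ c a b, le a b → le (c*a) (c*b)) (hrm : ∀ c a b, le a b → le (a*c) (b*c)) (a b : G) 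
    (hab : le (a*b) (b*a)) (j : ℕ) : le (a^j*b^j) ((a*b)^j) ∧ le ((a*b)^j) (b^j*a^j) := by
  have h1 : ∀ m : ℕ, le (a * b^m) (b^m * a) := by
    intro m
    induction m with
    | zero => simpa using hr a
    | succ m ih =>
      have e1 := hrm b _ _ ih
      have e2 := hl (b^m) _ _ hab
      have := ht _ _ _ (by simpa [mul_assoc] using e1) e2
      simpa [pow_succ, mul_assoc] using this
  have h2 : ∀ m : ℕ, le (a^m * b) (b * a^m) := by
    intro m
    induction m with
    | zero => simpa using hr b
    | succ m ih =>
      have e1 := hl a _ _ ih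
      have e2 := hrm (a^m) _ _ hab
      have := ht _ _ _ e1 (by simpa [mul_assoc] using e2)
      simpa [pow_succ', mul_assoc] using this
  induction j with
  | zero => simpa using hr 1
  | succ j ih =>
    constructor
    · have e1 := hrm (a*b) _ _ ih.1
      have e2 := hl (a^j) _ _ (hrm b _ _ (h1 j))
      have := ht _ _ _ e2 (by simpa [mul_assoc] using e1)
      simpa [pow_succ, mul_assoc] using this
    · have e1 := hrm (a*b) _ _ ih.2
      have e2 := hl (b^j) _ _ (h2 (j+1))
      have := ht _ _ _ e1 (by simpa [pow_succ, mul_assoc] using e2)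
      simpa [pow_succ, mul_assoc] using this

lemma ord_hom (le : G → G → Prop) (htot : ∀ a b, le a b ∨ le b a) (ht : ∀ a b c, le a b → le b c → le a c)
    (hl : ∀ c a b, le a b → le (c*a) (c*b)) (hrm : ∀ c a b, le a b → le (a*c) (b*c)) (f : G)
    (hf : ¬ le f 1) (harch : ∀ g, ∃ n : ℕ, le g (f^n)) :
    ∃ τ : G → ℝ, (∀ a b, τ (a*b) = τ a + τ b) ∧ (∀ a b, le a b → τ a ≤ τ b) ∧ τ f = 1 := by
  have hr : ∀ a, le a a := fun a => (htot a a).elim id id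
  have hmul : ∀ a b c d, le a b → le c d → le (a*c) (b*d) := fun a b c d h1 h2 =>
    ht _ _ _ (hrm c _ _ h1) (hl b _ _ h2)
  have hpow : ∀ a b, le a b → ∀ n : ℕ, le (a^n) (b^n) := by
    intro a b h n
    induction n with
    | zero => simpa using hr 1
    | succ n ih => rw [pow_succ, pow_succ]; exact hmul _ _ _ _ ih h
  have hinv : ∀ a b, le a b → le b⁻¹ a⁻¹ := by
    intro a b h
    have := hrm b⁻¹ _ _ (hl a⁻¹ _ _ h)
    simpa using this
  have h1f : le 1 f := (htot f 1).resolve_left hf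
  have hz0 : ∀ n : ℕ, le 1 (f^n) := fun n => by simpa using hpow _ _ h1f n
  have hzmono : ∀ m n : ℤ, m ≤ n → le (f^m) (f^n) := by
    intro m n h
    obtain ⟨d, rfl⟩ := Int.le.dest h
    rw [zpow_add, zpow_natCast]
    simpa using hl (f^m) _ _ (hz0 d)
  have hzst : ∀ m n : ℤ, le (f^m) (f^n) → m ≤ n := by
    intro m n h
    by_contra hn
    push Not at hn
    apply hf
    have h1 := hzmono (n+1) m (by omega)
    have h2 := ht _ _ _ h1 h
    have h3 := hl (f^(-n)) _ _ h2
    rw [← zpow_add, ← zpow_add] at h3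
    simpa using h3
  have hN : ∀ g, ∃ m : ℤ, le (f^m) g ∧ le g (f^(m+1)) := by
    intro g
    obtain ⟨n, hn⟩ := harch g
    obtain ⟨n', hn'⟩ := harch g⁻¹
    have hlow : le (f^(-(n':ℤ))) g := by
      have := hinv _ _ hn'
      simpa using this
    obtain ⟨m, hm1, hm2⟩ := Int.exists_greatest_of_bdd (P := fun m : ℤ => le (f^m) g) 
      ⟨n, fun z hz => hzst _ _ (ht _ _ _ hz (by simpa using hn))⟩ ⟨_, hlow⟩
    refine ⟨m, hm1, ?_⟩
    rcases htot g (f^(m+1)) with h | h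
    · exact h
    · have := hm2 _ h; omega
  choose Nn hN1 hN2 using hN
  have hNmono : ∀ a b, le a b → Nn a ≤ Nn b + 1 := by
    intro a b h
    apply hzst
    exact ht _ _ _ (hN1 a) (ht _ _ _ h (hN2 b))
  have hNmul : ∀ a b, |(Nn (a*b) : ℝ) - Nn a - Nn b| ≤ 2 := by
    intro a b
    have h1 : Nn a + Nn b ≤ Nn (a*b) + 1 := by
      apply hzst
      rw [zpow_add]
      exact ht _ _ _ (hmul _ _ _ _ (hN1 a) (hN1 b)) (hN2 _)
    have h2 : Nn (a*b) ≤ (Nn a + 1) + (Nn b + 1) := by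
      apply hzst
      rw [zpow_add]
      exact ht _ _ _ (hN1 _) (hmul _ _ _ _ (hN2 a) (hN2 b))
    have h1' : (Nn a : ℝ) + Nn b ≤ Nn (a*b) + 1 := by exact_mod_cast h1
    have h2' : (Nn (a*b) : ℝ) ≤ (Nn a + 1) + (Nn b + 1) := by exact_mod_cast h2
    rw [abs_le]; constructor <;> linarith
  let q : G → ℕ → ℝ := fun g n => (Nn (g^(2^n)) : ℝ) / 2^n
  have hlim : ∀ g, ∃ l, Tendsto (q g) atTop (𝓝 l) := by
    intro g
    apply cauchySeq_tendsto_of_complete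
    refine cauchySeq_of_le_geometric_two (C := 2) ?_
    intro n
    have h1 := hNmul (g^(2^n)) (g^(2^n))
    rw [← pow_add, ← two_mul, ← pow_succ'] at h1
    have h2 : q g n - q g (n+1) = - (((Nn (g^(2^(n+1))):ℝ) - Nn (g^(2^n)) - Nn (g^(2^n))) / 2^(n+1)) := by
      simp only [q]; field_simp; ring
    rw [Real.dist_eq, h2, abs_neg, abs_div, abs_of_pos (show (0:ℝ) < 2^(n+1) by positivity), 
      show (2:ℝ) / 2 / 2^n = 2 / 2^(n+1) by rw [pow_succ]; field_simp]
    gcongr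
  choose τ hτ using hlim
  have hdiv : ∀ C : ℝ, Tendsto (fun n : ℕ => C / (2:ℝ)^n) atTop (𝓝 0) := by
    intro C
    exact Tendsto.div_atTop tendsto_const_nhds (tendsto_pow_atTop_atTop_of_one_lt (by norm_num))
  refine ⟨τ, ?_, ?_, ?_⟩
  · intro a b
    have key : ∀ j : ℕ, |(Nn ((a*b)^j) : ℝ) - Nn (a^j) - Nn (b^j)| ≤ 3 := by
      intro j
      have e1 := abs_le.1 (hNmul (a^j) (b^j))
      have e2 := abs_le.1 (hNmul (b^j) (a^j))
      rcases htot (a*b) (b*a) with h | h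
      · obtain ⟨h1, h2⟩ := pw le hr ht hl hrm a b h j
        have h3 : (Nn (a^j*b^j) : ℝ) ≤ Nn ((a*b)^j) + 1 := by exact_mod_cast hNmono _ _ h1
        have h4 : (Nn ((a*b)^j) : ℝ) ≤ Nn (b^j*a^j) + 1 := by exact_mod_cast hNmono _ _ h2
        rw [abs_le]; constructor <;> linarith
      · obtain ⟨h1, h2⟩ := pw (fun x y => le y x) hr (fun a b c h1 h2 => ht _ _ _ h2 h1)
          (fun c a b h => hl c _ _ h) (fun c a b h => hrm c _ _ h) a b h j
        have h3 : (Nn ((a*b)^j) : ℝ) ≤ Nn (a^j*b^j) + 1 := by exact_mod_cast hNmono _ _ h1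
        have h4 : (Nn (b^j*a^j) : ℝ) ≤ Nn ((a*b)^j) + 1 := by exact_mod_cast hNmono _ _ h2
        rw [abs_le]; constructor <;> linarith
    have h1 : Tendsto (fun n => q (a*b) n - q a n - q b n) atTop (𝓝 (τ (a*b) - τ a - τ b)) :=
      ((hτ _).sub (hτ _)).sub (hτ _)
    have h2 : Tendsto (fun n => q (a*b) n - q a n - q b n) atTop (𝓝 0) := by
      refine squeeze_zero_norm (a := fun n : ℕ => (3:ℝ) / 2^n) ?_ (hdiv 3)
      intro n
      have : q (a*b) n - q a n - q b n = ((Nn ((a*b)^(2^n)):ℝ) - Nn (a^(2^n)) - Nn (b^(2^n))) / 2^n := by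
        simp only [q]; field_simp
      rw [this, Real.norm_eq_abs, abs_div, abs_of_pos (show (0:ℝ) < 2^n by positivity)]
      have := key (2^n)
      gcongr
    have := tendsto_nhds_unique h1 h2
    linarith
  · intro a b h
    have h1 : Tendsto (fun n => q b n + 1 / 2^n) atTop (𝓝 (τ b + 0)) := (hτ b).add (hdiv 1)
    rw [add_zero] at h1
    refine le_of_tendsto_of_tendsto' (hτ a) h1 ?_
    intro n
    simp only [q]
    rw [← add_div]
    have : (Nn (a^(2^n)) : ℝ) ≤ Nn (b^(2^n)) + 1 := by exact_mod_cast hNmono _ _ (hpow _ _ h (2^n))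
    gcongr
  · have h1 : Tendsto (q f) atTop (𝓝 1) := by
      have h2 : ∀ n, |q f n - 1| ≤ 1 / 2^n := by
        intro n
        have e1 : Nn (f^(2^n)) ≤ ((2^n : ℕ):ℤ) := by
          apply hzst; rw [zpow_natCast]; exact hN1 _
        have e2 : ((2^n : ℕ):ℤ) ≤ Nn (f^(2^n)) + 1 := by
          apply hzst; rw [zpow_natCast]; exact hN2 _
        have e1' : (Nn (f^(2^n)) : ℝ) ≤ 2^n := by exact_mod_cast e1
        have e2' : (2:ℝ)^n ≤ (Nn (f^(2^n)) : ℝ) + 1 := by exact_mod_cast e2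
        have : q f n - 1 = ((Nn (f^(2^n)) : ℝ) - 2^n) / 2^n := by simp only [q]; field_simp
        rw [this, abs_div, abs_of_pos (show (0:ℝ) < 2^n by positivity)]
        gcongr
        rw [abs_le]; constructor <;> linarith
      have h3 : Tendsto (fun n => q f n - 1) atTop (𝓝 0) := squeeze_zero_norm h2 (hdiv 1)
      simpa using h3.add_const 1
    exact tendsto_nhds_unique (hτ f) h1
end ordhom

lemma hom_comm {G : Subgroup GR} (τ : G → ℝ) (hτ : ∀ a b : G, τ (a*b) = τ a + τ b) (h : GR) (hh : h ∈ G)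
    (hc : h ∈ ⁅G, G⁆) : τ ⟨h, hh⟩ = 0 := by
  have h1 : τ 1 = 0 := by have := hτ 1 1; simp at this; exact this
  let T : G →* Multiplicative ℝ := ⟨⟨fun a => Multiplicative.ofAdd (τ a), by rw [h1]; rfl⟩, fun a b => by simp [hτ]⟩
  have hle : ⁅G, G⁆ ≤ T.ker.map G.subtype := by
    rw [Subgroup.commutator_le]
    intro a ha b hb
    refine ⟨⁅(⟨a, ha⟩ : G), ⟨b, hb⟩⁆, ?_, rfl⟩
    rw [SetLike.mem_coe, MonoidHom.mem_ker, map_commutatorElement]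
    exact commutatorElement_eq_one_iff_mul_comm.2 (mul_comm _ _)
  obtain ⟨⟨y, hy⟩, hk, rfl⟩ := hle hc
  exact hk

lemma not_comm {N : ℕ} {G : Subgroup GR} (hB : Bd N G) {f : GR} (hf : f ∈ G) (hpos : ∀ᶠ x in atBot, x < f x)
    (htop : ∀ w ∈ G, ∃ n : ℕ, ∀ᶠ x in atBot, w x ≤ (f ^ n) x) : f ∉ ⁅G, G⁆ := by
  intro hc
  suffices hex : ∃ τ : G → ℝ, (∀ a b, τ (a*b) = τ a + τ b) ∧ (∀ a b : G, (∀ᶠ x in atBot, (a:GR) x ≤ (b:GR) x) → τ a ≤ τ b) ∧ τ ⟨f, hf⟩ = 1 by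
    obtain ⟨τ, h1, _, h3⟩ := hex
    have := hom_comm τ h1 f hf hc
    linarith
  refine ord_hom (G := G) (fun a b => ∀ᶠ x in atBot, (a:GR) x ≤ (b:GR) x) ?_ ?_ ?_ ?_ ⟨f, hf⟩ ?_ ?_
  · intro a b
    by_cases hab : (a:GR)⁻¹ * b = 1
    · left
      have : (a:GR) = b := inv_mul_eq_one.1 hab
      rw [this]; exact Eventually.of_forall (fun x => le_rfl)
    · rcases ev_bot hB (G.mul_mem (G.inv_mem a.2) b.2) hab with h | h
      · left; filter_upwards [h] with x hx
        rw [RelIso.mul_apply, lt_inv_iff] at hx; exact hx.le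
      · right; filter_upwards [h] with x hx
        rw [RelIso.mul_apply, inv_lt_iff] at hx; exact hx.le
  · intro a b c h1 h2
    filter_upwards [h1, h2] with x a1 a2
    exact a1.trans a2
  · intro c a b h
    filter_upwards [h] with x hx
    exact (c:GR).le_iff_le.2 hx
  · intro c a b h
    exact (OrderIso.tendsto_atBot (c:GR)).eventually h
  · intro h
    obtain ⟨x, h1, h2⟩ := (hpos.and h).exists
    have h2 : f x ≤ x := h2
    linarith
  · intro g
    obtain ⟨n, hn⟩ := htop g g.2
    exact ⟨n, hn⟩

end Aux
end

section
open Set Filter Topology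
namespace Aux

lemma escape_ev (f : GR) (a b : ℝ) (hab : a ≤ b) (h : ∀ x, a ≤ x → x ≤ b → x < f x) : 
    ∀ᶠ n : ℕ in atTop, b < (f ^ n) a := by
  obtain ⟨n, hn⟩ := escape f a b h
  filter_upwards [eventually_ge_atTop n] with m hm
  induction m, hm using Nat.le_induction with
  | base => exact hn
  | succ m hm ih =>
    rw [pow_succ', RelIso.mul_apply]
    exact (h b hab le_rfl).trans (f.lt_iff_lt.2 ih)

lemma bot_total {N : ℕ} {G : Subgroup GR} (hB : Bd N G) {a b : GR} (ha : a ∈ G) (hb : b ∈ G) :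
    (∀ᶠ x in atBot, a x ≤ b x) ∨ (∀ᶠ x in atBot, b x < a x) := by
  by_cases hab : (a:GR)⁻¹ * b = 1
  · left
    have : (a:GR) = b := inv_mul_eq_one.1 hab
    rw [this]; exact Eventually.of_forall (fun x => le_rfl)
  · rcases ev_bot hB (G.mul_mem (G.inv_mem ha) hb) hab with h | h
    · left; filter_upwards [h] with x hx
      rw [RelIso.mul_apply, lt_inv_iff] at hx; exact hx.le
    · right; filter_upwards [h] with x hx
      rw [RelIso.mul_apply, inv_lt_iff] at hx; exact hx

/-- three term tuple -/
def tup (a b c d : ℝ) : ℕ → ℝ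
  | 0 => a
  | 1 => b
  | 2 => c
  | _ => d

lemma inc2 {a b c d : ℝ} (h1 : a < b) : Inc 2 (tup a b c d) := by
  apply inc_of_step
  intro i hi
  obtain rfl : i = 0 := by omega
  exact h1

lemma inc3 {a b c d : ℝ} (h1 : a < b) (h2 : b < c) : Inc 3 (tup a b c d) := by
  apply inc_of_step
  intro i hi
  have : i = 0 ∨ i = 1 := by omega
  rcases this with rfl | rfl
  · exact h1
  · exact h2

lemma inc4 {a b c d : ℝ} (h1 : a < b) (h2 : b < c) (h3 : c < d) : Inc 4 (tup a b c d) := by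
  apply inc_of_step
  intro i hi
  have : i = 0 ∨ i = 1 ∨ i = 2 := by omega
  rcases this with rfl | rfl | rfl
  · exact h1
  · exact h2
  · exact h3

lemma alt2 {f : GR} {a b c d : ℝ} (s : ℝ) (h1 : 0 < s * (f a - a)) (h2 : s * (f b - b) < 0) : Alt f 2 (tup a b c d) := by
  refine ⟨s, fun i hi => ?_⟩
  have : i = 0 ∨ i = 1 := by omega
  rcases this with rfl | rfl <;> simp only [tup] <;> norm_num <;> linarith

lemma alt3 {f : GR} {a b c d : ℝ} (s : ℝ) (h1 : 0 < s * (f a - a)) (h2 : s * (f b - b) < 0)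
    (h3 : 0 < s * (f c - c)) : Alt f 3 (tup a b c d) := by
  refine ⟨s, fun i hi => ?_⟩
  have : i = 0 ∨ i = 1 ∨ i = 2 := by omega
  rcases this with rfl | rfl | rfl <;> simp only [tup] <;> norm_num <;> linarith

lemma alt4 {f : GR} {a b c d : ℝ} (s : ℝ) (h1 : 0 < s * (f a - a)) (h2 : s * (f b - b) < 0)
    (h3 : 0 < s * (f c - c)) (h4 : s * (f d - d) < 0) : Alt f 4 (tup a b c d) := by
  refine ⟨s, fun i hi => ?_⟩
  have : i = 0 ∨ i = 1 ∨ i = 2 ∨ i = 3 := by omega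
  rcases this with rfl | rfl | rfl | rfl <;> simp only [tup] <;> norm_num <;> linarith

lemma ne_one_of {f : GR} {x : ℝ} (h : f x ≠ x) : f ≠ 1 := by rintro rfl; exact h rfl

lemma step_F {N : ℕ} {G : Subgroup GR} (hB : Bd N G) (hA : NoAlt G 3) {g : GR} (hg : g ∈ G) {p0 p1 : ℝ} (hp : p0 < p1)
    (h0 : p0 < g p0) (h1 : g p1 < p1) : g ∉ ⁅G, G⁆ := by
  have hne : g ≠ 1 := ne_one_of h0.ne'
  have hbot : ∀ᶠ x in atBot, x < g x := by
    refine (ev_bot hB hg hne).resolve_right (fun h => ?_)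
    obtain ⟨x, hx, hx2⟩ := (h.and (eventually_lt_atBot p0)).exists
    exact hA g hg (tup x p0 p1 0) (inc3 hx2 hp) (alt3 (-1) (by linarith) (by linarith) (by linarith))
  have htop : ∀ᶠ x in atTop, g x < x := by
    refine (ev_top hB hg hne).resolve_left (fun h => ?_)
    obtain ⟨x, hx, hx2⟩ := (h.and (eventually_gt_atTop p1)).exists
    exact hA g hg (tup p0 p1 x 0) (inc3 hp hx2) (alt3 1 (by linarith) (by linarith) (by linarith))
  apply not_comm hB hg hbot
  intro w hw
  by_contra hn
  rw [not_exists] at hn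
  have hn' : ∀ n : ℕ, ∀ᶠ x in atBot, (g ^ n) x < w x := fun n => 
    (bot_total hB hw (G.pow_mem hg n)).resolve_left (hn n)
  obtain ⟨L, hL⟩ := eventually_atBot.1 hbot
  obtain ⟨M, hM⟩ := eventually_atTop.1 htop
  obtain ⟨x2, hx2, hx2'⟩ := ((eventually_gt_atTop M).and (eventually_gt_atTop (w⁻¹ M))).exists
  obtain ⟨x1, hx1, hx1', hx1''⟩ := ((eventually_lt_atBot L).and ((eventually_lt_atBot (w⁻¹ L)).and (eventually_lt_atBot x2))).exists
  rw [inv_lt_iff] at hx2'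
  rw [lt_inv_iff] at hx1'
  have e1 := escape_ev g x1 L hx1.le (fun x _ h => hL x h)
  have e2 := escape_ev g⁻¹ M x2 hx2.le (fun x h _ => (lt_inv_iff _ _ _).2 (hM x h))
  obtain ⟨n, n1, n2⟩ := (e1.and e2).exists
  rw [inv_pow, lt_inv_iff] at n2
  obtain ⟨x0, hx0, hx0'⟩ := ((hn' n).and (eventually_lt_atBot x1)).exists
  refine hA ((g^n)⁻¹ * w) (G.mul_mem (G.inv_mem (G.pow_mem hg n)) hw) (tup x0 x1 x2 0) (inc3 hx0' hx1'') 
    (alt3 1 ?_ ?_ ?_)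
  · have : x0 < ((g^n)⁻¹ * w) x0 := by rw [RelIso.mul_apply, lt_inv_iff]; exact hx0
    linarith
  · have : ((g^n)⁻¹ * w) x1 < x1 := by rw [RelIso.mul_apply, inv_lt_iff]; linarith
    linarith
  · have : x2 < ((g^n)⁻¹ * w) x2 := by rw [RelIso.mul_apply, lt_inv_iff]; linarith
    linarith

lemma noalt2 {N : ℕ} {G : Subgroup GR} (hB : Bd N G) (hA : NoAlt G 3) : NoAlt ⁅G, G⁆ 2 := by
  intro f hf p hp ha
  obtain ⟨s, hs1, hs⟩ := ha.norm
  have hle : ⁅G, G⁆ ≤ G := Subgroup.commutator_le_self G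
  have p01 := hp 0 1 (by omega) (by omega)
  have s0 := hs 0 (by omega)
  have s1 := hs 1 (by omega)
  rcases hs1 with rfl | rfl
  · exact step_F hB hA (hle hf) p01 (by linarith) (by linarith) hf
  · refine step_F hB hA (hle (inv_mem hf)) p01 ?_ ?_ (inv_mem hf)
    · rw [lt_inv_iff]; linarith
    · rw [inv_lt_iff]; linarith

structure Shape (f : GR) (L B R M : ℝ) : Prop where
  hL : ∀ x, x ≤ L → x < f x
  hBR : B < R
  hm : ∀ x, B < x → x < R → f x < x
  hM : ∀ x, M ≤ x → x < f x

lemma claimE {G : Subgroup GR} (hA : NoAlt G 4) {f w : GR} (hf : f ∈ G) (hw : w ∈ G) {L B R M : ℝ} (hS : Shape f L B R M)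
    (hn : ∀ n : ℕ, ∀ᶠ x in atBot, (f ^ n) x < w x) : w R ≤ B := by
  by_contra hR
  push Not at hR
  obtain ⟨x2, hx2, hx2R⟩ := exists_between (max_lt hS.hBR ((inv_lt_iff w _ _).2 hR))
  have hx2B : B < x2 := (le_max_left _ _).trans_lt hx2
  have hx2w : B < w x2 := (inv_lt_iff _ _ _).1 ((le_max_right _ _).trans_lt hx2)
  obtain ⟨y, hy1, hy2⟩ := exists_between (lt_min hx2B hx2w)
  have hyx : y < x2 := hy2.trans_le (min_le_left _ _)
  have hyw : y < w x2 := hy2.trans_le (min_le_right _ _)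
  obtain ⟨x1, hx1, hx1', hx1''⟩ := ((eventually_lt_atBot L).and ((eventually_lt_atBot (w⁻¹ L)).and (eventually_lt_atBot x2))).exists
  rw [lt_inv_iff] at hx1'
  obtain ⟨x3, hx3, hx3'⟩ := ((eventually_gt_atTop M).and (eventually_gt_atTop x2)).exists
  have e1 := escape_ev f x1 L hx1.le (fun x _ h => hS.hL x h)
  have e2 := escape_ev f⁻¹ y x2 hyx.le (fun x h h' => (lt_inv_iff _ _ _).2 (hS.hm x (hy1.trans_le h) (h'.trans_lt hx2R)))
  have e3 := escape_ev f x3 (max x3 (w x3)) (le_max_left _ _) (fun x h _ => hS.hM x (by linarith))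
  obtain ⟨n, n1, n2, n3⟩ := (e1.and (e2.and e3)).exists
  rw [inv_pow, lt_inv_iff] at n2
  obtain ⟨x0, hx0, hx0'⟩ := ((hn n).and (eventually_lt_atBot x1)).exists
  refine hA ((f^n)⁻¹ * w) (G.mul_mem (G.inv_mem (G.pow_mem hf n)) hw) (tup x0 x1 x2 x3) (inc4 hx0' hx1'' hx3') 
    (alt4 1 ?_ ?_ ?_ ?_)
  · have : x0 < ((f^n)⁻¹ * w) x0 := by rw [RelIso.mul_apply, lt_inv_iff]; exact hx0
    linarith
  · have : ((f^n)⁻¹ * w) x1 < x1 := by rw [RelIso.mul_apply, inv_lt_iff]; linarith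
    linarith
  · have : x2 < ((f^n)⁻¹ * w) x2 := by rw [RelIso.mul_apply, lt_inv_iff]; linarith
    linarith
  · have : ((f^n)⁻¹ * w) x3 < x3 := by 
      rw [RelIso.mul_apply, inv_lt_iff]; exact (le_max_right _ _).trans_lt n3
    linarith

lemma le_bot_pow {a b : GR} (h : ∀ᶠ x in atBot, a x ≤ b x) (n : ℕ) : ∀ᶠ x in atBot, (a^n) x ≤ (b^n) x := by
  induction n with
  | zero => simp
  | succ n ih =>
    filter_upwards [h, (OrderIso.tendsto_atBot b).eventually ih] with x h1 h2
    rw [pow_succ, pow_succ, RelIso.mul_apply, RelIso.mul_apply]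
    exact ((a^n).le_iff_le.2 h1).trans h2

lemma Shape.conj {f : GR} {L B R M : ℝ} (h : Shape f L B R M) (v : GR) : 
    Shape (v⁻¹ * f * v) (v⁻¹ L) (v⁻¹ B) (v⁻¹ R) (v⁻¹ M) := by
  refine ⟨?_, (v⁻¹).lt_iff_lt.2 h.hBR, ?_, ?_⟩
  · intro x hx
    rw [le_inv_iff] at hx
    simp only [RelIso.mul_apply]; rw [lt_inv_iff]; exact h.hL _ hx
  · intro x h1 h2
    rw [inv_lt_iff] at h1
    rw [lt_inv_iff] at h2
    simp only [RelIso.mul_apply]; rw [inv_lt_iff]; exact h.hm _ h1 h2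
  · intro x hx
    rw [inv_le_iff] at hx
    simp only [RelIso.mul_apply]; rw [lt_inv_iff]; exact h.hM _ hx

lemma step_E {N : ℕ} {G : Subgroup GR} (hB : Bd N G) (hI : Irr G) (hA : NoAlt G 4) {f : GR} (hf : f ∈ G) 
    {p0 p1 p2 : ℝ} (hp : p0 < p1) (hp' : p1 < p2)
    (h0 : p0 < f p0) (h1 : f p1 < p1) (h2 : p2 < f p2) : f ∉ ⁅G, G⁆ := by
  have hne : f ≠ 1 := ne_one_of h0.ne'
  have hbot : ∀ᶠ x in atBot, x < f x := by
    refine (ev_bot hB hf hne).resolve_right (fun h => ?_)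
    obtain ⟨x, hx, hx2⟩ := (h.and (eventually_lt_atBot p0)).exists
    exact hA f hf (tup x p0 p1 p2) (inc4 hx2 hp hp') (alt4 (-1) (by linarith) (by linarith) (by linarith) (by linarith))
  have htop : ∀ᶠ x in atTop, x < f x := by
    refine (ev_top hB hf hne).resolve_right (fun h => ?_)
    obtain ⟨x, hx, hx2⟩ := (h.and (eventually_gt_atTop p2)).exists
    exact hA f hf (tup p0 p1 p2 x) (inc4 hp hp' hx2) (alt4 1 (by linarith) (by linarith) (by linarith) (by linarith))
  obtain ⟨L, hL⟩ := eventually_atBot.1 hbot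
  obtain ⟨M, hM⟩ := eventually_atTop.1 htop
  have hmid : ∀ᶠ x in 𝓝 p1, f x - x < 0 := (dcont f).continuousAt.eventually_lt_const (by linarith)
  obtain ⟨B, R, hBR, hsub⟩ := mem_nhds_iff_exists_Ioo_subset.1 hmid
  have hS : Shape f L B R M := ⟨hL, hBR.1.trans hBR.2, fun x a b => by 
    have : f x - x < 0 := hsub ⟨a, b⟩
    linarith, hM⟩
  apply not_comm hB hf hbot
  intro w hw
  by_contra hn
  rw [not_exists] at hn
  have hn' : ∀ n : ℕ, ∀ᶠ x in atBot, (f ^ n) x < w x := fun n => 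
    (bot_total hB hw (G.pow_mem hf n)).resolve_left (hn n)
  obtain ⟨L', hL'⟩ := eventually_atBot.1 (hn' 0)
  obtain ⟨v, hv, hvp⟩ := push hI (min L' R) (max R M)
  have hvR : v⁻¹ R < min L' R := (inv_lt_iff _ _ _).2 ((le_max_left _ _).trans_lt hvp)
  have hvM : v⁻¹ M < min L' R := (inv_lt_iff _ _ _).2 ((le_max_right _ _).trans_lt hvp)
  have hS2 := hS.conj v
  have hG2 : v⁻¹ * f * v ∈ G := G.mul_mem (G.mul_mem (G.inv_mem hv) hf) hv
  have hex : ∃ n : ℕ, ∀ᶠ x in atBot, w x ≤ ((v⁻¹ * f * v)^n) x := by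
    by_contra hn2
    rw [not_exists] at hn2
    have h3 := claimE hA hG2 hw hS2 (fun n => (bot_total hB hw (G.pow_mem hG2 n)).resolve_left (hn2 n))
    have h4 := hL' (v⁻¹ R) (hvR.le.trans (min_le_left _ _))
    simp only [pow_zero, RelIso.coe_one, id] at h4
    linarith [hS2.hBR]
  obtain ⟨n, hwn⟩ := hex
  have h5 : ∀ m : ℕ, ∀ᶠ x in atBot, (f ^ m) x < (v⁻¹ * f * v) x := by
    intro m
    refine (bot_total hB hG2 (G.pow_mem hf m)).resolve_left (fun h => ?_)
    apply hn (m * n)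
    filter_upwards [hwn, le_bot_pow h n] with x a1 a2
    rw [pow_mul]
    exact a1.trans a2
  have h6 := claimE hA hf hG2 hS h5
  have h7 := hS2.hM R (hvM.le.trans (min_le_right _ _))
  linarith [hS.hBR]

lemma noalt3 {N : ℕ} {G : Subgroup GR} (hB : Bd N G) (hI : Irr G) (hA : NoAlt G 4) : NoAlt ⁅G, G⁆ 3 := by
  intro f hf p hp ha
  obtain ⟨s, hs1, hs⟩ := ha.norm
  have hle : ⁅G, G⁆ ≤ G := Subgroup.commutator_le_self G
  have p01 := hp 0 1 (by omega) (by omega)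
  have p12 := hp 1 2 (by omega) (by omega)
  have s0 := hs 0 (by omega)
  have s1 := hs 1 (by omega)
  have s2 := hs 2 (by omega)
  rcases hs1 with rfl | rfl
  · exact step_E hB hI hA (hle hf) p01 p12 (by linarith) (by linarith) (by linarith) hf
  · refine step_E hB hI hA (hle (inv_mem hf)) p01 p12 ?_ ?_ ?_ (inv_mem hf)
    · rw [lt_inv_iff]; linarith
    · rw [inv_lt_iff]; linarith
    · rw [lt_inv_iff]; linarith

end Aux
end

section
open Set Filter Topology
open scoped commutatorElement
namespace Aux

/-- `T` is normalized by `G`. -/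
def Nz (G T : Subgroup GR) : Prop := ∀ g ∈ G, ∀ t ∈ T, g * t * g⁻¹ ∈ T
def Free (T : Subgroup GR) : Prop := ∀ t ∈ T, ∀ x, t x = x → t = 1

lemma Nz.comm {G T : Subgroup GR} (h : Nz G T) : Nz G ⁅T, T⁆ := by
  intro g hg t ht
  have h1 : T.map (MulAut.conj g).toMonoidHom ≤ T := by
    rintro _ ⟨x, hx, rfl⟩
    exact h g hg x hx
  have h2 : ⁅T, T⁆.map (MulAut.conj g).toMonoidHom ≤ ⁅T, T⁆ := by
    rw [Subgroup.map_commutator]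
    exact Subgroup.commutator_mono h1 h1
  exact h2 ⟨t, ht, rfl⟩

lemma Nz.self (G : Subgroup GR) : Nz G G := fun _ hg _ ht => G.mul_mem (G.mul_mem hg ht) (G.inv_mem hg)

lemma Bd.mono {N : ℕ} {G T : Subgroup GR} (h : Bd N G) (hT : T ≤ G) : Bd N T := fun f hf => h f (hT hf)

lemma moves {N : ℕ} {G T : Subgroup GR} (hB : Bd N T) (hI : Irr G) (hz : Nz G T) (hN : ND T) (p : ℝ) :
    ∃ᶠ h in LF, h ∈ T ∧ h p ≠ p := by
  classical
  intro hn
  obtain ⟨g, hg, _, hgs⟩ := exists_seq hI p p le_rfl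
  have : ∀ᶠ h in LF, ∀ j ∈ Finset.range (N+1), ¬ ((g j)⁻¹ * h * (g j)⁻¹⁻¹ ∈ T ∧ ((g j)⁻¹ * h * (g j)⁻¹⁻¹) p ≠ p) := by
    rw [Finset.eventually_all]
    intro j _
    exact (tendsto_conj (g j)⁻¹).eventually hn
  obtain ⟨h, ⟨h1, h2⟩, h3⟩ := (hN.and_eventually this).exists
  apply h2
  apply hB.inj h1 ((Finset.range (N+1)).image (fun j => g j p))
  · intro x hx
    obtain ⟨j, hj, rfl⟩ := Finset.mem_image.1 hx
    have h4 := h3 j hj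
    rw [not_and_not_right] at h4
    have h5 := h4 (hz _ (inv_mem (hg j)) _ h1)
    simp only [inv_inv, RelIso.mul_apply] at h5
    conv_rhs => rw [← h5]
    rw [RelIso.apply_inv_self]
  · rw [Finset.card_image_of_injective]
    · simp
    · intro i j hij
      rcases lt_trichotomy i j with h | h | h
      · exact absurd hij (hgs i j h).1.ne
      · exact h
      · exact absurd hij (hgs j i h).1.ne'

lemma free_of {N : ℕ} {G T : Subgroup GR} (hB : Bd N T) (hI : Irr G) (hz : Nz G T) (hN : ND T) (hA : NoAlt T 2) :
    Free T := by
  intro f hf p hp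
  by_contra h1
  have hex : ∃ x, p < x ∧ f x ≠ x := by
    rcases ev_top hB hf h1 with h | h
    · obtain ⟨x, hx, hx2⟩ := (h.and (eventually_gt_atTop p)).exists
      exact ⟨x, hx2, hx.ne'⟩
    · obtain ⟨x, hx, hx2⟩ := (h.and (eventually_gt_atTop p)).exists
      exact ⟨x, hx2, hx.ne⟩
  obtain ⟨p2, hp2, hne⟩ := hex
  have hmv := moves hB hI hz hN p
  rcases lt_or_gt_of_ne hne with h | h
  · have e1 := (tendsto_eval (f p2)).eventually_lt_const h
    have e2 := tendsto_inv.eventually e1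
    have key : ∀ k ∈ T, p < k p → k (f p2) < p2 → False := by
      intro k hk hk1 hk2
      refine hA (k * f) (T.mul_mem hk hf) (tup p p2 0 0) (inc2 hp2) (alt2 1 ?_ ?_)
      · rw [RelIso.mul_apply, hp]; linarith
      · rw [RelIso.mul_apply]; linarith
    obtain ⟨k, ⟨hk, hkp⟩, k1, k2⟩ := (hmv.and_eventually (e1.and e2)).exists
    rcases lt_or_gt_of_ne hkp with h | h
    · exact key k⁻¹ (T.inv_mem hk) ((lt_inv_iff _ _ _).2 h) k2
    · exact key k hk h k1
  · have e1 := (tendsto_eval (f p2)).eventually_const_lt h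
    have e2 := tendsto_inv.eventually e1
    have key : ∀ k ∈ T, k p < p → p2 < k (f p2) → False := by
      intro k hk hk1 hk2
      refine hA (k * f) (T.mul_mem hk hf) (tup p p2 0 0) (inc2 hp2) (alt2 (-1) ?_ ?_)
      · rw [RelIso.mul_apply, hp]; linarith
      · rw [RelIso.mul_apply]; linarith
    obtain ⟨k, ⟨hk, hkp⟩, k1, k2⟩ := (hmv.and_eventually (e1.and e2)).exists
    rcases lt_or_gt_of_ne hkp with h | h
    · exact key k hk h k1
    · exact key k⁻¹ (T.inv_mem hk) ((inv_lt_iff _ _ _).2 h) k2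

lemma fix_of_commute {f h : GR} (hc : h * f = f * h) {p : ℝ} (hp : f p = p) (hmin : ∀ x, f x = x → p ≤ x) : h p = p := by
  have a1 : f (h p) = h p := by
    rw [← RelIso.mul_apply, ← hc, RelIso.mul_apply, hp]
  have hc' : h⁻¹ * f = f * h⁻¹ := by
    rw [inv_mul_eq_iff_eq_mul, ← mul_assoc, hc, mul_assoc, mul_inv_cancel, mul_one]
  have a2 : f (h⁻¹ p) = h⁻¹ p := by
    rw [← RelIso.mul_apply, ← hc', RelIso.mul_apply, hp]
  have b1 := hmin _ a1
  have b2 := hmin _ a2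
  rw [le_inv_iff] at b2
  exact le_antisymm b2 b1

lemma nd_comm {N : ℕ} {G T : Subgroup GR} (hB : Bd N T) (hI : Irr G) (hz : Nz G T) (hN : ND T) (hf : ¬ Free T) :
    ND ⁅T, T⁆ := by
  classical
  unfold Free at hf
  push Not at hf
  obtain ⟨f, hfT, x, hx, hf1⟩ := hf
  have hfin := hB.fin hfT hf1
  obtain ⟨p, hp, hmin⟩ := hfin.exists_minimal ⟨x, hx⟩
  have hp : f p = p := hp
  have hmin : ∀ x, f x = x → p ≤ x := by
    intro y hy
    rcases le_total p y with h | h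
    · exact h
    · exact hmin hy h
  obtain ⟨g, hg, _, hgs⟩ := exists_seq hI p p le_rfl
  intro hn
  have : ∀ᶠ h in LF, ∀ j ∈ Finset.range (N+1), ¬ (cm h (g j * f * (g j)⁻¹) ∈ ⁅T, T⁆ ∧ cm h (g j * f * (g j)⁻¹) ≠ 1) := by
    rw [Finset.eventually_all]
    intro j _
    exact (tendsto_cm _).eventually hn
  obtain ⟨h, ⟨h1, h2⟩, h3⟩ := (hN.and_eventually this).exists
  apply h2
  apply hB.inj h1 ((Finset.range (N+1)).image (fun j => g j p))
  · intro x hx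
    obtain ⟨j, hj, rfl⟩ := Finset.mem_image.1 hx
    have h4 := h3 j hj
    rw [not_and_not_right] at h4
    have hk : g j * f * (g j)⁻¹ ∈ T := hz _ (hg j) _ hfT
    have h5 := h4 (by
      have := Subgroup.commutator_mem_commutator (T.inv_mem h1) (T.inv_mem hk)
      rw [commutatorElement_def] at this
      simpa [cm, mul_assoc] using this)
    apply fix_of_commute (f := g j * f * (g j)⁻¹)
    · rw [cm] at h5
      have h6 := inv_mul_eq_one.1 h5
      have : (g j * f * (g j)⁻¹) * h = h * (g j * f * (g j)⁻¹) := by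
        conv_lhs => rw [h6]
        simp only [mul_assoc, mul_inv_cancel_left]
      exact this.symm
    · simp only [RelIso.mul_apply, RelIso.inv_apply_self, hp]
    · intro x hx
      rw [← le_inv_iff]
      apply hmin
      apply (g j).injective
      rw [RelIso.apply_inv_self]
      exact hx
  · rw [Finset.card_image_of_injective]
    · simp
    · intro i j hij
      rcases lt_trichotomy i j with h | h | h
      · exact absurd hij (hgs i j h).1.ne
      · exact h
      · exact absurd hij (hgs j i h).1.ne'

lemma exists_T {N : ℕ} {G : Subgroup GR} (hB : Bd N G) (hI : Irr G) (hN : ND ⁅G, G⁆) :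
    ∃ T : Subgroup GR, Nz G T ∧ ND T ∧ Free T := by
  have hle : ⁅G, G⁆ ≤ G := Subgroup.commutator_le_self G
  have hle2 : ⁅(⁅G, G⁆), ⁅G, G⁆⁆ ≤ ⁅G, G⁆ := Subgroup.commutator_le_self _
  have hNG : ND G := hN.mono (fun h hh => ⟨hle hh.1, hh.2⟩)
  have hA4 := no_alt4 hB hI hNG
  have hA3 := noalt3 hB hI hA4
  have hz1 := (Nz.self G).comm
  have hB1 := hB.mono hle
  by_cases hfr : Free ⁅G, G⁆
  · exact ⟨_, hz1, hN, hfr⟩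
  · have hN2 := nd_comm hB1 hI hz1 hN hfr
    exact ⟨_, hz1.comm, hN2, free_of (hB1.mono hle2) hI hz1.comm hN2 (noalt2 hB1 hA3)⟩

end Aux
end

section
open Set Filter Topology
namespace Aux

lemma free_lt {T : Subgroup GR} (hF : Free T) {t : GR} (ht : t ∈ T) {x : ℝ} (hx : x < t x) (y : ℝ) : y < t y := by
  have hne : t ≠ 1 := ne_one_of hx.ne'
  have hz : ∀ z, t z - z ≠ 0 := fun z hz => hne (hF t ht z (by linarith))
  rcases le_total x y with h | h
  · have := const_sign (dcont t) h (fun z _ _ => hz z) (by linarith)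
    linarith
  · have := const_sign' (dcont t) h (fun z _ _ => hz z) (by linarith)
    linarith

lemma free_cmp {T : Subgroup GR} (hF : Free T) (a b : T) {x : ℝ} (hx : (a:GR) x < (b:GR) x) (y : ℝ) :
    (a:GR) y < (b:GR) y := by
  have h1 : x < ((a:GR)⁻¹ * b) x := by rw [RelIso.mul_apply, lt_inv_iff]; exact hx
  have := free_lt hF (T.mul_mem (T.inv_mem a.2) b.2) h1 y
  rw [RelIso.mul_apply, lt_inv_iff] at this; exact this

lemma free_cmp_le {T : Subgroup GR} (hF : Free T) (a b : T) {x : ℝ} (hx : (a:GR) x ≤ (b:GR) x) (y : ℝ) :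
    (a:GR) y ≤ (b:GR) y := by
  by_contra h
  push Not at h
  exact absurd (free_cmp hF b a h x) (not_lt.2 hx)

lemma free_small {T : Subgroup GR} (hF : Free T) (hN : ND T) (n : ℕ) (x y : ℝ) (hxy : x < y) :
    ∃ h : T, (∀ z, z < (h:GR) z) ∧ ((h:GR)^n) x < y := by
  have e1 := (tendsto_eval x).eventually_lt_const hxy
  have e2 := (tendsto_pow n).eventually e1
  have e3 := tendsto_inv.eventually e2
  obtain ⟨h, ⟨h1, h2⟩, h3, h4⟩ := (hN.and_eventually (e2.and e3)).exists
  have hne : h 0 ≠ 0 := fun h0 => h2 (hF h h1 0 h0)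
  rcases lt_or_gt_of_ne hne with h0 | h0
  · refine ⟨⟨h⁻¹, T.inv_mem h1⟩, free_lt hF (T.inv_mem h1) (x := 0) ((lt_inv_iff _ _ _).2 h0), h4⟩
  · exact ⟨⟨h, h1⟩, free_lt hF h1 h0, h3⟩

lemma free_arch (f : GR) (hf : ∀ x, x < f x) (g : GR) (x : ℝ) : ∃ n : ℕ, g x < (f^n) x := by
  rcases le_total x (g x) with h | h
  · exact escape f x (g x) (fun z _ _ => hf z)
  · exact ⟨1, by rw [pow_one]; exact lt_of_le_of_lt h (hf x)⟩

lemma hom_pow {T : Subgroup GR} {τ : T → ℝ} (h : ∀ a b, τ (a*b) = τ a + τ b) (a : T) (n : ℕ) : τ (a^n) = n * τ a := by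
  induction n with
  | zero =>
    have := h 1 1
    simp at this; simp [this]
  | succ n ih => rw [pow_succ, h, ih]; push_cast; ring

lemma hom_inv {T : Subgroup GR} {τ : T → ℝ} (h : ∀ a b, τ (a*b) = τ a + τ b) (a : T) : τ (a⁻¹) = - τ a := by
  have h1 := h 1 1
  have h2 := h a⁻¹ a
  simp at h1 h2
  linarith

lemma exists_tau {T : Subgroup GR} (hF : Free T) (hN : ND T) : ∃ τ : T → ℝ, ∃ t0 : T,
    (∀ a b, τ (a*b) = τ a + τ b) ∧ (∀ a b : T, ∀ x, (a:GR) x ≤ (b:GR) x → τ a ≤ τ b) ∧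
    (∀ a b : T, ∀ x, (a:GR) x < (b:GR) x → τ a < τ b) ∧ (∀ x, x < (t0:GR) x) ∧ τ t0 = 1 ∧
    (∀ ε > 0, ∀ x y, x < y → ∃ h : T, (∀ z, z < (h:GR) z) ∧ (h:GR) x < y ∧ τ h < ε) := by
  obtain ⟨t0, ht0, -⟩ := free_small hF hN 0 0 1 one_pos
  suffices hex : ∃ τ : T → ℝ, (∀ a b, τ (a*b) = τ a + τ b) ∧ (∀ a b : T, (a:GR) 0 ≤ (b:GR) 0 → τ a ≤ τ b) ∧ τ t0 = 1 by
    obtain ⟨τ, h1, h2, h3⟩ := hex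
    have hmono : ∀ a b : T, ∀ x, (a:GR) x ≤ (b:GR) x → τ a ≤ τ b := fun a b x h => h2 a b (free_cmp_le hF a b h 0)
    have hpos : ∀ h : T, (∀ z, z < (h:GR) z) → 0 < τ h := by
      intro h hh
      obtain ⟨n, hn⟩ := free_arch (h:GR) hh (t0:GR) 0
      have h4 := h2 t0 (h^n) (by simpa using hn.le)
      rw [h3, hom_pow h1] at h4
      by_contra h5
      push Not at h5
      have : (n:ℝ) * τ h ≤ 0 := mul_nonpos_of_nonneg_of_nonpos (Nat.cast_nonneg n) h5
      linarith
    refine ⟨τ, t0, h1, hmono, ?_, ht0, h3, ?_⟩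
    · intro a b x hx
      have h4 : x < ((a⁻¹ * b : T) : GR) x := by
        push_cast
        rw [RelIso.mul_apply, lt_inv_iff]; exact hx
      have h5 := hpos (a⁻¹ * b) (free_lt hF (a⁻¹ * b).2 h4)
      rw [h1, hom_inv h1] at h5
      linarith
    · intro ε hε x y hxy
      obtain ⟨n, hn⟩ := exists_nat_one_div_lt hε
      have hm : x < min y ((t0:GR) x) := lt_min hxy (ht0 x)
      obtain ⟨h, hh1, hh2⟩ := free_small hF hN (n+1) x _ hm
      refine ⟨h, hh1, ?_, ?_⟩
      · refine lt_of_le_of_lt ?_ (lt_of_lt_of_le hh2 (min_le_left _ _))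
        rw [pow_succ', RelIso.mul_apply]
        apply (h:GR).le_iff_le.2
        rcases n with _ | n
        · simp
        · exact (pow_gt _ _ (hh1 x) n).le
      · have := hmono (h^(n+1)) t0 x (by simpa using (lt_of_lt_of_le hh2 (min_le_right _ _)).le)
        rw [h3, hom_pow h1] at this
        refine lt_of_le_of_lt ?_ hn
        rw [le_div_iff₀ (by positivity)]
        push_cast at this
        linarith
  refine ord_hom (G := T) (fun a b => (a:GR) 0 ≤ (b:GR) 0) ?_ ?_ ?_ ?_ t0 ?_ ?_
  · intro a b; exact le_total _ _
  · intro a b c h1 h2; exact h1.trans h2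
  · intro c a b h
    exact (c:GR).le_iff_le.2 h
  · intro c a b h
    exact free_cmp_le hF a b h _
  · exact not_le.2 (ht0 0)
  · intro g
    obtain ⟨n, hn⟩ := free_arch (t0:GR) ht0 g 0
    exact ⟨n, by simpa using hn.le⟩

lemma exists_D {G T : Subgroup GR} (hz : Nz G T) (hF : Free T) (hN : ND T) :
    ∃ D : ℝ → ℝ, StrictMono D ∧ D 0 = 0 ∧ (∃ x1, D x1 = 1) ∧
      ∀ g ∈ G, ∃ a b : ℝ, 0 < a ∧ ∀ x, D (g x) = a * D x + b := by
  obtain ⟨τ, t0, hom, mono, smono, ht0, hτ0, small⟩ := exists_tau hF hN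
  have hone : τ 1 = 0 := by have := hom 1 1; simp at this; exact this
  set S : ℝ → Set ℝ := fun x => {r | ∃ t : T, (t:GR) 0 ≤ x ∧ τ t = r} with hS
  have harch : ∀ x y, ∃ n : ℕ, y < ((t0:GR)^n) x := by
    intro x y
    obtain ⟨n, hn⟩ := escape (t0:GR) x y (fun z _ _ => ht0 z)
    exact ⟨n, hn⟩
  have hne : ∀ x, (S x).Nonempty := by
    intro x
    obtain ⟨n, hn⟩ := harch x 0
    refine ⟨_, (t0^n)⁻¹, ?_, rfl⟩
    push_cast
    rw [inv_le_iff]; exact hn.le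
  have hbd : ∀ x, BddAbove (S x) := by
    intro x
    obtain ⟨n, hn⟩ := harch 0 x
    refine ⟨τ (t0^n), ?_⟩
    rintro r ⟨t, ht, rfl⟩
    exact mono _ _ 0 (by push_cast; linarith)
  set D : ℝ → ℝ := fun x => sSup (S x) with hD
  have Dle : ∀ t : T, ∀ x, (t:GR) 0 ≤ x → τ t ≤ D x := fun t x h => le_csSup (hbd x) ⟨t, h, rfl⟩
  have leD : ∀ x r, (∀ t : T, (t:GR) 0 ≤ x → τ t ≤ r) → D x ≤ r := by
    intro x r h
    apply csSup_le (hne x)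
    rintro _ ⟨t, ht, rfl⟩
    exact h t ht
  have Dmono : Monotone D := fun x y hxy => leD x _ (fun t ht => Dle t y (ht.trans hxy))
  have Dt1 : ∀ (t : T) x, D ((t:GR) x) ≤ D x + τ t := by
    intro t x
    apply leD
    intro s hs
    have := Dle (t⁻¹ * s) x (by push_cast; rw [RelIso.mul_apply, inv_le_iff]; exact hs)
    rw [hom, hom_inv hom] at this
    linarith
  have Dt : ∀ (t : T) x, D ((t:GR) x) = D x + τ t := by
    intro t x
    apply le_antisymm (Dt1 t x)
    have := Dt1 t⁻¹ ((t:GR) x)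
    rw [hom_inv hom] at this
    push_cast at this
    rw [RelIso.inv_apply_self] at this
    linarith
  have D0 : D 0 = 0 := by
    apply le_antisymm
    · apply leD
      intro t ht
      rw [← hone]
      exact mono _ _ 0 ht
    · have := Dle 1 0 (by simp)
      rwa [hone] at this
  have tpos : ∀ h : T, (∀ z, z < (h:GR) z) → 0 < τ h := by
    intro h hh
    rw [← hone]
    exact smono 1 h 0 (hh 0)
  have Ds : StrictMono D := by
    intro x y hxy
    obtain ⟨h, h1, h2, h3⟩ := small 1 one_pos x y hxy
    have := Dmono h2.le
    rw [Dt] at this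
    linarith [tpos h h1]
  refine ⟨D, Ds, D0, ⟨(t0:GR) 0, by rw [Dt, D0, hτ0]; norm_num⟩, ?_⟩
  intro g hg
  set c : T → T := fun t => ⟨g * t * g⁻¹, hz g hg t t.2⟩ with hc
  have cm_ : ∀ a b, c (a*b) = c a * c b := by
    intro a b
    apply Subtype.ext
    simp [hc, mul_assoc]
  have cap : ∀ t x, (c t : GR) (g x) = g ((t:GR) x) := by
    intro t x
    simp [hc, RelIso.mul_apply]
  have cmono : ∀ a b : T, ∀ x, (a:GR) x ≤ (b:GR) x → τ (c a) ≤ τ (c b) := by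
    intro a b x h
    apply mono _ _ (g x)
    rw [cap, cap]; exact g.le_iff_le.2 h
  set lam := τ (c t0) with hlam
  have hlp : 0 < lam := by
    rw [hlam, ← hone]
    apply smono _ _ (g 0)
    rw [cap]
    exact g.lt_iff_lt.2 (ht0 0)
  set s : T → ℝ := fun t => τ (c t) - lam * τ t with hs
  have shom : ∀ a b, s (a*b) = s a + s b := by
    intro a b
    simp only [hs, cm_, hom]; ring
  have st0 : s t0 = 0 := by simp [hs, hτ0, hlam]
  have chom : ∀ a b, τ (c (a*b)) = τ (c a) + τ (c b) := by intro a b; rw [cm_, hom]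
  have sbd : ∀ t : T, (∀ x, x ≤ (t:GR) x) → s t ≤ lam := by
    intro t ht
    have hex : ∃ n : ℕ, (t:GR) 0 ≤ ((t0:GR)^n) 0 := (free_arch _ ht0 (t:GR) 0).imp (fun _ h => h.le)
    classical
    have hn := Nat.find_spec hex
    rcases hN0 : Nat.find hex with _ | m
    · rw [hN0] at hn
      have h1 := cmono t 1 0 (by simpa using hn)
      have h2 := mono 1 t 0 (by simpa using ht 0)
      have h3 : τ (c 1) = 0 := by
        have := chom 1 1
        simp at this; exact this
      simp only [hs]
      rw [hone] at h2
      nlinarith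
    · rw [hN0] at hn
      have hm := Nat.find_min hex (m := m) (by omega)
      have h1 := cmono t (t0^(m+1)) 0 (by simpa using hn)
      have h2 := mono (t0^m) t 0 (by push_cast; linarith)
      rw [hom_pow hom] at h2
      rw [hom_pow (τ := fun t => τ (c t)) chom] at h1
      simp only [hs]
      rw [hτ0] at h2
      push_cast at h1
      rw [← hlam] at h1
      nlinarith
  have spos : ∀ t : T, (∀ x, x ≤ (t:GR) x) → s t ≤ 0 := by
    intro t ht
    by_contra h
    push Not at h
    obtain ⟨n, hn⟩ := exists_nat_gt (lam / s t)
    have := sbd (t^n) (by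
      intro x
      rcases n with _ | n
      · simp
      · rcases (ht x).eq_or_lt with h | h
        · have : (t:GR) = 1 := hF _ t.2 x h.symm
          simp [this]
        · simpa using (pow_gt _ _ h n).le)
    rw [hom_pow shom] at this
    rw [div_lt_iff₀ h] at hn
    linarith
  have spos2 : ∀ t : T, (∀ x, x ≤ (t:GR) x) → 0 ≤ s t := by
    intro t ht
    obtain ⟨n, hn⟩ := free_arch _ ht0 (t:GR) 0
    have h1 := spos (t⁻¹ * t0^n) (by
      intro x
      push_cast
      rw [RelIso.mul_apply, le_inv_iff]
      exact free_cmp_le hF t (t0^n) (x := 0) (by push_cast; exact hn.le) x)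
    rw [shom, hom_inv shom, hom_pow shom, st0] at h1
    linarith
  have s0 : ∀ t, s t = 0 := by
    intro t
    rcases le_total 0 ((t:GR) 0) with h | h
    · have := free_cmp_le hF 1 t h
      exact le_antisymm (spos t this) (spos2 t this)
    · have := free_cmp_le hF 1 t⁻¹ (x := 0) (by push_cast; rw [le_inv_iff]; exact h)
      have := le_antisymm (spos _ this) (spos2 _ this)
      rw [hom_inv shom] at this
      linarith
  have hconj : ∀ t, τ (c t) = lam * τ t := fun t => by have := s0 t; simp only [hs] at this; linarith
  refine ⟨lam, D (g 0), hlp, ?_⟩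
  intro x
  have hgt : ∀ t : T, ∀ y, D (g ((t:GR) y)) = D (g y) + lam * τ t := by
    intro t y
    rw [← cap, Dt, hconj]
  have key : ∀ ε > 0, |D (g x) - (lam * D x + D (g 0))| ≤ lam * ε := by
    intro ε hε
    obtain ⟨h, h1, h2, h3⟩ := small ε hε 0 1 one_pos
    have hp := tpos h h1
    obtain ⟨r, ⟨t, ht, rfl⟩, htr⟩ := exists_lt_of_lt_csSup (hne x) (b := D x - τ h) (by change _ < D x; linarith)
    have a1 : x ≤ (t:GR) ((h:GR) 0) := by
      by_contra hh
      push Not at hh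
      have := Dle (t * h) x hh.le
      rw [hom] at this
      linarith
    have b1 := Dle t x ht
    have b2 := Dmono (g.le_iff_le.2 ht)
    have b3 := Dmono (g.le_iff_le.2 a1)
    rw [hgt] at b2 b3
    rw [hgt] at b3
    rw [abs_le]
    constructor <;> nlinarith
  have : |D (g x) - (lam * D x + D (g 0))| ≤ 0 := by
    apply le_of_forall_pos_le_add
    intro e he
    have := key (e / lam) (by positivity)
    rw [mul_div_cancel₀ _ hlp.ne'] at this
    linarith
  have := abs_nonpos_iff.1 this
  linarith

/-- affine order isomorphism -/
def affIso (a b : ℝ) (ha : 0 < a) : GR where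
  toFun x := a * x + b
  invFun y := (y - b) / a
  left_inv x := by field_simp; ring
  right_inv x := by field_simp; ring
  map_rel_iff' := by
    intro x y
    simp only [Equiv.coe_fn_mk]
    constructor
    · intro h; exact le_of_mul_le_mul_left (by linarith) ha
    · intro h; nlinarith

lemma affine_GR {G T : Subgroup GR} (hz : Nz G T) (hF : Free T) (hN : ND T) :
    (∀ f ∈ G, f ≠ 1 → {x | f x = x}.encard ≤ 1) ∧
    ∃ φ : G →* GR, Function.Injective φ ∧ ∀ g, ∃ a b : ℝ, 0 < a ∧ ∀ x, φ g x = a * x + b := by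
  obtain ⟨D, Ds, D0, ⟨x1, D1⟩, H⟩ := exists_D hz hF hN
  have hid : ∀ g : GR, (∀ x, D (g x) = D x) → g = 1 := by
    intro g h
    ext x
    exact Ds.injective (h x)
  constructor
  · intro f hf h1
    rw [Set.encard_le_one_iff]
    intro u v hu hv
    by_contra hne
    obtain ⟨a, b, ha, hab⟩ := H f hf
    apply h1
    apply hid
    have e1 := hab u
    have e2 := hab v
    rw [hu] at e1
    rw [hv] at e2
    have hDne : D u - D v ≠ 0 := sub_ne_zero.2 (Ds.injective.ne hne)
    have ha1 : a = 1 := by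
      have : (a - 1) * (D u - D v) = 0 := by linarith
      rcases mul_eq_zero.1 this with h | h
      · linarith
      · exact absurd h hDne
    subst ha1
    intro x
    rw [hab x]; linarith
  · choose! a b ha hab using H
    have hb : ∀ g ∈ G, b g = D (g 0) := by
      intro g hg; have := hab g hg 0; rw [D0] at this; linarith
    have hav : ∀ g ∈ G, a g = D (g x1) - D (g 0) := by
      intro g hg; have := hab g hg x1; rw [D1, ← hb g hg] at *; linarith
    have hmul : ∀ g ∈ G, ∀ h ∈ G, a (g*h) = a g * a h ∧ b (g*h) = a g * b h + b g := by
      intro g hg h hh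
      have e1 : b (g*h) = a g * b h + b g := by
        rw [hb _ (G.mul_mem hg hh), RelIso.mul_apply, hab g hg, hb h hh]
      refine ⟨?_, e1⟩
      have := hab _ (G.mul_mem hg hh) x1
      rw [RelIso.mul_apply, hab g hg, hab h hh, D1, e1] at this
      linarith
    have hone : a 1 = 1 ∧ b 1 = 0 := by
      constructor
      · rw [hav 1 G.one_mem]; simp [D0, D1]
      · rw [hb 1 G.one_mem]; simp [D0]
    refine ⟨{ toFun := fun g => affIso (a g) (b g) (ha g g.2), map_one' := ?_, map_mul' := ?_ }, ?_, ?_⟩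
    · ext x
      change a 1 * x + b 1 = x
      rw [hone.1, hone.2]; ring
    · intro g h
      ext x
      change a ((g:GR)*h) * x + b ((g:GR)*h) = a g * (a h * x + b h) + b g
      obtain ⟨e1, e2⟩ := hmul g g.2 h h.2
      rw [e1, e2]; ring
    · rw [injective_iff_map_eq_one]
      intro g hg
      have e : ∀ x, a g * x + b g = x := fun x => DFunLike.congr_fun hg x
      apply Subtype.ext
      apply hid
      intro x
      rw [hab g g.2, e]
    · intro g
      exact ⟨a g, b g, ha g g.2, fun x => rfl⟩

end Aux
end

section
open Set Filter Topology
open scoped commutatorElement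
namespace Aux

abbrev JI : Type := {x : ↥unitInterval // 0 < (x:ℝ) ∧ (x:ℝ) < 1}

lemma int_pos (f : HomeoI) (x : ↥unitInterval) : 0 < (f x : ℝ) ↔ 0 < (x:ℝ) := by
  have h : ∀ y : ↥unitInterval, 0 < (y:ℝ) ↔ ⊥ < y := fun y => Iff.rfl
  rw [h, h, ← f.lt_iff_lt (x := ⊥) (y := x), f.map_bot]

lemma int_lt (f : HomeoI) (x : ↥unitInterval) : (f x : ℝ) < 1 ↔ (x:ℝ) < 1 := by
  have h : ∀ y : ↥unitInterval, (y:ℝ) < 1 ↔ y < ⊤ := fun y => Iff.rfl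
  rw [h, h, ← f.lt_iff_lt (x := x) (y := ⊤), f.map_top]

/-- the open interval is order isomorphic to `(-1,1)` -/
def jIso : Ioo (-1:ℝ) 1 ≃o JI where
  toFun y := ⟨⟨(y.1 + 1)/2, by constructor <;> linarith [y.2.1, y.2.2]⟩, by
    constructor <;> simp only <;> linarith [y.2.1, y.2.2]⟩
  invFun x := ⟨2 * (x.1:ℝ) - 1, by constructor <;> linarith [x.2.1, x.2.2]⟩
  left_inv y := by apply Subtype.ext; simp only; ring
  right_inv x := by apply Subtype.ext; apply Subtype.ext; simp only; ring
  map_rel_iff' := by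
    intro x y
    change (x.1+1)/2 ≤ (y.1+1)/2 ↔ x.1 ≤ y.1
    constructor <;> intro h <;> linarith

def eI : ℝ ≃o JI := (orderIsoIooNegOneOne ℝ).trans jIso

def resI (f : HomeoI) (x : JI) : JI := ⟨f x.1, (int_pos f x.1).2 x.2.1, (int_lt f x.1).2 x.2.2⟩

def psi0 (f : HomeoI) : GR where
  toFun x := eI.symm (resI f (eI x))
  invFun x := eI.symm (resI f⁻¹ (eI x))
  left_inv x := by
    simp [resI]
  right_inv x := by
    simp [resI]
  map_rel_iff' := by
    intro x y
    simp only [Equiv.coe_fn_mk, OrderIso.le_iff_le]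
    change f _ ≤ f _ ↔ _
    rw [f.le_iff_le]
    exact eI.le_iff_le

lemma psi0_apply (f : HomeoI) (x : ℝ) : psi0 f x = eI.symm (resI f (eI x)) := rfl

def psi : HomeoI →* GR where
  toFun := psi0
  map_one' := by
    ext x
    rw [psi0_apply]
    exact eI.symm_apply_apply x
  map_mul' f g := by
    ext x
    rw [RelIso.mul_apply, psi0_apply, psi0_apply, psi0_apply, OrderIso.apply_symm_apply]
    rfl

lemma psi_apply (f : HomeoI) (x : ℝ) : psi f x = eI.symm (resI f (eI x)) := rfl

lemma psi_fix (f : HomeoI) (x : ℝ) : psi f x = x ↔ f (eI x).1 = (eI x).1 := by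
  rw [psi_apply, OrderIso.symm_apply_eq]
  exact Subtype.ext_iff

lemma psi_inj : Function.Injective psi := by
  rw [injective_iff_map_eq_one]
  intro f hf
  refine RelIso.ext (fun x => ?_)
  change f x = x
  by_cases h0 : 0 < (x:ℝ)
  · by_cases h1 : (x:ℝ) < 1
    · have := (psi_fix f (eI.symm ⟨x, h0, h1⟩)).1 (by rw [hf]; rfl)
      simpa using this
    · have : x = ⊤ := Subtype.ext (le_antisymm x.2.2 (not_lt.1 h1))
      rw [this, f.map_top]
  · have : x = ⊥ := Subtype.ext (le_antisymm (not_lt.1 h0) x.2.1)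
    rw [this, f.map_bot]

lemma psi_encard (f : HomeoI) : (interiorFixedPts f).encard = {x | psi f x = x}.encard := by
  have hi : Function.Injective (fun x : ℝ => (eI x).1) := Subtype.val_injective.comp eI.injective
  rw [← hi.encard_image]
  congr 1
  ext y
  simp only [interiorFixedPts, mem_ofPred_eq, mem_image]
  constructor
  · rintro ⟨h1, h2⟩
    refine ⟨eI.symm ⟨y, h2⟩, ?_, by simp⟩
    rw [psi_fix]; simpa using h1
  · rintro ⟨x, hx, rfl⟩
    exact ⟨(psi_fix f x).1 hx, (eI x).2⟩

lemma c0_le (f : HomeoI) (x : ↥unitInterval) : |(f x : ℝ) - (x:ℝ)| ≤ c0DistId f := by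
  unfold c0DistId
  refine le_ciSup (f := fun x : ↥unitInterval => |(f x : ℝ) - (x:ℝ)|) ⟨1, ?_⟩ x
  rintro _ ⟨y, rfl⟩
  simp only [abs_le]
  constructor <;> linarith [y.2.1, y.2.2, (f y).2.1, (f y).2.2]

lemma c0_nonneg (f : HomeoI) : 0 ≤ c0DistId f := (abs_nonneg _).trans (c0_le f 0)

lemma tendsto_psi : Tendsto psi (comap c0DistId (𝓝 0)) LF := by
  rw [tendsto_LF]
  intro x
  have ev : ∀ δ > 0, ∀ᶠ f in comap c0DistId (𝓝 0), c0DistId f < δ := fun δ hδ =>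
    tendsto_comap.eventually_lt_const hδ
  rw [tendsto_order]
  constructor
  · intro a ha
    have h1 : ((eI a).1 : ℝ) < ((eI x).1 : ℝ) := eI.lt_iff_lt.2 ha
    filter_upwards [ev _ (sub_pos.2 h1)] with f hf
    have h2 := (abs_le.1 (c0_le f (eI x).1)).1
    rw [psi_apply, OrderIso.lt_symm_apply]
    change ((eI a).1 : ℝ) < (f (eI x).1 : ℝ)
    linarith
  · intro a ha
    have h1 : ((eI x).1 : ℝ) < ((eI a).1 : ℝ) := eI.lt_iff_lt.2 ha
    filter_upwards [ev _ (sub_pos.2 h1)] with f hf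
    have h2 := (abs_le.1 (c0_le f (eI x).1)).2
    rw [psi_apply, OrderIso.symm_apply_lt]
    change (f (eI x).1 : ℝ) < ((eI a).1 : ℝ)
    linarith

lemma final (N : ℕ) (Γ : Subgroup HomeoI)
    (hirr : IrreducibleSubgroup Γ)
    (hfix : ∀ f ∈ Γ, f ≠ 1 → (interiorFixedPts f).encard ≤ (N : ℕ∞))
    (hsmall : ∀ ε > (0 : ℝ), ∃ h ∈ ⁅Γ, Γ⁆, h ≠ 1 ∧ c0DistId h < ε) :
    (∀ f ∈ Γ, f ≠ 1 → (interiorFixedPts f).encard ≤ 1) ∧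
      IsIsomorphicToAffineSubgroup Γ := by
  have hB : Bd N (Γ.map psi) := by
    rintro _ ⟨f, hf, rfl⟩ h1
    rw [← psi_encard]
    exact hfix f hf (fun h => h1 (by rw [h, map_one]))
  have hI : Irr (Γ.map psi) := by
    intro x
    obtain ⟨f, hf, hx⟩ := hirr (eI x).1 (eI x).2.1 (eI x).2.2
    exact ⟨psi f, ⟨f, hf, rfl⟩, fun h => hx ((psi_fix f x).1 h)⟩
  have hN : ND ⁅Γ.map psi, Γ.map psi⁆ := by
    rw [← Subgroup.map_commutator]
    have h1 : ∃ᶠ h in comap c0DistId (𝓝 0), h ∈ ⁅Γ, Γ⁆ ∧ h ≠ 1 := by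
      rw [frequently_comap, Metric.nhds_basis_ball.frequently_iff]
      intro ε hε
      obtain ⟨h, h1, h2, h3⟩ := hsmall ε hε
      refine ⟨c0DistId h, ?_, h, rfl, h1, h2⟩
      rw [Metric.mem_ball, Real.dist_eq, sub_zero, abs_of_nonneg (c0_nonneg h)]
      exact h3
    apply tendsto_psi.frequently
    refine h1.mono ?_
    rintro h ⟨ha, hb⟩
    exact ⟨⟨h, ha, rfl⟩, fun h => hb (psi_inj (by rw [h, map_one]))⟩
  obtain ⟨T, hz, hNT, hF⟩ := exists_T hB hI hN
  obtain ⟨r1, φ, r2, r3⟩ := affine_GR hz hF hNT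
  constructor
  · intro f hf h1
    rw [psi_encard]
    exact r1 (psi f) ⟨f, hf, rfl⟩ (fun h => h1 (psi_inj (by rw [h, map_one])))
  · refine ⟨φ.comp (psi.subgroupMap Γ), ?_, fun γ => r3 _⟩
    refine r2.comp ?_
    intro x y hxy
    exact Subtype.ext (psi_inj (congrArg Subtype.val hxy))

end Aux
end

/-- Let `N ≥ 0` and let `Γ` be an irreducible subgroup of `Diff₊(I)`
with every non-identity element having at most `N` fixed points in `(0,1)`, such that
`[Γ,Γ]` contains non-identity elements arbitrarily `C⁰`-close to the identity.  Then
every non-identity element of `Γ` has at most one fixed point in `(0,1)`, and `Γ` is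
isomorphic to a subgroup of `Aff₊(ℝ)`. -/
theorem affine_of_commutator_c0_nondiscrete
    (N : ℕ) (Γ : Subgroup HomeoI)
    (hdiff : ∀ f ∈ Γ, IsC1DiffeoI f)
    (hirr : IrreducibleSubgroup Γ)
    (hfix : ∀ f ∈ Γ, f ≠ 1 → (interiorFixedPts f).encard ≤ (N : ℕ∞))
    (hsmall : ∀ ε > (0 : ℝ), ∃ h ∈ ⁅Γ, Γ⁆, h ≠ 1 ∧ c0DistId h < ε) :
    (∀ f ∈ Γ, f ≠ 1 → (interiorFixedPts f).encard ≤ 1) ∧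
      IsIsomorphicToAffineSubgroup Γ := by
  exact Aux.final N Γ hirr hfix hsmall

end
end

section
/- Let Γ be a subgroup of Homeo₊(I) such that every non-identity element of Γ has only finitely many fixed points in (0,1). Then Γ is either Abelian or contains a free semigroup on two generators. -/
open Set

noncomputable section

/-- `f` and `g` generate a free semigroup on two generators: the canonical semigroup
homomorphism from the free semigroup on two letters sending the letters to `f` and `g`
is injective. -/
def FreeSemigroupPair {G : Type*} [Group G] (f g : G) : Prop :=
  Function.Injective
    ⇑(FreeSemigroup.lift (fun b : Bool => if b then f else g) : FreeSemigroup Bool →ₙ* G)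

section HolderAux

variable {G : Type*} [Group G] [LinearOrder G] [MulLeftMono G] [MulRightMono G]

/-- Integer part of `b` with respect to `a` in an Archimedean bi-ordered group. -/
theorem holder_floor (arch : ∀ a : G, 1 < a → ∀ b : G, ∃ n : ℕ, b < a ^ n)
    (a : G) (ha : 1 < a) (b : G) : ∃ n : ℤ, a ^ n ≤ b ∧ b < a ^ (n + 1) := by
  classical
  obtain ⟨N, hN⟩ := arch a ha b
  obtain ⟨M, hM⟩ := arch a ha b⁻¹
  have hex : ∃ n : ℕ, b < a ^ ((n : ℤ) - M) := by
    refine ⟨N + M, ?_⟩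
    simpa using hN
  have h0 : ¬ b < a ^ (((0 : ℕ) : ℤ) - M) := by
    have : (a ^ M)⁻¹ < b := inv_lt_of_inv_lt' hM
    simpa using this.le
  have hs := Nat.find_spec hex
  have hm : ∀ m, m < Nat.find hex → ¬ b < a ^ ((m : ℤ) - M) := fun m h => Nat.find_min hex h
  generalize Nat.find hex = k at hs hm
  cases k with
  | zero => exact absurd hs h0
  | succ k =>
    refine ⟨(k : ℤ) - M, not_lt.1 (hm k (Nat.lt_succ_self k)), ?_⟩
    have : ((k : ℤ) - M + 1) = ((k + 1 : ℕ) : ℤ) - M := by push_cast; ring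
    rw [this]; exact hs

/-- No commutator exceeds `1`, when the order has no least positive element. -/
theorem holder_dense (arch : ∀ a : G, 1 < a → ∀ b : G, ∃ n : ℕ, b < a ^ n)
    (hd : ∀ e : G, 1 < e → ∃ x, 1 < x ∧ x < e) (a b : G) : a * b ≤ b * a := by
  by_contra hlt
  rw [not_le] at hlt
  have he : 1 < (b * a)⁻¹ * (a * b) := by
    rw [← inv_mul_cancel (b * a)]
    exact mul_lt_mul_right hlt _
  have hδ : ∃ δ : G, 1 < δ ∧ δ * δ ≤ (b * a)⁻¹ * (a * b) := by
    generalize (b * a)⁻¹ * (a * b) = e at he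
    obtain ⟨x, hx, hxe⟩ := hd e he
    rcases le_or_gt (x * x) e with h | h
    · exact ⟨x, hx, h⟩
    · refine ⟨x⁻¹ * e, ?_, ?_⟩
      · rw [← inv_mul_cancel x]
        exact mul_lt_mul_right hxe _
      · have h1 : e * x⁻¹ < x := by
          rwa [mul_inv_lt_iff_lt_mul]
        have h2 : x⁻¹ * (e * x⁻¹) * e ≤ x⁻¹ * x * e :=
          mul_le_mul_left (mul_le_mul_right h1.le _) _
        simpa [mul_assoc] using h2
  obtain ⟨δ, hδ1, hδ2⟩ := hδ
  obtain ⟨m, hm1, hm2⟩ := holder_floor arch δ hδ1 a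
  obtain ⟨n, hn1, hn2⟩ := holder_floor arch δ hδ1 b
  have hba : δ ^ (n + m) ≤ b * a := by
    rw [zpow_add]; exact mul_le_mul' hn1 hm1
  have hab : a * b < δ ^ ((m + 1) + (n + 1)) := by
    rw [zpow_add]; exact mul_lt_mul_of_lt_of_lt hm2 hn2
  have h3 : b * a * (δ * δ) ≤ a * b := by
    have := mul_le_mul_right hδ2 (b * a)
    rwa [mul_inv_cancel_left] at this
  have h4 : δ ^ ((m + 1) + (n + 1)) ≤ b * a * (δ * δ) := by
    have h5 : δ ^ ((m + 1) + (n + 1)) = δ ^ (n + m) * (δ * δ) := by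
      have : (m + 1) + (n + 1) = (n + m) + 1 + 1 := by ring
      rw [this, zpow_add_one, zpow_add_one, mul_assoc]
    rw [h5]
    exact mul_le_mul_left hba _
  exact absurd (hab.trans_le (h4.trans h3)) (lt_irrefl _)

/-- Hoelder: an Archimedean bi-ordered group is commutative. -/
theorem holder_comm (arch : ∀ a : G, 1 < a → ∀ b : G, ∃ n : ℕ, b < a ^ n)
    (a b : G) : a * b = b * a := by
  by_cases hd : ∀ e : G, 1 < e → ∃ x, 1 < x ∧ x < e
  · exact le_antisymm (holder_dense arch hd a b) (holder_dense arch hd b a)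
  · push Not at hd
    obtain ⟨e, he, hmin⟩ := hd
    have key : ∀ b : G, ∃ n : ℤ, b = e ^ n := by
      intro b
      obtain ⟨n, h1, h2⟩ := holder_floor arch e he b
      refine ⟨n, ?_⟩
      by_contra hne
      have hlt : e ^ n < b := lt_of_le_of_ne h1 (Ne.symm hne)
      have h3 : 1 < (e ^ n)⁻¹ * b := by
        rw [← inv_mul_cancel (e ^ n)]
        exact mul_lt_mul_right hlt _
      have h4 : (e ^ n)⁻¹ * b < e := by
        rw [inv_mul_lt_iff_lt_mul, ← zpow_add_one]
        exact h2
      exact absurd h4 (not_lt.2 (hmin _ h3))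
    obtain ⟨m, rfl⟩ := key a
    obtain ⟨n, rfl⟩ := key b
    rw [← zpow_add, ← zpow_add, add_comm]

end HolderAux

/-- Ping-pong for semigroups acting on the interval. -/
theorem pingpong (h : Bool → HomeoI) (J : Set ↥unitInterval) (hne : J.Nonempty)
    (hJ : ∀ b, ∀ x ∈ J, h b x ∈ J)
    (hdisj : ∀ b c, b ≠ c → ∀ x ∈ J, ∀ y ∈ J, h b x ≠ h c y) :
    Function.Injective ⇑(FreeSemigroup.lift h : FreeSemigroup Bool →ₙ* HomeoI) := by
  obtain ⟨d, hd⟩ := hne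
  have hP : ∀ l : List Bool, ∀ x ∈ J, (l.map h).prod x ∈ J := by
    intro l
    induction l with
    | nil => intro x hx; simpa using hx
    | cons a l ih =>
      intro x hx
      rw [List.map_cons, List.prod_cons, RelIso.mul_apply]
      exact hJ _ _ (ih x hx)
  have hnil : ∀ (a : Bool) (l : List Bool), ((a :: l).map h).prod ≠ 1 := by
    intro a l heq
    have hb : h (!a) d ∈ J := hJ _ _ hd
    have h1 := congrArg (fun k : HomeoI => k (h (!a) d)) heq
    rw [List.map_cons, List.prod_cons] at h1
    simp only [RelIso.mul_apply, RelIso.one_apply] at h1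
    exact hdisj a (!a) (by cases a <;> simp) _ (hP l _ hb) d hd h1
  have hinj : ∀ l l' : List Bool, (l.map h).prod = (l'.map h).prod → l = l' := by
    intro l
    induction l with
    | nil =>
      intro l' heq
      cases l' with
      | nil => rfl
      | cons a l' => exact absurd heq.symm (by simpa using hnil a l')
    | cons a l ih =>
      intro l' heq
      cases l' with
      | nil => exact absurd heq (by simpa using hnil a l)
      | cons a' l' =>
        by_cases haa : a = a'
        · subst haa
          rw [List.map_cons, List.prod_cons, List.map_cons, List.prod_cons] at heq
          rw [ih l' (mul_left_cancel heq)]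
        · exfalso
          have h1 := congrArg (fun k : HomeoI => k d) heq
          rw [List.map_cons, List.prod_cons, List.map_cons, List.prod_cons] at h1
          simp only [RelIso.mul_apply] at h1
          exact hdisj a a' haa _ (hP l d hd) _ (hP l' d hd) h1
  have hlift : ∀ w : FreeSemigroup Bool,
      (FreeSemigroup.lift h : FreeSemigroup Bool →ₙ* HomeoI) w
        = ((w.head :: w.tail).map h).prod := by
    intro w
    induction w with
    | ih1 x => simp
    | ih2 x y _ ih => rw [FreeSemigroup.lift_of_mul, ih]; simp
  intro w w' heq
  rw [hlift, hlift] at heq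
  have := hinj _ _ heq
  rw [List.cons.injEq] at this
  exact FreeSemigroup.ext this.1 this.2

/-- Iterates of a point escape below the next fixed point. -/
theorem iter_escape (f : HomeoI) (b : ↥unitInterval)
    (hf : ∀ x, 0 < x → x < b → x < f x) (d y : ↥unitInterval) (hd : 0 < d)
    (hy : y < b) : ∃ n : ℕ, y < (f ^ n) d := by
  by_contra hcon
  push Not at hcon
  have hlub : IsLUB (Set.range fun n : ℕ => (f ^ n) d) (⨆ n : ℕ, (f ^ n) d) := isLUB_iSup
  generalize (⨆ n : ℕ, (f ^ n) d) = s at hlub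
  have hsy : s ≤ y := hlub.2 (by rintro _ ⟨n, rfl⟩; exact hcon n)
  have hds : d ≤ s := by
    have := hlub.1 (Set.mem_range_self 0)
    simpa using this
  have hfs : s < f s := hf s (hd.trans_le hds) (hsy.trans_lt hy)
  have h1 : f.symm s < s := by
    rw [OrderIso.symm_apply_lt]; exact hfs
  obtain ⟨_, ⟨n, rfl⟩, hn⟩ := (lt_isLUB_iff hlub).1 h1
  have h2 : s < (f ^ (n + 1)) d := by
    rw [pow_succ', RelIso.mul_apply]
    exact (OrderIso.symm_apply_lt f).1 hn
  exact absurd h2 (not_lt.2 (hlub.1 (Set.mem_range_self (n + 1))))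

theorem pow_fix (f : HomeoI) (b : ↥unitInterval) (hfb : f b = b) (n : ℕ) : (f ^ n) b = b := by
  induction n with
  | zero => simp
  | succ n ih => rw [pow_succ', RelIso.mul_apply, ih, hfb]

theorem map_zero_homeo (f : HomeoI) : f 0 = 0 := by
  have h : f ⊥ = ⊥ := OrderIso.map_bot f
  exact h

theorem map_pos_homeo (f : HomeoI) {x : ↥unitInterval} (hx : 0 < x) : 0 < f x := by
  rw [← map_zero_homeo f]; exact f.lt_iff_lt.2 hx

/-- A crossing gives a free semigroup. -/
theorem crossing (f g : HomeoI) (b : ↥unitInterval) (hfb : f b = b)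
    (hf : ∀ x, 0 < x → x < b → x < f x) (hg0 : 0 < g b) (hg : g b < b) :
    ∃ n k : ℕ, FreeSemigroupPair (f ^ n) (g * f ^ k) := by
  obtain ⟨d, hd0, hdg⟩ := exists_between hg0
  have hdb : d < b := hdg.trans hg
  obtain ⟨n, hn⟩ := iter_escape f b hf d (g b) hd0 hg
  have hgd : g.symm d < b := by rw [OrderIso.symm_apply_lt]; exact hdg
  obtain ⟨k, hk⟩ := iter_escape f b hf d (g.symm d) hd0 hgd
  refine ⟨n, k, ?_⟩
  have hA : ∀ x ∈ Set.Icc d b, g b < (f ^ n) x ∧ (f ^ n) x ≤ b := by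
    intro x hx
    refine ⟨hn.trans_le ((f ^ n).monotone hx.1), ?_⟩
    have := (f ^ n).monotone hx.2
    rwa [pow_fix f b hfb] at this
  have hB : ∀ x ∈ Set.Icc d b, d ≤ (g * f ^ k) x ∧ (g * f ^ k) x ≤ g b := by
    intro x hx
    rw [RelIso.mul_apply]
    constructor
    · have h1 : g.symm d ≤ (f ^ k) x := hk.le.trans ((f ^ k).monotone hx.1)
      exact (OrderIso.symm_apply_le g).1 h1
    · apply g.monotone
      have := (f ^ k).monotone hx.2
      rwa [pow_fix f b hfb] at this
  unfold FreeSemigroupPair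
  apply pingpong _ (Set.Icc d b) ⟨d, le_refl d, hdb.le⟩
  · intro c x hx
    cases c
    · simpa using And.intro (hB x hx).1 ((hB x hx).2.trans hg.le)
    · simpa using And.intro (hdg.le.trans (hA x hx).1.le) (hA x hx).2
  · intro c c' hcc x hx y hy
    cases c <;> cases c'
    · exact absurd rfl hcc
    · simpa using ((hB x hx).2.trans_lt (hA y hy).1).ne
    · simpa using ((hB y hy).2.trans_lt (hA x hx).1).ne'
    · exact absurd rfl hcc

/-- Constant sign on a fixed-point-free interval. -/
theorem sign_const (f : HomeoI) (b x y : ↥unitInterval)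
    (hf : ∀ x, 0 < x → x < b → f x ≠ x)
    (hx0 : 0 < x) (hxb : x < b) (hx : x < f x) (hy0 : 0 < y) (hyb : y < b) : y < f y := by
  by_contra hcon
  rw [not_lt] at hcon
  obtain ⟨z, hz, hfz⟩ := (isPreconnected_Ioo (a := (0 : ↥unitInterval)) (b := b)).intermediate_value₂
    (a := y) (b := x) ⟨hy0, hyb⟩ ⟨hx0, hxb⟩ (f := f) (g := id)
    f.continuous.continuousOn continuous_id.continuousOn hcon hx.le
  exact hf z hz.1 hz.2 hfz

theorem inv_fix_iff (f : HomeoI) (x : ↥unitInterval) : f⁻¹ x = x ↔ f x = x := by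
  constructor
  · intro h
    have := RelIso.apply_inv_self f x
    rwa [h] at this
  · intro h
    have := RelIso.inv_apply_self f x
    rwa [h] at this

theorem lt_inv_apply (f : HomeoI) (x y : ↥unitInterval) : x < f⁻¹ y ↔ f x < y := by
  rw [← f.lt_iff_lt, RelIso.apply_inv_self]

/-- Without free semigroups, the first interior fixed point of an element is a global
fixed point. -/
theorem first_fixed_global (Γ : Subgroup HomeoI)
    (hno : ¬ ∃ f ∈ Γ, ∃ g ∈ Γ, FreeSemigroupPair f g)
    (f : HomeoI) (hfΓ : f ∈ Γ) (b : ↥unitInterval) (hb0 : 0 < b) (hfb : f b = b)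
    (hf : ∀ x, 0 < x → x < b → f x ≠ x) (g : HomeoI) (hg : g ∈ Γ) : g b = b := by
  have main : ∀ g ∈ Γ, ¬ g b < b := by
    intro g hg hlt
    obtain ⟨x, hx0, hxb⟩ := exists_between hb0
    have hsgn : ∃ F ∈ Γ, F b = b ∧ ∀ x, 0 < x → x < b → x < F x := by
      rcases lt_or_gt_of_ne (hf x hx0 hxb) with h | h
      · refine ⟨f⁻¹, Γ.inv_mem hfΓ, (inv_fix_iff f b).2 hfb, fun y hy0 hyb => ?_⟩
        exact sign_const f⁻¹ b x y (fun z h0 h1 h2 => hf z h0 h1 ((inv_fix_iff f z).1 h2))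
          hx0 hxb ((lt_inv_apply f x x).2 h) hy0 hyb
      · exact ⟨f, hfΓ, hfb, fun y hy0 hyb => sign_const f b x y hf hx0 hxb h hy0 hyb⟩
    obtain ⟨F, hFΓ, hFb, hF⟩ := hsgn
    obtain ⟨n, k, hfree⟩ := crossing F g b hFb hF (map_pos_homeo g hb0) hlt
    exact hno ⟨F ^ n, Γ.pow_mem hFΓ n, g * F ^ k, Γ.mul_mem hg (Γ.pow_mem hFΓ k), hfree⟩
  rcases lt_trichotomy (g b) b with h | h | h
  · exact absurd h (main g hg)
  · exact h
  · refine absurd ?_ (main g⁻¹ (Γ.inv_mem hg))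
    rw [← g.lt_iff_lt, RelIso.apply_inv_self]
    exact h

/-- A group acting freely on `(0,c)` is Abelian. -/
theorem comm_of_free_action (Γ : Subgroup HomeoI) (c : ↥unitInterval) (hc : 0 < c)
    (hglob : ∀ f ∈ Γ, f c = c)
    (hfree : ∀ f ∈ Γ, f ≠ 1 → ∀ x, 0 < x → x < c → f x ≠ x) (a b : ↥Γ) : a * b = b * a := by
  obtain ⟨x₀, hx0, hxc⟩ := exists_between hc
  have hinv : ∀ f ∈ Γ, f x₀ = x₀ → f = 1 := by
    intro f hf h
    by_contra hne
    exact hfree f hf hne x₀ hx0 hxc h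
  have hinj : Function.Injective (fun f : ↥Γ => (f : HomeoI) x₀) := by
    intro f g hfg
    have hfg' : (f : HomeoI) x₀ = (g : HomeoI) x₀ := hfg
    have h1 : ((g : HomeoI)⁻¹ * (f : HomeoI)) = 1 := by
      apply hinv _ (Γ.mul_mem (Γ.inv_mem g.2) f.2)
      rw [RelIso.mul_apply, hfg', RelIso.inv_apply_self]
    exact Subtype.ext (inv_mul_eq_one.1 h1).symm
  let _ : LinearOrder ↥Γ := LinearOrder.lift' (fun f : ↥Γ => (f : HomeoI) x₀) hinj
  have hle : ∀ f g : ↥Γ, f ≤ g ↔ (f : HomeoI) x₀ ≤ (g : HomeoI) x₀ := fun f g => Iff.rfl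
  have hlt : ∀ f g : ↥Γ, f < g ↔ (f : HomeoI) x₀ < (g : HomeoI) x₀ := fun f g => Iff.rfl
  have hpos : ∀ f ∈ Γ, ∀ y, 0 < y → y < c → x₀ < f x₀ → y < f y := by
    intro f hf y hy0 hyc h
    refine sign_const f c x₀ y (hfree f hf ?_) hx0 hxc h hy0 hyc
    rintro rfl
    simp at h
  have _ : MulLeftMono ↥Γ := ⟨fun h f g hfg => by
    have h1 := (hle f g).1 hfg
    exact (hle _ _).2 ((h : HomeoI).monotone h1)⟩
  have _ : MulRightMono ↥Γ := ⟨fun h f g hfg => by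
    have hfg' : f ≤ g := hfg
    change f * h ≤ g * h
    rcases eq_or_lt_of_le hfg' with h0 | h0
    · rw [h0]
    · have h1 := (hlt f g).1 h0
      have h2 : x₀ < ((f : HomeoI)⁻¹ * (g : HomeoI)) x₀ := by
        rw [RelIso.mul_apply, lt_inv_apply]; exact h1
      have hc' : (h : HomeoI) x₀ < c := by
        have := (h : HomeoI).lt_iff_lt.2 hxc
        rwa [hglob _ h.2] at this
      have h3 := hpos _ (Γ.mul_mem (Γ.inv_mem f.2) g.2) ((h : HomeoI) x₀)
        (map_pos_homeo _ hx0) hc' h2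
      rw [RelIso.mul_apply, lt_inv_apply] at h3
      exact (hle _ _).2 h3.le⟩
  refine holder_comm ?_ a b
  intro a ha b
  have ha' : x₀ < (a : HomeoI) x₀ := (hlt 1 a).1 ha
  have hbc : (b : HomeoI) x₀ < c := by
    have := (b : HomeoI).lt_iff_lt.2 hxc
    rwa [hglob _ b.2] at this
  obtain ⟨n, hn⟩ := iter_escape (a : HomeoI) c
    (fun y hy0 hyc => hpos _ a.2 y hy0 hyc ha') x₀ _ hx0 hbc
  refine ⟨n, (hlt _ _).2 ?_⟩
  simpa using hn

/-- The least interior fixed point. -/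
theorem exists_first_fixed (f : HomeoI) (hfin : (interiorFixedPts f).Finite)
    (x : ↥unitInterval) (hx : x ∈ interiorFixedPts f) :
    ∃ m, 0 < m ∧ m < 1 ∧ f m = m ∧ m ≤ x ∧ ∀ y, 0 < y → y < m → f y ≠ y := by
  obtain ⟨m, hm, hmin⟩ := Set.exists_min_image _ id hfin ⟨x, hx⟩
  refine ⟨m, hm.2.1, hm.2.2, hm.1, hmin x hx, fun y hy0 hym hy => ?_⟩
  have hy1 : y < 1 := hym.trans hm.2.2
  exact absurd hym (not_lt.2 (hmin y ⟨hy, hy0, hy1⟩))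

/-- Any subgroup of `Homeo₊(I)` in which every non-identity element has
finitely many fixed points in `(0,1)` is either Abelian or contains a free semigroup on
two generators. -/
theorem abelian_or_freeSemigroup_of_finiteFix
    (Γ : Subgroup HomeoI)
    (hfix : ∀ f ∈ Γ, f ≠ 1 → (interiorFixedPts f).Finite) :
    (∀ a b : ↥Γ, a * b = b * a) ∨ ∃ f ∈ Γ, ∃ g ∈ Γ, FreeSemigroupPair f g := by
  by_cases hno : ∃ f ∈ Γ, ∃ g ∈ Γ, FreeSemigroupPair f g
  · exact Or.inr hno
  left
  by_cases hA : ∃ f ∈ Γ, f ≠ 1 ∧ (interiorFixedPts f).Nonempty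
  · obtain ⟨f, hf, hf1, x, hx⟩ := hA
    obtain ⟨c, hc0, hc1, hfc, -, hmin⟩ := exists_first_fixed f (hfix f hf hf1) x hx
    refine comm_of_free_action Γ c hc0
      (fun g hg => first_fixed_global Γ hno f hf c hc0 hfc hmin g hg) ?_
    intro g hg hg1 y hy0 hyc hy
    obtain ⟨m, hm0, hm1, hgm, hmy, hmin'⟩ :=
      exists_first_fixed g (hfix g hg hg1) y ⟨hy, hy0, hyc.trans hc1⟩
    exact hmin m hm0 (hmy.trans_lt hyc)
      (first_fixed_global Γ hno g hg m hm0 hgm hmin' f hf)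
  · refine comm_of_free_action Γ 1 zero_lt_one (fun f _ => OrderIso.map_top f) ?_
    intro f hf hf1 x hx0 hx1 hx
    exact hA ⟨f, hf, hf1, x, hx, hx0, hx1⟩

end
end

section
/- Let G be a countable group with a left order < satisfying property (P₁). Then there exists an injective group homomorphism from G into Homeo₊(ℝ) such that every non-identity element of the image has at most 1 fixed point in ℝ. -/
noncomputable section

variable {G : Type*} [Group G]

/-- The sequence `(s n)_{n ≥ 1}` is (strictly) increasing for the order `lt`. -/
def SeqIncr (lt : G → G → Prop) (s : ℕ → G) : Prop :=
  ∀ n : ℕ, 1 ≤ n → lt (s n) (s (n + 1))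

/-- The sequence `(s n)_{n ≥ 1}` is bounded: there is `h` with `h⁻¹ < s n < h`. -/
def SeqBounded (lt : G → G → Prop) (s : ℕ → G) : Prop :=
  ∃ h : G, ∀ n : ℕ, 1 ≤ n → lt h⁻¹ (s n) ∧ lt (s n) h

/-- The sequence `(s n)_{n ≥ 1}` is unbounded from above: it has no upper bound. -/
def SeqUnboundedAbove (lt : G → G → Prop) (s : ℕ → G) : Prop :=
  ∀ h : G, ∃ n : ℕ, 1 ≤ n ∧ lt h (s n)

/-- Property `(P₁)`: for every `g` such that `(gⁿ)_{n≥1}` is increasing and bounded and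
every `δ` for which there is `M` with `δ gᵏ > gᵐ` for all `k, m > M`, for all
sufficiently large `k` either `(gⁿ δ gᵏ)_{n≥1}` or `(g⁻ⁿ δ gᵏ)_{n≥1}` is increasing and
unbounded from above. -/
def PropertyP1 (lt : G → G → Prop) : Prop :=
  ∀ g δ : G,
    SeqIncr lt (fun n => g ^ n) → SeqBounded lt (fun n => g ^ n) →
    (∃ M : ℕ, ∀ k m : ℕ, M < k → M < m → lt (g ^ m) (δ * g ^ k)) →
    ∃ K : ℕ, ∀ k : ℕ, K ≤ k →
      (SeqIncr lt (fun n => g ^ n * δ * g ^ k) ∧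
        SeqUnboundedAbove lt (fun n => g ^ n * δ * g ^ k)) ∨
      (SeqIncr lt (fun n => g⁻¹ ^ n * δ * g ^ k) ∧
        SeqUnboundedAbove lt (fun n => g⁻¹ ^ n * δ * g ^ k))

/-- Build a homomorphism to order automorphisms from a strictly monotone action. -/
theorem P1aux_mkHom {G X : Type*} [Group G] [LinearOrder X] (act : G → X → X)
    (h1 : ∀ x, act 1 x = x) (hm : ∀ g h x, act (g * h) x = act g (act h x))
    (hs : ∀ g, StrictMono (act g)) :
    ∃ φ : G →* (X ≃o X), ∀ g x, φ g x = act g x := by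
  refine ⟨{ toFun := fun g =>
              { toFun := act g
                invFun := act g⁻¹
                left_inv := fun x => by rw [← hm, inv_mul_cancel, h1]
                right_inv := fun x => by rw [← hm, mul_inv_cancel, h1]
                map_rel_iff' := (hs g).le_iff_le }
            map_one' := ?_
            map_mul' := ?_ }, fun g x => rfl⟩
  · ext x; exact h1 x
  · intro g h; ext x; exact hm g h x

/-- An action on a countable dense order without endpoints extends to the real line. -/
theorem P1aux_extend {G X : Type*} [Group G] [LinearOrder X] [Countable X] [DenselyOrdered X]
    [NoMinOrder X] [NoMaxOrder X] [Nonempty X] (act : G → X → X)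
    (h1 : ∀ x, act 1 x = x) (hm : ∀ g h x, act (g * h) x = act g (act h x))
    (hs : ∀ g, StrictMono (act g)) :
    ∃ (φ : G →* (ℝ ≃o ℝ)) (ι : X → ℝ), StrictMono ι ∧ (∀ g x, φ g (ι x) = ι (act g x)) ∧
      ∀ u v : ℝ, u < v → ∃ x, u < ι x ∧ ι x < v := by
  obtain ⟨e⟩ := Order.iso_of_countable_dense X ℚ
  set ι : X → ℝ := fun x => ((e x : ℚ) : ℝ) with hι
  have ιmono : StrictMono ι := fun x y h => by
    simp only [hι]; exact_mod_cast e.strictMono h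
  have dense : ∀ u v : ℝ, u < v → ∃ x, u < ι x ∧ ι x < v := by
    intro u v huv
    obtain ⟨q, hq1, hq2⟩ := exists_rat_btwn huv
    exact ⟨e.symm q, by simpa [hι] using hq1, by simpa [hι] using hq2⟩
  have le_of : ∀ u v : ℝ, (∀ z, ι z < u → ι z < v) → u ≤ v := by
    intro u v h
    by_contra hc
    obtain ⟨x, hx1, hx2⟩ := dense v u (not_le.mp hc)
    exact lt_asymm hx1 (h x hx2)
  have uniq : ∀ u v : ℝ, (∀ z, ι z < u ↔ ι z < v) → u = v := fun u v h =>
    le_antisymm (le_of _ _ fun z => (h z).1) (le_of _ _ fun z => (h z).2)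
  have ex : ∀ (g : G) (x : ℝ), ∃ y : ℝ, ∀ z : X, ι z < y ↔ ι (act g⁻¹ z) < x := by
    intro g x
    have bdd : BddAbove (ι '' {z | ι (act g⁻¹ z) < x}) := by
      obtain ⟨w, hw, -⟩ := dense x (x + 1) (by linarith)
      refine ⟨ι (act g w), ?_⟩
      rintro _ ⟨z, hz, rfl⟩
      have : act g⁻¹ z < w := ιmono.lt_iff_lt.1 (lt_trans hz hw)
      have := hs g this
      rw [← hm, mul_inv_cancel, h1] at this
      exact (ιmono this).le
    refine ⟨sSup (ι '' {z | ι (act g⁻¹ z) < x}), fun z => ⟨fun h => ?_, fun h => ?_⟩⟩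
    · have hne : (ι '' {z | ι (act g⁻¹ z) < x}).Nonempty := by
        obtain ⟨w, -, hw⟩ := dense (x - 1) x (by linarith)
        refine ⟨_, act g w, ?_, rfl⟩
        show ι _ < x
        rwa [← hm, inv_mul_cancel, h1]
      obtain ⟨_, ⟨w, hw, rfl⟩, hzw⟩ := exists_lt_of_lt_csSup hne h
      exact lt_trans (ιmono (hs _ (ιmono.lt_iff_lt.1 hzw))) hw
    · obtain ⟨w, hw1, hw2⟩ := dense _ _ h
      have h2 : z < act g w := by
        have := hs g (ιmono.lt_iff_lt.1 hw1)
        rwa [← hm, mul_inv_cancel, h1] at this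
      refine lt_of_lt_of_le (ιmono h2) (le_csSup bdd ⟨_, ?_, rfl⟩)
      show ι _ < x
      rwa [← hm, inv_mul_cancel, h1]
  choose A hA using ex
  have hAs : ∀ g, StrictMono (A g) := by
    intro g u v huv
    obtain ⟨w, hw1, hw2⟩ := dense _ _ huv
    have a1 : ¬ ι (act g w) < A g u := by
      rw [hA, ← hm, inv_mul_cancel, h1]; exact not_lt.2 hw1.le
    have a2 : ι (act g w) < A g v := by
      rw [hA, ← hm, inv_mul_cancel, h1]; exact hw2
    exact lt_of_le_of_lt (not_lt.1 a1) a2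
  obtain ⟨φ, hφ⟩ := P1aux_mkHom A
    (fun x => uniq _ _ fun z => by rw [hA, inv_one, h1])
    (fun g h x => uniq _ _ fun z => by rw [hA, hA, hA, mul_inv_rev, hm]) hAs
  refine ⟨φ, ι, ιmono, fun g x => ?_, dense⟩
  rw [hφ]
  refine uniq _ _ fun z => ?_
  rw [hA, ιmono.lt_iff_lt, ιmono.lt_iff_lt, ← (hs g).lt_iff_lt, ← hm, mul_inv_cancel, h1]

theorem P1aux_sup {G : Type*} [Group G] (φ : G →* (ℝ ≃o ℝ)) (g : G) (x b : ℝ)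
    (hb : ∀ m : ℤ, φ (g ^ m) x ≤ b) :
    ∃ p, φ g p = p ∧ x ≤ p ∧ p ≤ b ∧ (∀ m : ℤ, φ (g ^ m) x ≤ p) ∧
      ∀ y < p, ∃ m : ℤ, y < φ (g ^ m) x := by
  have bdd : BddAbove (Set.range fun m : ℤ => φ (g ^ m) x) := ⟨b, by rintro _ ⟨m, rfl⟩; exact hb m⟩
  refine ⟨⨆ m : ℤ, φ (g ^ m) x, ?_, ?_, ciSup_le hb, fun m => le_ciSup bdd m,
    fun y hy => exists_lt_of_lt_ciSup hy⟩
  · rw [OrderIso.map_ciSup _ bdd]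
    refine Equiv.iSup_congr (Equiv.addLeft (1 : ℤ)) fun m => ?_
    simp [zpow_add]
  · simpa using le_ciSup bdd 0

theorem P1aux_inf {G : Type*} [Group G] (φ : G →* (ℝ ≃o ℝ)) (g : G) (x b : ℝ)
    (hb : ∀ m : ℤ, b ≤ φ (g ^ m) x) :
    ∃ p, φ g p = p ∧ p ≤ x ∧ b ≤ p := by
  have bdd : BddBelow (Set.range fun m : ℤ => φ (g ^ m) x) := ⟨b, by rintro _ ⟨m, rfl⟩; exact hb m⟩
  refine ⟨⨅ m : ℤ, φ (g ^ m) x, ?_, ?_, le_ciInf hb⟩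
  · rw [OrderIso.map_ciInf _ bdd]
    refine Equiv.iInf_congr (Equiv.addLeft (1 : ℤ)) fun m => ?_
    simp [zpow_add]
  · simpa using ciInf_le bdd 0

theorem P1aux_fix {G : Type*} [Group G] (φ : G →* (ℝ ≃o ℝ)) (g : G) (p : ℝ)
    (h : φ g p = p) : φ g⁻¹ p = p := by
  have : φ g⁻¹ (φ g p) = p := by rw [← RelIso.mul_apply, ← map_mul]; simp
  rwa [h] at this

theorem P1aux_fix_pow {G : Type*} [Group G] (φ : G →* (ℝ ≃o ℝ)) (g : G) (p : ℝ)
    (h : φ g p = p) (n : ℕ) : φ (g ^ n) p = p := by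
  induction n with
  | zero => simp
  | succ k ih => rw [pow_succ, map_mul, RelIso.mul_apply, h, ih]

theorem P1aux_fix_zpow {G : Type*} [Group G] (φ : G →* (ℝ ≃o ℝ)) (g : G) (p : ℝ)
    (h : φ g p = p) (n : ℤ) : φ (g ^ n) p = p := by
  cases n with
  | ofNat n => simpa using P1aux_fix_pow φ g p h n
  | negSucc n =>
    rw [zpow_negSucc]; exact P1aux_fix φ _ _ (P1aux_fix_pow φ g p h _)

/-- The dynamical realization. -/
theorem P1aux_real {G : Type*} [Group G] [Countable G] [Nontrivial G]
    (lt : G → G → Prop) (hsto : IsStrictTotalOrder G lt)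
    (hleft : ∀ c a b : G, lt a b → lt (c * a) (c * b)) :
    ∃ (φ : G →* (ℝ ≃o ℝ)) (x0 : ℝ), (∀ a b, lt a b ↔ φ a x0 < φ b x0) ∧
      (∀ y, ∃ a, y < φ a x0) ∧ (∀ y, ∃ a, φ a x0 < y) := by
  classical
  let _ : LinearOrder G := linearOrderOfSTO lt
  have hlt : ∀ a b : G, a < b ↔ lt a b := fun a b => Iff.rfl
  have hl : ∀ c a b : G, a < b → c * a < c * b := hleft
  obtain ⟨k, hk⟩ : ∃ k : G, 1 < k := by
    obtain ⟨k, hk⟩ := exists_ne (1 : G)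
    rcases lt_or_gt_of_ne hk with h | h
    · exact ⟨k⁻¹, by simpa using hl k⁻¹ _ _ h⟩
    · exact ⟨k, h⟩
  have : Nonempty (G ×ₗ ℚ) := ⟨toLex (1, 0)⟩
  have : Countable (G ×ₗ ℚ) := inferInstanceAs (Countable (G × ℚ))
  obtain ⟨φ, ι, hι, heq, hd⟩ := P1aux_extend (X := G ×ₗ ℚ)
    (fun g x => toLex (g * (ofLex x).1, (ofLex x).2))
    (fun x => by simp) (fun g h x => by simp [mul_assoc])
    (fun g x y hxy => by
      rw [Prod.Lex.lt_iff] at hxy ⊢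
      rcases hxy with h | ⟨h, h'⟩
      · left; exact hl _ _ _ h
      · right; exact ⟨by simp [h], h'⟩)
  refine ⟨φ, ι (toLex (1, 0)), fun a b => ?_, fun y => ?_, fun y => ?_⟩
  · rw [heq, heq, hι.lt_iff_lt, Prod.Lex.lt_iff, ← hlt]; simp
  · obtain ⟨x, hx, -⟩ := hd y (y + 1) (by linarith)
    refine ⟨(ofLex x).1 * k, hx.trans ?_⟩
    rw [heq, hι.lt_iff_lt, Prod.Lex.lt_iff]
    left; simpa using hl (ofLex x).1 _ _ hk
  · obtain ⟨x, -, hx⟩ := hd (y - 1) y (by linarith)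
    refine ⟨(ofLex x).1 * k⁻¹, lt_trans ?_ hx⟩
    rw [heq, hι.lt_iff_lt, Prod.Lex.lt_iff]
    left; simpa using hl ((ofLex x).1 * k⁻¹) _ _ hk

/-- Key consequence of `(P₁)`: the increasing version. -/
theorem P1aux_key0 {G : Type*} [Group G] (lt : G → G → Prop) (hP1 : PropertyP1 lt)
    (φ : G →* (ℝ ≃o ℝ)) (x0 : ℝ) (hlt : ∀ a b, lt a b ↔ φ a x0 < φ b x0)
    (hup : ∀ y, ∃ a, y < φ a x0) (g a : G) (p : ℝ)
    (hg : φ a x0 < φ g (φ a x0)) (hp : φ g p = p) (hap : φ a x0 < p)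
    (hlim : ∀ y < p, ∃ k : ℕ, y < φ (g ^ k) (φ a x0))
    (δ : G) (hδ : p < φ δ p) (r : ℝ) (hr : φ g r = r) : r < φ δ p := by
  have hA : ∀ (u v : G) (x : ℝ), φ (u * v) x = φ u (φ v x) := fun u v x => by
    rw [map_mul]; rfl
  have hI : ∀ (u : G) (x : ℝ), φ u⁻¹ (φ u x) = x := fun u x => by rw [← hA]; simp
  set x := φ a x0 with hx
  have hstep : ∀ n : ℕ, φ (g ^ n) x < φ (g ^ (n + 1)) x := fun n => by
    rw [pow_succ, hA]; exact (φ (g ^ n)).strictMono hg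
  have hmono : StrictMono fun n : ℕ => φ (g ^ n) x := strictMono_nat_of_lt_succ hstep
  have hltp : ∀ n : ℕ, φ (g ^ n) x < p := fun n => by
    have := (φ (g ^ n)).strictMono hap
    rwa [P1aux_fix_pow φ g p hp] at this
  have hpow : ∀ n : ℕ, (a⁻¹ * g * a) ^ n = a⁻¹ * g ^ n * a := fun n => by
    have := conj_pow (i := n) (a := a⁻¹) (b := g)
    simpa using this
  have hpow' : ∀ n : ℕ, (a⁻¹ * g * a)⁻¹ ^ n = a⁻¹ * g⁻¹ ^ n * a := fun n => by
    rw [inv_pow, hpow, inv_pow]; group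
  have e1 : ∀ n : ℕ, φ ((a⁻¹ * g * a) ^ n) x0 = φ a⁻¹ (φ (g ^ n) x) := fun n => by
    rw [hpow, hA, hA]
  have e2 : ∀ k : ℕ, φ ((a⁻¹ * δ * a) * (a⁻¹ * g * a) ^ k) x0 = φ a⁻¹ (φ δ (φ (g ^ k) x)) :=
    fun k => by
      rw [hpow, ← hA, hx, ← hA, ← hA]; congr 2; group
  obtain ⟨M, hM⟩ : ∃ M : ℕ, p < φ δ (φ (g ^ M) x) := by
    have : φ δ⁻¹ p < p := by
      have := (φ δ⁻¹).strictMono hδ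
      rwa [hI] at this
    obtain ⟨k, hk⟩ := hlim _ this
    refine ⟨k, ?_⟩
    have := (φ δ).strictMono hk
    rwa [← hA, mul_inv_cancel, map_one] at this
  have h1 : SeqIncr lt (fun n => (a⁻¹ * g * a) ^ n) := fun n _ => by
    show lt _ _
    rw [hlt, e1, e1]
    exact (φ a⁻¹).strictMono (hstep n)
  have h2 : SeqBounded lt (fun n => (a⁻¹ * g * a) ^ n) := by
    obtain ⟨h, hh⟩ := hup (max (φ a⁻¹ p) x0)
    refine ⟨h, fun n _ => ⟨?_, ?_⟩⟩
    · show lt _ _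
      rw [hlt, e1]
      have a1 : φ h⁻¹ x0 < x0 := by
        have := (φ h⁻¹).strictMono (lt_of_le_of_lt (le_max_right _ _) hh)
        rwa [hI] at this
      have a2 : x0 ≤ φ a⁻¹ (φ (g ^ n) x) := by
        have := (φ a⁻¹).monotone (hmono.monotone (Nat.zero_le n))
        simpa [hx, hI] using this
      exact a1.trans_le a2
    · show lt _ _
      rw [hlt, e1]
      exact lt_trans ((φ a⁻¹).strictMono (hltp n)) (lt_of_le_of_lt (le_max_left _ _) hh)
  have h3 : ∃ M : ℕ, ∀ k m : ℕ, M < k → M < m →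
      lt ((a⁻¹ * g * a) ^ m) ((a⁻¹ * δ * a) * (a⁻¹ * g * a) ^ k) := by
    refine ⟨M, fun k m hk _ => ?_⟩
    rw [hlt, e1, e2]
    apply (φ a⁻¹).strictMono
    exact (hltp m).trans (hM.trans ((φ δ).strictMono (hmono hk)))
  obtain ⟨K, hK⟩ := hP1 _ _ h1 h2 h3
  have hfin : φ δ (φ (g ^ K) x) < φ δ p := (φ δ).strictMono (hltp K)
  refine lt_trans ?_ hfin
  obtain ⟨h, hh⟩ := hup (φ a⁻¹ r)
  have main : ∀ w : G, φ w r = r → ∀ n : ℕ, (a⁻¹ * w ^ n * a) = (a⁻¹ * w * a) ^ n →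
      lt h ((a⁻¹ * w ^ n * a) * (a⁻¹ * δ * a) * (a⁻¹ * g * a) ^ K) →
      r < φ δ (φ (g ^ K) x) := by
    intro w hw n _ hl
    rw [hlt, mul_assoc, hA, e2, hA, hA, ← hA a, mul_inv_cancel, map_one] at hl
    have := (φ a⁻¹).lt_iff_lt.1 (hh.trans hl)
    rw [← P1aux_fix_pow φ w r hw n] at this
    exact (φ (w ^ n)).lt_iff_lt.1 this
  rcases hK K le_rfl with ⟨-, hu⟩ | ⟨-, hu⟩
  · obtain ⟨n, -, hn⟩ := hu h
    simp only [] at hn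
    rw [hpow n] at hn
    exact main g hr n (hpow n).symm hn
  · obtain ⟨n, -, hn⟩ := hu h
    simp only [] at hn
    rw [hpow' n] at hn
    refine main g⁻¹ (P1aux_fix φ g r hr) n ?_ hn
    rw [← hpow']; congr 1; group

/-- Key consequence of `(P₁)`. -/
theorem P1aux_key {G : Type*} [Group G] (lt : G → G → Prop) (hP1 : PropertyP1 lt)
    (φ : G →* (ℝ ≃o ℝ)) (x0 : ℝ) (hlt : ∀ a b, lt a b ↔ φ a x0 < φ b x0)
    (hfree : ∀ g, φ g x0 = x0 → g = 1)
    (hup : ∀ y, ∃ a, y < φ a x0) (hdn : ∀ y, ∃ a, φ a x0 < y)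
    (h : G) (h1 : h ≠ 1) (r0 : ℝ) (hr0 : φ h r0 = r0) :
    ∃ p ≤ r0, φ h p = p ∧ ∀ δ, p < φ δ p → ∀ r, φ h r = r → r < φ δ p := by
  have hA : ∀ (u v : G) (x : ℝ), φ (u * v) x = φ u (φ v x) := fun u v x => by
    rw [map_mul]; rfl
  have hI : ∀ (u : G) (x : ℝ), φ u⁻¹ (φ u x) = x := fun u x => by rw [← hA]; simp
  obtain ⟨a, ha⟩ := hdn r0
  have inc : ∀ g : G, φ g r0 = r0 → φ a x0 < φ g (φ a x0) →
      ∃ p ≤ r0, φ g p = p ∧ ∀ δ, p < φ δ p → ∀ r, φ g r = r → r < φ δ p := by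
    intro g hg hga
    obtain ⟨p, hp, hp1, hp2, hp3, hp4⟩ := P1aux_sup φ g (φ a x0) r0 (fun m => by
      have := (φ (g ^ m)).strictMono ha
      rw [P1aux_fix_zpow φ g r0 hg] at this
      exact this.le)
    refine ⟨p, hp2, hp, fun δ hδ r hr => ?_⟩
    refine P1aux_key0 lt hP1 φ x0 hlt hup g a p hga hp ?_ ?_ δ hδ r hr
    · have := hp3 1
      rw [zpow_one] at this
      exact hga.trans_le this
    · intro y hy
      obtain ⟨m, hm⟩ := hp4 y hy
      refine ⟨m.toNat, hm.trans_le ?_⟩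
      have mono : Monotone fun n : ℤ => φ (g ^ n) (φ a x0) := by
        refine monotone_int_of_le_succ fun n => ?_
        rw [zpow_add_one, hA]
        exact (φ (g ^ n)).monotone hga.le
      have := mono (Int.self_le_toNat m)
      simp only [zpow_natCast] at this
      exact this
  have hne : φ h (φ a x0) ≠ φ a x0 := by
    intro he
    apply h1
    have h2 : φ (a⁻¹ * h * a) x0 = x0 := by rw [hA, hA, he, hI]
    have h3 := hfree _ h2
    have : h = a * (a⁻¹ * h * a) * a⁻¹ := by group
    rw [this, h3]; simp
  rcases lt_or_gt_of_ne hne with hl | hl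
  · have h2 : φ a x0 < φ h⁻¹ (φ a x0) := by
      have := (φ h⁻¹).strictMono hl
      rwa [hI] at this
    obtain ⟨p, hp1, hp2, hp3⟩ := inc h⁻¹ (P1aux_fix φ h r0 hr0) h2
    refine ⟨p, hp1, ?_, fun δ hδ r hr => hp3 δ hδ r (P1aux_fix φ h r hr)⟩
    have := P1aux_fix φ h⁻¹ p hp2
    rwa [inv_inv] at this
  · exact inc h hr0 hl

theorem P1aux_main {G : Type*} [Group G] [Countable G] [Nontrivial G]
    (lt : G → G → Prop)
    (hsto : IsStrictTotalOrder G lt)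
    (hleft : ∀ c a b : G, lt a b → lt (c * a) (c * b))
    (hP1 : PropertyP1 lt) :
    ∃ φ : G →* (ℝ ≃o ℝ), ∀ x : G, x ≠ 1 → ∀ u v : ℝ, u < v → φ x u = u → φ x v = v → False := by
  obtain ⟨φ, x0, hlt, hup, hdn⟩ := P1aux_real lt hsto hleft
  have hA : ∀ (u v : G) (x : ℝ), φ (u * v) x = φ u (φ v x) := fun u v x => by
    rw [map_mul]; rfl
  have hI : ∀ (u : G) (x : ℝ), φ u⁻¹ (φ u x) = x := fun u x => by rw [← hA]; simp
  have hfree : ∀ g, φ g x0 = x0 → g = 1 := by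
    intro g hg
    rcases hsto.toTrichotomous.rel_or_eq_or_rel_swap (a := g) (b := 1) with h | h | h
    · rw [hlt, hg] at h; simp at h
    · exact h
    · rw [hlt, hg] at h; simp at h
  have key := P1aux_key lt hP1 φ x0 hlt hfree hup hdn
  by_cases hB : ∃ g : G, g ≠ 1 ∧ ∃ r, φ g r = r
  swap
  · exact ⟨φ, fun x hx u v _ hu _ => hB ⟨x, hx, u, hu⟩⟩
  obtain ⟨g, hg1, r1, hr1⟩ := hB
  obtain ⟨p, -, hp, hpk⟩ := key g hg1 r1 hr1
  have orbUp : ∀ y z : ℝ, ∃ δ, z < φ δ y := by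
    intro y z
    obtain ⟨b, hb⟩ := hdn y
    obtain ⟨a, ha⟩ := hup z
    refine ⟨a * b⁻¹, ha.trans ?_⟩
    rw [hA]
    apply (φ a).strictMono
    have := (φ b⁻¹).strictMono hb
    rwa [hI] at this
  have orbDn : ∀ y z : ℝ, ∃ δ, φ δ y < z := by
    intro y z
    obtain ⟨δ, hδ⟩ := orbUp z y
    refine ⟨δ⁻¹, ?_⟩
    have := (φ δ⁻¹).strictMono hδ
    rwa [hI] at this
  let X := Set.range fun t => φ t p
  have : Countable X := (Set.countable_range _).to_subtype
  have : Nonempty X := ⟨⟨_, 1, rfl⟩⟩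
  have : NoMaxOrder X := ⟨fun x => by
    obtain ⟨δ, hδ⟩ := orbUp p x
    exact ⟨⟨_, δ, rfl⟩, hδ⟩⟩
  have : NoMinOrder X := ⟨fun x => by
    obtain ⟨δ, hδ⟩ := orbDn p x
    exact ⟨⟨_, δ, rfl⟩, hδ⟩⟩
  have : DenselyOrdered X := ⟨by
    rintro ⟨_, t, rfl⟩ ⟨_, s, rfl⟩ hts
    replace hts : φ t p < φ s p := hts
    have hδ : p < φ (t⁻¹ * s) p := by
      have := (φ t⁻¹).strictMono hts
      rwa [hI, ← hA] at this
    generalize hd : t⁻¹ * s = δ at hδ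
    have hs : s = t * δ := by rw [← hd]; group
    by_cases hex : ∃ δ', p < φ δ' p ∧ φ δ' p < φ δ p
    · obtain ⟨δ', h1, h2⟩ := hex
      refine ⟨⟨_, t * δ', rfl⟩, ?_, ?_⟩
      · show φ t p < φ (t * δ') p
        rw [hA]; exact (φ t).strictMono h1
      · show φ (t * δ') p < φ s p
        rw [hs, hA, hA]; exact (φ t).strictMono h2
    · push Not at hex
      have a1 : φ δ p ≤ φ (g * δ) p := hex _ (by
        rw [hA]
        have := (φ g).strictMono hδ
        rwa [hp] at this)
      have a2 : φ δ p ≤ φ (g⁻¹ * δ) p := hex _ (by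
        rw [hA]
        have := (φ g⁻¹).strictMono hδ
        rwa [P1aux_fix φ g p hp] at this)
      have a3 := (φ g).monotone a2
      rw [← hA, ← hA, mul_inv_cancel_left] at a3
      have a4 : φ g (φ δ p) = φ δ p := by rw [← hA]; exact le_antisymm a3 a1
      exact absurd (hpk δ hδ _ a4) (lt_irrefl _)⟩
  have hcl : ∀ (t : G) (x : X), φ t x.1 ∈ X := by
    rintro t ⟨_, s, rfl⟩
    exact ⟨t * s, hA _ _ _⟩
  obtain ⟨ψ, ι, hι, heq, hd⟩ := P1aux_extend (X := X) (fun t x => ⟨φ t x.1, hcl t x⟩)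
    (fun x => by ext; simp) (fun t s x => by ext; exact hA _ _ _)
    (fun t x y hxy => (φ t).strictMono hxy)
  refine ⟨ψ, fun h h1 u v huv hu hv => ?_⟩
  obtain ⟨o1, ho1, ho1'⟩ := hd u v huv
  obtain ⟨o2, ho2, ho2'⟩ := hd _ _ ho1'
  obtain ⟨o0, -, ho0⟩ := hd (u - 1) u (by linarith)
  obtain ⟨o3, ho3, -⟩ := hd v (v + 1) (by linarith)
  have ho12 : o1.1 < o2.1 := hι.lt_iff_lt.1 ho2
  obtain ⟨r0, hr0, hr0o, -⟩ := P1aux_inf φ h o1.1 o0.1 (fun m => by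
    have h2 := (ψ (h ^ m)).strictMono ho1
    rw [P1aux_fix_zpow ψ h u hu, heq] at h2
    exact (hι.lt_iff_lt.1 (ho0.trans h2)).le)
  obtain ⟨r, hr, hro, -⟩ := P1aux_sup φ h o2.1 o3.1 (fun m => by
    have h2 := (ψ (h ^ m)).strictMono ho2'
    rw [P1aux_fix_zpow ψ h v hv, heq] at h2
    exact (hι.lt_iff_lt.1 (h2.trans ho3)).le)
  obtain ⟨w, hwr, hw, hwk⟩ := key h h1 r0 hr0
  obtain ⟨_, t, rfl⟩ := o1
  simp only at ho12 hr0o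
  obtain ⟨δ0, hδ0⟩ := orbUp w o2.1
  have hfixo : φ (t * g * t⁻¹) (φ t p) = φ t p := by rw [hA, hA, hI, hp]
  by_cases hex : ∃ m : ℤ, φ ((t * g * t⁻¹) ^ m) (φ δ0 w) < o2.1
  · obtain ⟨m, hm⟩ := hex
    have h2 : w < φ ((t * g * t⁻¹) ^ m * δ0) w := by
      rw [hA]
      have := (φ ((t * g * t⁻¹) ^ m)).strictMono (ho12.trans hδ0)
      rw [P1aux_fix_zpow φ _ _ hfixo] at this
      exact (hwr.trans hr0o).trans_lt this
    have h3 := hwk _ h2 r hr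
    rw [hA] at h3
    exact absurd (hro.trans_lt h3) (not_lt.2 hm.le)
  · push Not at hex
    obtain ⟨r', hr', -, hrlow⟩ := P1aux_inf φ (t * g * t⁻¹) (φ δ0 w) o2.1 hex
    obtain ⟨s, hs⟩ := o2.2
    simp only at hs
    rw [← hs] at ho12 hrlow
    have h2 : p < φ (t⁻¹ * s) p := by
      have := (φ t⁻¹).strictMono ho12
      rwa [hI, ← hA] at this
    have h3 : φ g (φ t⁻¹ r') = φ t⁻¹ r' := by
      rw [hA, hA] at hr'
      have := congrArg (φ t⁻¹) hr'
      rwa [hI] at this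
    have h4 := hpk _ h2 _ h3
    rw [hA] at h4
    exact absurd ((φ t⁻¹).lt_iff_lt.1 h4) (not_lt.2 hrlow)

/-- A countable group with a left order satisfying property `(P₁)`
embeds into `Homeo₊(ℝ)` (the group of orientation-preserving homeomorphisms of the real
line, i.e. order-isomorphisms of `ℝ`) so that every non-identity element of the image
has at most one fixed point. -/
theorem embeds_in_homeoR_of_P1 [Countable G]
    (lt : G → G → Prop)
    (hsto : IsStrictTotalOrder G lt)
    (hleft : ∀ c a b : G, lt a b → lt (c * a) (c * b))
    (hP1 : PropertyP1 lt) :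
    ∃ φ : G →* (ℝ ≃o ℝ), Function.Injective φ ∧
      ∀ x : G, x ≠ 1 → {p : ℝ | φ x p = p}.encard ≤ 1 := by
  rcases subsingleton_or_nontrivial G with hG | hG
  · exact ⟨1, Function.injective_of_subsingleton _, fun x hx => absurd (Subsingleton.elim x 1) hx⟩
  obtain ⟨φ, hφ⟩ := P1aux_main lt hsto hleft hP1
  refine ⟨φ, ?_, fun x hx => ?_⟩
  · rw [injective_iff_map_eq_one]
    intro x hx
    by_contra hne
    exact hφ x hne 0 1 one_pos (by rw [hx]; rfl) (by rw [hx]; rfl)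
  · rw [Set.encard_le_one_iff]
    intro u v hu hv
    rcases lt_trichotomy u v with h | h | h
    · exact (hφ x hx u v h hu hv).elim
    · exact h
    · exact (hφ x hx v u h hv hu).elim

end
end
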